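/- Let A = {a_1,…,a_p}, p ≥ 2, be distinct points, f ∈ 𝓛_A, A(z) = ∏_{j=1}^p (z−a_j), B = A f'/f ∈ 𝒫_{p−2}. Assume every index n is normal, let P_n, Q_n ∈ 𝒫_n be the Padé polynomials of order n for f with deg P_n = n, and for each n let H_n (monic of degree p−2) and C_n (monic of degree 2p−4) be the polynomials such that P_n, Q_n f and R_n = Q_n f − P_n all satisfy A H_n w'' + [(A'−B)H_n − A H_n'] w' − n(n+1) C_n w = 0. Define v_n(z) = P_n'(z)/(n P_n(z)). Then, for m₂-almost every z ∈ ℂ (m₂ denoting planar Lebesgue measure), v_n(z)² − C_n(z)/(A(z) H_n(z)) → 0 as n → ∞. -/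

import Mathlib

open Polynomial Filter Asymptotics Bornology Topology MeasureTheory

/-- local sub-mean value property at a point -/
def SubMean (v : ℂ → ℝ) (z : ℂ) : Prop :=
  ∀ᶠ r in 𝓝[>] (0:ℝ), v z ≤ Real.circleAverage v z r

lemma mean_eq {v : ℂ → ℝ} {z : ℂ} {r m : ℝ} (hr : 0 < r)
    (hc : ContinuousOn v (Metric.sphere z r)) (hle : ∀ w ∈ Metric.sphere z r, v w ≤ m)
    (hm : m ≤ Real.circleAverage v z r) : ∀ w ∈ Metric.sphere z r, v w = m := by
  intro w hw
  by_contra hne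
  have hlt : v w < m := lt_of_le_of_ne (hle w hw) hne
  have hw' : w ∈ circleMap z r '' Set.Ioc 0 (2 * Real.pi) := by
    rw [image_circleMap_Ioc, abs_of_pos hr]; exact hw
  obtain ⟨θ, hθ, rfl⟩ := hw'
  have hcont : Continuous (fun t => v (circleMap z r t)) :=
    hc.comp_continuous (continuous_circleMap z r) (fun t => circleMap_mem_sphere z hr.le t)
  have := intervalIntegral.integral_lt_integral_of_continuousOn_of_le_of_exists_lt
    (a := 0) (b := 2 * Real.pi) (f := fun t => v (circleMap z r t)) (g := fun _ => m)
    (by positivity) hcont.continuousOn continuousOn_const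
    (fun x _ => hle _ (circleMap_mem_sphere z hr.le x))
    ⟨θ, ⟨hθ.1.le, hθ.2⟩, hlt⟩
  rw [Real.circleAverage] at hm
  simp only [intervalIntegral.integral_const, sub_zero, smul_eq_mul] at this hm
  have h2 : (2 * Real.pi)⁻¹ * ∫ t in (0:ℝ)..(2 * Real.pi), v (circleMap z r t) < m := by
    rw [inv_mul_lt_iff₀ (by positivity)]; exact this
  linarith

lemma ev_sphere_subset {s : Set ℂ} {z : ℂ} (hs : s ∈ 𝓝 z) :
    ∀ᶠ r in 𝓝[>] (0:ℝ), Metric.closedBall z r ⊆ s := by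
  obtain ⟨ε, hε, h⟩ := Metric.mem_nhds_iff.1 hs
  filter_upwards [Ioo_mem_nhdsGT hε] with r hr
  exact (Metric.closedBall_subset_ball hr.2).trans h

lemma weak_max {S : Set ℂ} (hS : IsCompact S) {u : ℂ → ℝ} (hu : ContinuousOn u S) {m : ℝ}
    (h : ∀ z ∈ S, m < u z → ∀ᶠ r in 𝓝[>] (0:ℝ), Metric.sphere z r ⊆ S ∧
      u z ≤ Real.circleAverage u z r) : ∀ z ∈ S, u z ≤ m := by
  intro z1 hz1
  by_contra hcon
  push Not at hcon
  obtain ⟨z0, hz0, hmax⟩ := hS.exists_isMaxOn ⟨z1, hz1⟩ hu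
  have hT : IsCompact {z | z ∈ S ∧ u z = u z0} := by
    have : {z | z ∈ S ∧ u z = u z0} = S ∩ u ⁻¹' {u z0} := by ext; simp
    rw [this]
    exact hS.of_isClosed_subset (hu.preimage_isClosed_of_isClosed hS.isClosed isClosed_singleton)
      Set.inter_subset_left
  obtain ⟨y, hy, hymax⟩ := hT.exists_isMaxOn ⟨z0, hz0, rfl⟩ Complex.continuous_re.continuousOn
  have hmy : m < u y := by rw [hy.2]; exact hcon.trans_le (hmax hz1)
  obtain ⟨r, ⟨hr1, hr2⟩, hr0⟩ := ((h y hy.1 hmy).and self_mem_nhdsWithin).exists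
  have hr0 : 0 < r := hr0
  have := mean_eq hr0 (hu.mono hr1) (m := u z0) (fun w hw => hmax (hr1 hw)) (hy.2 ▸ hr2)
  have hw : y + r ∈ Metric.sphere y r := by simp [abs_of_pos hr0]
  have h3 := hymax (show y + r ∈ {z | z ∈ S ∧ u z = u z0} from ⟨hr1 hw, this _ hw⟩)
  simp at h3
  linarith

lemma SubMean.congr {u v : ℂ → ℝ} {z : ℂ} (h : u =ᶠ[𝓝 z] v) (hu : SubMean u z) : SubMean v z := by
  have := ev_sphere_subset h
  filter_upwards [hu, this, self_mem_nhdsWithin] with r h1 h2 h3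
  have h3 : 0 < r := h3
  rw [← h.self_of_nhds]
  refine h1.trans (le_of_eq (Real.circleAverage_congr_sphere ?_))
  intro x hx
  rw [abs_of_pos h3] at hx
  exact h2 (Metric.sphere_subset_closedBall hx)

lemma ev_circleIntegrable {v : ℂ → ℝ} {z : ℂ} (hv : ∀ᶠ w in 𝓝 z, ContinuousAt v w) :
    ∀ᶠ r in 𝓝[>] (0:ℝ), CircleIntegrable v z r := by
  filter_upwards [ev_sphere_subset hv, self_mem_nhdsWithin] with r h1 h2
  refine ContinuousOn.circleIntegrable (le_of_lt h2) fun x hx => ?_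
  exact (h1 (Metric.sphere_subset_closedBall hx)).continuousWithinAt

lemma SubMean.add {u v : ℂ → ℝ} {z : ℂ} (hu : SubMean u z) (hv : SubMean v z)
    (hcu : ∀ᶠ w in 𝓝 z, ContinuousAt u w) (hcv : ∀ᶠ w in 𝓝 z, ContinuousAt v w) :
    SubMean (fun w => u w + v w) z := by
  filter_upwards [hu, hv, ev_circleIntegrable hcu, ev_circleIntegrable hcv] with r h1 h2 h3 h4
  rw [Real.circleAverage_fun_add h3 h4]; linarith

lemma SubMean.const (c : ℝ) (z : ℂ) : SubMean (fun _ => c) z := by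
  refine Eventually.of_forall fun r => ?_
  rw [Real.circleAverage_const]

lemma SubMean.mul_const {u : ℂ → ℝ} {z : ℂ} (hu : SubMean u z) {c : ℝ} (hc : 0 ≤ c) :
    SubMean (fun w => c * u w) z := by
  filter_upwards [hu] with r h1
  have := Real.circleAverage_fun_smul (a := c) (f := u) (c := z) (R := r)
  simp only [smul_eq_mul] at this
  rw [this]
  exact mul_le_mul_of_nonneg_left h1 hc

lemma SubMean.add_const {u : ℂ → ℝ} {z : ℂ} (hu : SubMean u z) (c : ℝ)
    (hcu : ∀ᶠ w in 𝓝 z, ContinuousAt u w) : SubMean (fun w => u w + c) z :=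
  hu.add (SubMean.const c z) hcu (Eventually.of_forall fun _ => continuousAt_const)

lemma logmean {h z : ℂ} (hz : z ≠ h) : ∀ᶠ r in 𝓝[>] (0:ℝ),
    Real.circleAverage (fun w => Real.log ‖w - h‖) z r = Real.log ‖z - h‖ := by
  have : {w | w ≠ h} ∈ 𝓝 z := isOpen_ne.mem_nhds hz
  filter_upwards [ev_sphere_subset this, self_mem_nhdsWithin] with r h1 h2
  have h2 : 0 < r := h2
  refine AnalyticOnNhd.circleAverage_log_norm_of_ne_zero (g := fun w => w - h) ?_ ?_
  · intro w _; fun_prop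
  · intro u hu; rw [abs_of_pos h2] at hu; exact sub_ne_zero.2 (h1 hu)

lemma logcont {h z : ℂ} (hz : z ≠ h) : ∀ᶠ w in 𝓝 z,
    ContinuousAt (fun w => Real.log ‖w - h‖) w := by
  filter_upwards [isOpen_ne.mem_nhds hz] with w hw
  exact ContinuousAt.log (by fun_prop) (norm_ne_zero_iff.2 (sub_ne_zero.2 hw))

lemma submean_log {h z : ℂ} (hz : z ≠ h) : SubMean (fun w => Real.log ‖w - h‖) z := by
  filter_upwards [logmean hz] with r h1; rw [h1]

lemma submean_neglog {h z : ℂ} (hz : z ≠ h) : SubMean (fun w => -Real.log ‖w - h‖) z := by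
  filter_upwards [logmean hz] with r h1
  have := Real.circleAverage_fun_smul (a := (-1:ℝ)) (f := fun w => Real.log ‖w - h‖) (c := z) (R := r)
  simp only [smul_eq_mul, neg_mul, one_mul] at this
  rw [this, h1]

lemma compl_finite_connected {E : Set ℂ} (hE : E.Finite) : IsConnected Eᶜ :=
  hE.countable.isConnected_compl_of_one_lt_rank (by simp)

lemma liouville {E : Set ℂ} (hE : E.Finite) {v : ℂ → ℝ} (hv : ContinuousOn v Eᶜ)
    (hb : ∃ M, ∀ z ∉ E, v z ≤ M) (hs : ∀ z ∉ E, SubMean v z) :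
    ∃ c, ∀ z ∉ E, v z = c := by
  classical
  obtain ⟨M, hM⟩ := hb
  have hopen : IsOpen Eᶜ := hE.isClosed.isOpen_compl
  have hcat : ∀ z ∉ E, ∀ᶠ w in 𝓝 z, ContinuousAt v w := fun z hz => by
    filter_upwards [hopen.mem_nhds hz] with w hw using hv.continuousAt (hopen.mem_nhds hw)
  obtain ⟨R, hR1, hER⟩ : ∃ R : ℝ, 1 < R ∧ ∀ h ∈ E, ‖h‖ < R := by
    obtain ⟨R, hR⟩ := hE.isBounded.exists_norm_le
    exact ⟨max R 1 + 1, by linarith [le_max_right R 1],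
      fun h hh => by linarith [hR h hh, le_max_left R 1]⟩
  have hcirc : Metric.sphere (0:ℂ) R ⊆ Eᶜ := fun z hz hzE => by
    have := hER z hzE; rw [mem_sphere_zero_iff_norm] at hz; linarith
  obtain ⟨y, hy, hymax⟩ := (isCompact_sphere (0:ℂ) R).exists_isMaxOn
    ⟨(R:ℂ), by simp [abs_of_pos (by linarith : 0 < R)]⟩ (hv.mono hcirc)
  set m := v y with hm
  have hmM : m ≤ M := hM y (hcirc hy)
  -- inside bound
  have hin : ∀ z ∉ E, ‖z‖ ≤ R → v z ≤ m := by
    intro z hz hzR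
    have key : ∀ ε > 0, v z + ε * ∑ h ∈ hE.toFinset, Real.log (‖z - h‖ / (2 * R)) ≤ m := by
      intro ε hε
      set u : ℂ → ℝ := fun w => v w + ε * ∑ h ∈ hE.toFinset, (Real.log ‖w - h‖ + -Real.log (2*R))
        with hu
      have hlog : ∀ w ∉ E, ∀ h ∈ hE.toFinset,
          Real.log (‖w - h‖ / (2*R)) = Real.log ‖w - h‖ + -Real.log (2*R) := by
        intro w hw h hh
        rw [Real.log_div, sub_eq_add_neg]
        · rw [norm_ne_zero_iff, sub_ne_zero]; rintro rfl; exact hw (hE.mem_toFinset.1 hh)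
        · positivity
      have hle0 : ∀ w, ‖w‖ ≤ R → ∀ h ∈ hE.toFinset, Real.log (‖w - h‖ / (2*R)) ≤ 0 := by
        intro w hw h hh
        apply Real.log_nonpos (by positivity)
        rw [div_le_one (by positivity)]
        have := norm_sub_le w h; have := hER h (hE.mem_toFinset.1 hh); linarith
      obtain ⟨η, hη0, hη1, hη2⟩ : ∃ η > 0, (∀ h ∈ E, η ≤ ‖z - h‖) ∧
          M + ε * Real.log (η / (2*R)) ≤ m := by
        have h1 : ∀ᶠ η in 𝓝[>] (0:ℝ), ∀ h ∈ E, η ≤ ‖z - h‖ := by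
          rw [hE.eventually_all]
          intro h hh
          have : 0 < ‖z - h‖ := by rw [norm_pos_iff, sub_ne_zero]; rintro rfl; exact hz hh
          filter_upwards [Ioo_mem_nhdsGT this] with η hη using hη.2.le
        have h2 : ∀ᶠ η in 𝓝[>] (0:ℝ), M + ε * Real.log (η / (2*R)) ≤ m := by
          have t1 : Tendsto (fun η : ℝ => η / (2*R)) (𝓝[>] 0) (𝓝[>] 0) := by
            apply tendsto_nhdsWithin_of_tendsto_nhds_of_eventually_within
            · have : Tendsto (fun η : ℝ => η / (2*R)) (𝓝 0) (𝓝 (0 / (2*R))) :=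
                tendsto_id.div_const _
              rw [zero_div] at this
              exact this.mono_left nhdsWithin_le_nhds
            · filter_upwards [self_mem_nhdsWithin] with x hx
              have : 0 < x := hx
              exact Set.mem_Ioi.2 (by positivity)
          have t2 := Real.tendsto_log_nhdsGT_zero.comp t1
          filter_upwards [t2.eventually_le_atBot ((m - M) / ε)] with η hη
          simp only [Function.comp] at hη
          rw [le_div_iff₀ hε] at hη; linarith
        obtain ⟨η, ⟨h1, h2⟩, h3⟩ := ((h1.and h2).and self_mem_nhdsWithin).exists
        exact ⟨η, h3, h1, h2⟩
      have hS : IsCompact (Metric.closedBall (0:ℂ) R ∩ ⋂ h ∈ E, {w | η ≤ ‖w - h‖}) := by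
        apply (isCompact_closedBall _ _).inter_right
        refine isClosed_biInter fun h _ => isClosed_le continuous_const (by fun_prop)
      have hSE : (Metric.closedBall (0:ℂ) R ∩ ⋂ h ∈ E, {w | η ≤ ‖w - h‖}) ⊆ Eᶜ := by
        rintro w ⟨_, hw⟩ hwE
        have := Set.mem_iInter₂.1 hw w hwE
        simp at this; linarith
      have hucont : ∀ w ∉ E, ContinuousAt u w := by
        intro w hw
        refine (hcat w hw).self_of_nhds.add (continuousAt_const.mul ?_)
        refine tendsto_finsetSum _ fun h hh => ?_
        refine ((logcont ?_).self_of_nhds).add continuousAt_const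
        rintro rfl; exact hw (hE.mem_toFinset.1 hh)
      have := weak_max hS (u := u) (m := m) (fun w hw => (hucont w (hSE hw)).continuousWithinAt) ?_
        z ⟨by simpa using hzR, by simpa using hη1⟩
      · rw [hu] at this; rw [Finset.sum_congr rfl (hlog z hz)]; exact this
      · intro w hw hmw
        have hwE := hSE hw
        have hwR : ‖w‖ ≤ R := by simpa using hw.1
        have hwη : ∀ h ∈ E, η ≤ ‖w - h‖ := by simpa using hw.2
        have huw : u w = v w + ε * ∑ h ∈ hE.toFinset, Real.log (‖w - h‖ / (2*R)) := by
          rw [Finset.sum_congr rfl (hlog w hwE)]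
        have hsub : SubMean u w := by
          refine (hs w hwE).add (SubMean.mul_const ?_ hε.le) (hcat w hwE) ?_
          · have : ∀ T : Finset ℂ, (∀ h ∈ T, w ≠ h) →
              SubMean (fun w => ∑ h ∈ T, (Real.log ‖w - h‖ + -Real.log (2*R))) w ∧
              ∀ᶠ x in 𝓝 w, ContinuousAt (fun w => ∑ h ∈ T, (Real.log ‖w - h‖ + -Real.log (2*R))) x := by
              intro T
              induction T using Finset.induction_on with
              | empty => intro _; simp only [Finset.sum_empty]; exact ⟨SubMean.const _ _, Eventually.of_forall fun _ => continuousAt_const⟩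
              | insert h T hh ih =>
                intro hT
                obtain ⟨i1, i2⟩ := ih fun h hh => hT h (Finset.mem_insert_of_mem hh)
                have hne := hT h (Finset.mem_insert_self _ _)
                simp only [Finset.sum_insert hh]
                have c1 : ∀ᶠ x in 𝓝 w, ContinuousAt (fun w => Real.log ‖w - h‖ + -Real.log (2*R)) x := by
                  filter_upwards [logcont hne] with x hx using hx.add continuousAt_const
                refine ⟨((submean_log hne).add_const _ (logcont hne)).add i1 c1 i2, ?_⟩
                filter_upwards [c1, i2] with x h1 h2 using h1.add h2
            refine (this _ ?_).1
            rintro h hh rfl; exact hwE (hE.mem_toFinset.1 hh)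
          · filter_upwards [hopen.mem_nhds hwE] with x hx
            refine continuousAt_const.mul ?_
            refine tendsto_finsetSum _ fun h hh => ?_
            refine ((logcont ?_).self_of_nhds).add continuousAt_const
            rintro rfl; exact hx (hE.mem_toFinset.1 hh)
        have hwR' : ‖w‖ < R := by
          refine lt_of_le_of_ne hwR fun he => ?_
          have h1 : v w ≤ m := hymax (by simpa using he)
          have : ∑ h ∈ hE.toFinset, Real.log (‖w - h‖ / (2*R)) ≤ 0 :=
            Finset.sum_nonpos (hle0 w hwR)
          nlinarith
        have hwη' : ∀ h ∈ E, η < ‖w - h‖ := by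
          intro h hh
          refine lt_of_le_of_ne (hwη h hh) fun he => ?_
          have : ∑ h ∈ hE.toFinset, Real.log (‖w - h‖ / (2*R)) ≤ Real.log (η / (2*R)) := by
            rw [← Finset.add_sum_erase _ _ (hE.mem_toFinset.2 hh), ← he]
            have := Finset.sum_nonpos (s := hE.toFinset.erase h)
              (fun i hi => hle0 w hwR i (Finset.mem_of_mem_erase hi))
            linarith
          have := hM w hwE
          nlinarith
        have hnhds : (Metric.closedBall (0:ℂ) R ∩ ⋂ h ∈ E, {w | η ≤ ‖w - h‖}) ∈ 𝓝 w := by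
          refine inter_mem (Metric.closedBall_mem_nhds_of_mem (by simpa using hwR')) ?_
          rw [biInter_mem hE]
          intro h hh
          have : IsOpen {w : ℂ | η < ‖w - h‖} := isOpen_lt continuous_const (by fun_prop)
          exact mem_of_superset (this.mem_nhds (hwη' h hh)) fun x hx => le_of_lt (Set.mem_setOf_eq ▸ hx)
        filter_upwards [hsub, ev_sphere_subset hnhds] with r h1 h2
        exact ⟨Metric.sphere_subset_closedBall.trans h2, h1⟩
    have hlim : Tendsto (fun ε : ℝ => v z + ε * ∑ h ∈ hE.toFinset, Real.log (‖z - h‖ / (2 * R)))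
        (𝓝[>] 0) (𝓝 (v z + 0 * ∑ h ∈ hE.toFinset, Real.log (‖z - h‖ / (2 * R)))) := by
      apply Tendsto.mono_left _ nhdsWithin_le_nhds
      exact tendsto_const_nhds.add (tendsto_id.mul_const _)
    have := le_of_tendsto hlim (by filter_upwards [self_mem_nhdsWithin] with ε hε using key ε hε)
    simpa using this
  have hout : ∀ z ∉ E, R ≤ ‖z‖ → v z ≤ m := by
    intro z hz hzR
    have key : ∀ ε > 0, v z + ε * (-Real.log ‖z‖ + Real.log R) ≤ m := by
      intro ε hε
      obtain ⟨R', hR'1, hR'2⟩ : ∃ R', ‖z‖ ≤ R' ∧ M + ε * (-Real.log R' + Real.log R) ≤ m := by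
        have h1 := Real.tendsto_log_atTop.eventually_ge_atTop ((M - m) / ε + Real.log R)
        obtain ⟨R', h1, h2⟩ := (h1.and (eventually_ge_atTop ‖z‖)).exists
        refine ⟨R', h2, ?_⟩
        have h3 : (M - m) / ε ≤ Real.log R' - Real.log R := by linarith
        rw [div_le_iff₀ hε] at h3; linarith
      set S := Metric.closedBall (0:ℂ) R' ∩ {w | R ≤ ‖w‖} with hSdef
      have hS : IsCompact S :=
        (isCompact_closedBall _ _).inter_right (isClosed_le continuous_const continuous_norm)
      have hSE : S ⊆ Eᶜ := fun w hw hwE => by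
        have := hER w hwE; have := hw.2; simp at this; linarith
      have hS0 : ∀ w ∈ S, w ≠ 0 := by
        rintro w hw rfl; have := hw.2; simp at this; linarith
      set u : ℂ → ℝ := fun w => v w + ε * (-Real.log ‖w - 0‖ + Real.log R) with hu
      have hc2 : ∀ w : ℂ, w ≠ 0 → ∀ᶠ x in 𝓝 w,
          ContinuousAt (fun w => ε * (-Real.log ‖w - 0‖ + Real.log R)) x := by
        intro w hw
        filter_upwards [logcont hw] with x hx
        exact continuousAt_const.mul (hx.neg.add continuousAt_const)
      have := weak_max hS (u := u) (m := m) ?_ ?_ z ⟨by simpa using hR'1, hzR⟩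
      · simpa [hu] using this
      · intro w hw
        exact ((hcat w (hSE hw)).self_of_nhds.add (hc2 w (hS0 w hw)).self_of_nhds).continuousWithinAt
      · intro w hw hmw
        have hwE := hSE hw
        have hsub : SubMean u w := by
          refine (hs w hwE).add (SubMean.mul_const ?_ hε.le) (hcat w hwE) (hc2 w (hS0 w hw))
          refine (submean_neglog (hS0 w hw)).add_const _ ?_
          filter_upwards [logcont (hS0 w hw)] with x hx using hx.neg
        have hw1 : ‖w‖ ≤ R' := by simpa using hw.1
        have hw2 : R ≤ ‖w‖ := hw.2
        have hw1' : ‖w‖ < R' := by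
          refine lt_of_le_of_ne hw1 fun he => ?_
          have := hM w hwE
          simp only [hu, sub_zero, he] at hmw; linarith
        have hw2' : R < ‖w‖ := by
          refine lt_of_le_of_ne hw2 fun he => ?_
          have : v w ≤ m := hymax (by simpa using he.symm)
          simp only [hu, sub_zero, ← he] at hmw; linarith
        have hnhds : S ∈ 𝓝 w := by
          refine inter_mem (Metric.closedBall_mem_nhds_of_mem (by simpa using hw1')) ?_
          have : IsOpen {w : ℂ | R < ‖w‖} := isOpen_lt continuous_const continuous_norm
          exact mem_of_superset (this.mem_nhds hw2') fun x hx => le_of_lt (Set.mem_setOf_eq ▸ hx)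
        filter_upwards [hsub, ev_sphere_subset hnhds] with r h1 h2
        exact ⟨Metric.sphere_subset_closedBall.trans h2, h1⟩
    have hlim : Tendsto (fun ε : ℝ => v z + ε * (-Real.log ‖z‖ + Real.log R))
        (𝓝[>] 0) (𝓝 (v z + 0 * (-Real.log ‖z‖ + Real.log R))) := by
      apply Tendsto.mono_left _ nhdsWithin_le_nhds
      exact tendsto_const_nhds.add (tendsto_id.mul_const _)
    have := le_of_tendsto hlim (by filter_upwards [self_mem_nhdsWithin] with ε hε using key ε hε)
    simpa using this
  have hall : ∀ z ∉ E, v z ≤ m := fun z hz =>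
    (le_total ‖z‖ R).elim (hin z hz) (hout z hz)
  refine ⟨m, ?_⟩
  have hsub : Eᶜ ⊆ {z | z ∉ E ∧ v z = m} := by
    refine (compl_finite_connected hE).isPreconnected.subset_of_closure_inter_subset
      ?_ ⟨y, hcirc hy, hcirc hy, rfl⟩ ?_
    · rw [isOpen_iff_mem_nhds]
      rintro z ⟨hz, hzm⟩
      have h1 := (hs z hz).and ((ev_sphere_subset (hopen.mem_nhds hz)).and self_mem_nhdsWithin)
      obtain ⟨δ, hδ, h2⟩ := mem_nhdsGT_iff_exists_Ioo_subset.1 h1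
      refine Metric.mem_nhds_iff.2 ⟨δ, hδ, fun w hw => ?_⟩
      by_cases hwz : w = z
      · subst hwz; exact ⟨hz, hzm⟩
      have hpos : 0 < dist w z := dist_pos.2 hwz
      obtain ⟨g1, g2, g3⟩ := h2 ⟨hpos, hw⟩
      have hsph : Metric.sphere z (dist w z) ⊆ Eᶜ := Metric.sphere_subset_closedBall.trans g2
      exact ⟨hsph (by rw [Metric.mem_sphere]), mean_eq hpos (hv.mono hsph) (fun x hx => hall x (hsph hx))
        (by rw [← hzm]; exact g1) w (by rw [Metric.mem_sphere])⟩
    · rintro z ⟨hzc, hz⟩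
      refine ⟨hz, ?_⟩
      have : z ∈ closure {z | z ∉ E ∧ v z = m} := hzc
      have hfr := mem_closure_iff_frequently.1 this
      have hc := (hcat z hz).self_of_nhds
      by_contra hne
      have := hc.eventually_ne hne
      obtain ⟨x, hx1, hx2⟩ := (hfr.and_eventually this).exists
      exact hx2 hx1.2
  exact fun z hz => (hsub hz).2

lemma clopen_all {S : Set ℂ} (hS : IsPreconnected S) {p : ℂ → Prop}
    (hop : ∀ x ∈ S, p x → ∀ᶠ y in 𝓝 x, p y) (hcl : ∀ x ∈ S, ¬ p x → ∀ᶠ y in 𝓝 x, ¬ p y)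
    {x0 : ℂ} (hx0 : x0 ∈ S) (hp : p x0) : ∀ x ∈ S, p x := by
  intro x hx
  by_contra hnp
  have hu : IsOpen {x | ∀ᶠ y in 𝓝 x, p y} := by
    rw [isOpen_iff_mem_nhds]; exact fun x hx => eventually_eventually_nhds.2 hx
  have hv : IsOpen {x | ∀ᶠ y in 𝓝 x, ¬ p y} := by
    rw [isOpen_iff_mem_nhds]; exact fun x hx => eventually_eventually_nhds.2 hx
  obtain ⟨y, _, h1, h2⟩ := hS _ _ hu hv (fun y hy => by
    by_cases h : p y
    · exact Or.inl (hop y hy h)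
    · exact Or.inr (hcl y hy h)) ⟨x0, hx0, hop x0 hx0 hp⟩ ⟨x, hx, hcl x hx hnp⟩
  have h1 : ∀ᶠ y in 𝓝 y, p y := h1
  have h2 : ∀ᶠ y in 𝓝 y, ¬ p y := h2
  exact h2.self_of_nhds h1.self_of_nhds

/-- `F` is a branch of the solution of `A F' = B F` on `U` -/
def Br (A B : ℂ[X]) (F : ℂ → ℂ) (U : Set ℂ) : Prop :=
  ∀ z ∈ U, F z ≠ 0 ∧ A.eval z ≠ 0 ∧ HasDerivAt F (B.eval z * F z / A.eval z) z

lemma Br.mono {A B : ℂ[X]} {F : ℂ → ℂ} {U V : Set ℂ} (h : Br A B F U) (hV : V ⊆ U) : Br A B F V :=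
  fun z hz => h z (hV hz)

lemma Br.smul {A B : ℂ[X]} {F : ℂ → ℂ} {U : Set ℂ} (h : Br A B F U) {l : ℂ} (hl : l ≠ 0) :
    Br A B (fun z => l * F z) U := by
  intro z hz
  obtain ⟨h1, h2, h3⟩ := h z hz
  refine ⟨mul_ne_zero hl h1, h2, ?_⟩
  exact (h3.const_mul l).congr_deriv (by ring)

lemma exists_branch {A B : ℂ[X]} {c : ℂ} {ρ : ℝ} (hA : ∀ z ∈ Metric.ball c ρ, A.eval z ≠ 0)
    {w φ : ℂ} (hφ : φ ≠ 0) :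
    ∃ F, Br A B F (Metric.ball c ρ) ∧ F w = φ := by
  have hd : DifferentiableOn ℂ (fun z => B.eval z / A.eval z) (Metric.ball c ρ) :=
    fun z hz => (B.differentiable.differentiableAt.div A.differentiable.differentiableAt
      (hA z hz)).differentiableWithinAt
  obtain ⟨g, hg⟩ := hd.isExactOn_ball
  refine ⟨fun z => φ * Complex.exp (g z - g w), fun z hz => ⟨?_, hA z hz, ?_⟩, by simp⟩
  · exact mul_ne_zero hφ (Complex.exp_ne_zero _)
  · exact ((((hg z hz).sub_const (g w)).cexp).const_mul φ).congr_deriv (by ring)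

lemma Br.proportional {A B : ℂ[X]} {F G : ℂ → ℂ} {U : Set ℂ} (hU : IsOpen U)
    (hc : IsPreconnected U) (hF : Br A B F U) (hG : Br A B G U) {w : ℂ} (hw : w ∈ U) :
    ∀ z ∈ U, G z = G w / F w * F z := by
  have hd : ∀ z ∈ U, HasDerivAt (fun z => G z / F z) 0 z := by
    intro z hz
    obtain ⟨h1, h2, h3⟩ := hF z hz
    obtain ⟨g1, g2, g3⟩ := hG z hz
    exact (g3.div h3 h1).congr_deriv (by field_simp; ring)
  intro z hz
  have := hU.is_const_of_deriv_eq_zero hc (f := fun z => G z / F z)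
    (fun z hz => (hd z hz).differentiableAt.differentiableWithinAt)
    (fun z hz => (hd z hz).deriv) hz hw
  rw [← this, div_mul_cancel₀ _ (hF z hz).1]

structure LimData (A B : ℂ[X]) (f : ℂ → ℂ) (E : Set ℂ) (N : ℂ → ℝ) (r : ℂ → ℂ → ℝ) (c : ℝ) :
    Prop where
  finE : E.Finite
  EA : ∀ z, A.eval z = 0 → z ∈ E
  contN : ∀ z ∉ E, ContinuousAt N z
  contr : ∀ U F, IsOpen U → U ⊆ Eᶜ → Br A B F U → ∀ z ∈ U, ContinuousAt (fun w => r w (F w)) z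
  subN : ∀ z ∉ E, SubMean N z
  subr : ∀ U F, IsOpen U → U ⊆ Eᶜ → Br A B F U → ∀ z ∈ U, SubMean (fun w => r w (F w)) z
  low : ∀ z ∉ E, ∀ φ ≠ 0, c - N z ≤ r z φ
  up : ∀ z ∉ E, ∀ φ ≠ 0, r z φ ≤ N z
  uniq : ∀ z ∉ E, ∀ φ ≠ 0, ∀ φ' ≠ 0, φ ≠ φ' → r z φ < N z → r z φ' = N z
  lc : ∀ U F, IsOpen U → U ⊆ Eᶜ → Br A B F U → ∀ z ∈ U, r z (F z) < N z → c < N z + r z (F z) →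
    ∀ᶠ w in 𝓝 z, N w - r w (F w) = N z - r z (F z)
  grow : ∃ C R, (∀ z ∉ E, N z ≤ C + Real.log (1 + ‖z‖)) ∧
    (∀ z, R ≤ ‖z‖ → z ∉ E ∧ f z ≠ 0 ∧ r z (f z) ≤ C - Real.log ‖z‖)
  null : volume {z | z ∉ E ∧ N z = c / 2} = 0

lemma liou_ext {E O : Set ℂ} (hE : E.Finite) {h : ℂ → ℝ}
    (hOE : O ⊆ Eᶜ) (hO : IsOpen O) (hc : ∀ z ∉ E, ContinuousAt h z)
    (hpos : ∀ z ∈ O, 0 < h z) (hs : ∀ z ∈ O, SubMean h z)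
    (hcl : ∀ z ∉ E, z ∉ O → 0 < h z → ∀ᶠ w in 𝓝 z, w ∉ O)
    (hb : ∃ M, ∀ z ∈ O, h z ≤ M) :
    O = ∅ ∨ (∃ k, ∀ z ∉ E, z ∈ O ∧ h z = k) := by
  classical
  set v : ℂ → ℝ := fun z => if z ∈ O then h z else 0 with hv
  have hv0 : ∀ z, 0 ≤ v z := fun z => by
    by_cases hz : z ∈ O
    · simp [hv, hz, (hpos z hz).le]
    · simp [hv, hz]
  have hvO : ∀ z ∈ O, h =ᶠ[𝓝 z] v := fun z hz => by
    filter_upwards [hO.mem_nhds hz] with w hw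
    simp [hv, hw]
  have hvc : ∀ z ∉ E, ContinuousAt v z := by
    intro z hz
    by_cases hzO : z ∈ O
    · exact (hc z hz).congr (hvO z hzO)
    · by_cases hp : 0 < h z
      · have : (fun _ => (0:ℝ)) =ᶠ[𝓝 z] v := by
          filter_upwards [hcl z hz hzO hp] with w hw
          simp [hv, hw]
        exact continuousAt_const.congr this
      · have h0 : v z = 0 := by simp [hv, hzO]
        rw [ContinuousAt, h0]
        have h1 : Tendsto (fun w => max (h w) 0) (𝓝 z) (𝓝 0) := by
          have := (hc z hz).tendsto.max (tendsto_const_nhds (x := (0:ℝ)))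
          rwa [max_eq_right (not_lt.1 hp)] at this
        refine squeeze_zero hv0 (fun w => ?_) h1
        by_cases hw : w ∈ O <;> simp [hv, hw]
  have hopen : IsOpen Eᶜ := hE.isClosed.isOpen_compl
  obtain ⟨M, hM⟩ := hb
  obtain ⟨k, hk⟩ := liouville hE (v := v) (fun z hz => (hvc z hz).continuousWithinAt)
    ⟨max M 0, fun z hz => by
      by_cases hzO : z ∈ O
      · simp only [hv, hzO, if_true]; exact (hM z hzO).trans (le_max_left _ _)
      · simp [hv, hzO]⟩
    (fun z hz => by
      by_cases hzO : z ∈ O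
      · exact (hs z hzO).congr (hvO z hzO)
      · have : v z = 0 := by simp [hv, hzO]
        refine Eventually.of_forall fun r => ?_
        rw [this]
        exact Real.circleAverage_nonneg_of_nonneg fun x _ => hv0 x)
  by_cases hne : O = ∅
  · exact Or.inl hne
  right
  obtain ⟨y, hy⟩ := Set.nonempty_iff_ne_empty.2 hne
  have hkpos : 0 < k := by
    rw [← hk y (hOE hy)]; simp only [hv, hy, if_true]; exact hpos y hy
  refine ⟨k, fun z hz => ?_⟩
  have := hk z hz
  by_cases hzO : z ∈ O
  · refine ⟨hzO, ?_⟩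
    simpa [hv, hzO] using this
  · simp [hv, hzO] at this; linarith

namespace LimData
variable {A B : ℂ[X]} {f : ℂ → ℂ} {E : Set ℂ} {N : ℂ → ℝ} {r : ℂ → ℂ → ℝ} {c : ℝ}

lemma isOpen (L : LimData A B f E N r c) : IsOpen Eᶜ := L.finE.isClosed.isOpen_compl

lemma half (L : LimData A B f E N r c) {z : ℂ} (hz : z ∉ E) : c / 2 ≤ N z := by
  have h1 := L.low z hz 1 one_ne_zero
  have h2 := L.up z hz 1 one_ne_zero
  linarith

/-- around each point, there is a ball on which branches with any prescribed value exist -/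
lemma ball (L : LimData A B f E N r c) {z : ℂ} (hz : z ∉ E) {s : Set ℂ} (hs : s ∈ 𝓝 z) :
    ∃ ρ > 0, Metric.ball z ρ ⊆ Eᶜ ∧ Metric.ball z ρ ⊆ s ∧
      ∀ w φ, φ ≠ 0 → ∃ F, Br A B F (Metric.ball z ρ) ∧ F w = φ := by
  obtain ⟨ρ, hρ, h⟩ := Metric.mem_nhds_iff.1 (inter_mem (L.isOpen.mem_nhds hz) hs)
  refine ⟨ρ, hρ, h.trans Set.inter_subset_left, h.trans Set.inter_subset_right, fun w φ hφ => ?_⟩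
  exact exists_branch (fun x hx hx0 => (h hx).1 (L.EA x hx0)) hφ

lemma ne_const (L : LimData A B f E N r c) (k : ℝ) (hk : ∀ z ∉ E, N z = k) : False := by
  obtain ⟨C, R, _, h2⟩ := L.grow
  have h3 := Real.tendsto_log_atTop.eventually_gt_atTop (C - c + k)
  obtain ⟨t, ht1, ht2, ht3⟩ := (h3.and ((eventually_ge_atTop R).and (eventually_ge_atTop 0))).exists
  have hn : ‖(t:ℂ)‖ = t := by simp [abs_of_nonneg ht3]
  obtain ⟨g1, g2, g3⟩ := h2 t (by rw [hn]; exact ht2)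
  have := L.low _ g1 _ g2
  rw [hk _ g1] at this
  rw [hn] at g3; linarith

lemma far (L : LimData A B f E N r c) : ∃ C R, 1 ≤ R ∧ (∀ z ∉ E, N z ≤ C + Real.log (1 + ‖z‖)) ∧
    (∀ z, R ≤ ‖z‖ → z ∉ E ∧ f z ≠ 0 ∧ r z (f z) ≤ C - Real.log ‖z‖ ∧ r z (f z) < N z) := by
  obtain ⟨C, R, h1, h2⟩ := L.grow
  have h3 := Real.tendsto_log_atTop.eventually_gt_atTop (C - c / 2)
  obtain ⟨t, ht1⟩ := eventually_atTop.1 h3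
  refine ⟨C, max 1 (max R t), le_max_left _ _, h1, fun z hz => ?_⟩
  have hz1 : R ≤ ‖z‖ := ((le_max_left R t).trans (le_max_right 1 _)).trans hz
  have hz2 : t ≤ ‖z‖ := ((le_max_right R t).trans (le_max_right 1 _)).trans hz
  obtain ⟨g1, g2, g3⟩ := h2 z hz1
  have := ht1 _ hz2
  have := L.half g1
  exact ⟨g1, g2, g3, by linarith⟩

lemma uniq' (L : LimData A B f E N r c) {z : ℂ} (hz : z ∉ E) {φ φ' : ℂ} (h : φ ≠ 0) (h' : φ' ≠ 0)
    (h1 : r z φ < N z) (h2 : r z φ' < N z) : φ = φ' := by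
  by_contra hne
  have := L.uniq z hz φ h φ' h' hne h1
  linarith

lemma rlt (L : LimData A B f E N r c) {z : ℂ} (hz : z ∉ E) {φ : ℂ} (hφ : φ ≠ 0)
    (h : r z φ < N z) : r z φ = c - N z := by
  by_contra hne
  have he : c < N z + r z φ := by
    have := L.low z hz φ hφ
    have : c - N z < r z φ := lt_of_le_of_ne this (Ne.symm hne)
    linarith
  set d := N z - r z φ with hd
  have hdpos : 0 < d := by linarith
  set O : Set ℂ := {w | w ∉ E ∧ 0 < 2 * N w - d - c ∧ ∃ ψ, ψ ≠ 0 ∧ N w - r w ψ = d} with hO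
  have hcont : ∀ z ∉ E, ContinuousAt (fun w => 2 * N w - d - c) z := fun z hz =>
    ((continuousAt_const.mul (L.contN z hz)).sub continuousAt_const).sub continuousAt_const
  have hOo : ∀ w ∈ O, ∀ᶠ y in 𝓝 w, y ∈ O := by
    rintro w ⟨hw, hw1, ψ, hψ, hw2⟩
    obtain ⟨ρ, hρ, hρE, -, hF⟩ := L.ball hw univ_mem
    obtain ⟨F, hF, hFw⟩ := hF w ψ hψ
    have := L.lc _ F Metric.isOpen_ball hρE hF w (Metric.mem_ball_self hρ)
      (by rw [hFw]; linarith) (by rw [hFw]; linarith)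
    filter_upwards [this, (hcont w hw).eventually_const_lt hw1, Metric.ball_mem_nhds w hρ] with y h1 h2 h3
    exact ⟨hρE h3, h2, F y, (hF y h3).1, by rw [h1, hFw, hw2]⟩
  have := liou_ext (O := O) (h := fun w => 2 * N w - d - c) L.finE (fun w hw => hw.1)
    (isOpen_iff_mem_nhds.2 hOo) hcont (fun w hw => hw.2.1) ?_ ?_ ?_
  · rcases this with h0 | ⟨k, hk⟩
    · have : z ∈ O := ⟨hz, by linarith, φ, hφ, rfl⟩
      rw [h0] at this; exact this
    · exact L.ne_const ((k + d + c) / 2) fun w hw => by have := (hk w hw).2; linarith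
  · intro w hw
    have h1 := (L.subN w hw.1).mul_const (c := 2) (by norm_num)
    have h2 := h1.add_const (-d - c) (by
      filter_upwards [L.isOpen.mem_nhds hw.1] with x hx using continuousAt_const.mul (L.contN x hx))
    refine h2.congr (Eventually.of_forall fun x => ?_)
    ring
  · intro w hw hwO hpos
    obtain ⟨ρ, hρ, hρE, hρ2, hF⟩ := L.ball hw ((hcont w hw).eventually_const_lt hpos)
    filter_upwards [Metric.ball_mem_nhds w hρ] with y hy hyO
    obtain ⟨h1, h2, ψ, hψ, h3⟩ := hyO
    obtain ⟨F, hF, hFy⟩ := hF y ψ hψ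
    have := clopen_all (convex_ball w ρ).isPreconnected (p := fun x => N x - r x (F x) = d) ?_ ?_ hy
      (by rw [hFy]; exact h3) w (Metric.mem_ball_self hρ)
    · exact hwO ⟨hw, hpos, F w, (hF w (Metric.mem_ball_self hρ)).1, this⟩
    · intro x hx hpx
      have hx2 : 0 < 2 * N x - d - c := hρ2 hx
      filter_upwards [L.lc _ F Metric.isOpen_ball hρE hF x hx (by linarith) (by linarith)] with t ht
      rw [ht, hpx]
    · intro x hx hpx
      exact ((L.contN x (hρE hx)).sub (L.contr _ F Metric.isOpen_ball hρE hF x hx)).eventually_ne hpx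
  · obtain ⟨C, R, hR1, h1, h2⟩ := L.far
    refine ⟨max (2 * (C + Real.log (1 + R)) - d - c) (2 * (d + C) - d - c), fun w hw => ?_⟩
    obtain ⟨g1, g2, ψ, hψ, g3⟩ := hw
    rcases le_total ‖w‖ R with hwR | hwR
    · apply le_max_of_le_left
      have := h1 w g1
      have : Real.log (1 + ‖w‖) ≤ Real.log (1 + R) := Real.log_le_log (by positivity) (by linarith)
      linarith
    · apply le_max_of_le_right
      obtain ⟨k1, k2, k3, k4⟩ := h2 w hwR
      have : ψ = f w := L.uniq' k1 hψ k2 (by linarith) k4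
      subst this
      have : 0 ≤ Real.log ‖w‖ := Real.log_nonneg (by linarith)
      linarith

lemma D_of_gt (L : LimData A B f E N r c) {z : ℂ} (hz : z ∉ E) (h : c / 2 < N z) :
    ∃ φ, φ ≠ 0 ∧ r z φ = c - N z := by
  set D : Set ℂ := {w | ∃ φ, φ ≠ 0 ∧ r w φ < N w} with hD
  have hDo : ∀ w ∉ E, w ∈ D → ∀ᶠ y in 𝓝 w, y ∈ D := by
    rintro w hw ⟨ψ, hψ, hw2⟩
    obtain ⟨ρ, hρ, hρE, -, hF⟩ := L.ball hw univ_mem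
    obtain ⟨F, hF, hFw⟩ := hF w ψ hψ
    have hc := L.contr _ F Metric.isOpen_ball hρE hF w (Metric.mem_ball_self hρ)
    have := hc.eventually_lt (L.contN w hw) (by rw [hFw]; exact hw2)
    filter_upwards [this, Metric.ball_mem_nhds w hρ] with y h1 h3
    exact ⟨F y, (hF y h3).1, h1⟩
  have hDc : ∀ w ∉ E, w ∉ D → c / 2 < N w → ∀ᶠ y in 𝓝 w, y ∉ D := by
    intro w hw hwD hpos
    obtain ⟨ρ, hρ, hρE, hρ2, hF⟩ := L.ball hw ((L.contN w hw).eventually_const_lt hpos)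
    filter_upwards [Metric.ball_mem_nhds w hρ] with y hy hyD
    obtain ⟨ψ, hψ, h3⟩ := hyD
    obtain ⟨F, hF, hFy⟩ := hF y ψ hψ
    have := clopen_all (convex_ball w ρ).isPreconnected (p := fun x => r x (F x) < N x) ?_ ?_ hy
      (by rw [hFy]; exact h3) w (Metric.mem_ball_self hρ)
    · exact hwD ⟨F w, (hF w (Metric.mem_ball_self hρ)).1, this⟩
    · intro x hx hpx
      exact (L.contr _ F Metric.isOpen_ball hρE hF x hx).eventually_lt (L.contN x (hρE hx)) hpx
    · intro x hx hpx
      have hx2 : c / 2 < N x := hρ2 hx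
      have h1 : c - N x < r x (F x) := by linarith
      have h2 : ∀ᶠ t in 𝓝 x, c - N t < r t (F t) :=
        (continuousAt_const.sub (L.contN x (hρE hx))).eventually_lt
          (L.contr _ F Metric.isOpen_ball hρE hF x hx) h1
      filter_upwards [h2, Metric.isOpen_ball.mem_nhds hx] with t ht htb hlt
      have := L.rlt (hρE htb) (hF t htb).1 hlt
      linarith
  have := liou_ext (O := {w | w ∉ E ∧ c / 2 < N w ∧ w ∉ D}) (h := fun w => N w + -(c / 2)) L.finE
    (fun w hw => hw.1) ?_ (fun w hw => (L.contN w hw).add continuousAt_const)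
    (fun w hw => by have := hw.2.1; linarith) ?_ ?_ ?_
  · rcases this with h0 | ⟨k, hk⟩
    · have hzD : z ∈ D := by
        by_contra hzD
        have : z ∈ {w | w ∉ E ∧ c / 2 < N w ∧ w ∉ D} := ⟨hz, h, hzD⟩
        rw [h0] at this; exact this
      obtain ⟨φ, h1, h2⟩ := hzD
      exact ⟨φ, h1, L.rlt hz h1 h2⟩
    · exact (L.ne_const (k + c / 2) fun w hw => by have := (hk w hw).2; linarith).elim
  · rw [isOpen_iff_mem_nhds]
    rintro w ⟨h1, h2, h3⟩
    filter_upwards [L.isOpen.mem_nhds h1, (L.contN w h1).eventually_const_lt h2, hDc w h1 h3 h2]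
      with y k1 k2 k3
    exact ⟨k1, k2, k3⟩
  · intro w hw
    exact (L.subN w hw.1).add_const _ (by
      filter_upwards [L.isOpen.mem_nhds hw.1] with x hx using L.contN x hx)
  · intro w hw hwO hpos
    have hwD : w ∈ D := by
      by_contra hwD
      exact hwO ⟨hw, by linarith, hwD⟩
    filter_upwards [hDo w hw hwD] with y hy hyO
    exact hyO.2.2 hy
  · obtain ⟨C, R, hR1, h1, h2⟩ := L.far
    refine ⟨(C + Real.log (1 + R)) + -(c / 2), fun w hw => ?_⟩
    rcases le_total ‖w‖ R with hwR | hwR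
    · have := h1 w hw.1
      have : Real.log (1 + ‖w‖) ≤ Real.log (1 + R) := Real.log_le_log (by positivity) (by linarith)
      linarith
    · obtain ⟨k1, k2, k3, k4⟩ := h2 w hwR
      exact (hw.2.2 ⟨f w, k2, k4⟩).elim

end LimData

namespace LimData
variable {A B : ℂ[X]} {f : ℂ → ℂ} {E : Set ℂ} {N : ℂ → ℝ} {r : ℂ → ℂ → ℝ} {c : ℝ}

lemma shift (L : LimData A B f E N r c) :
    LimData A B f E (fun z => N z + -(c/2)) (fun z φ => r z φ + -(c/2)) 0 where
  finE := L.finE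
  EA := L.EA
  contN := fun z hz => (L.contN z hz).add continuousAt_const
  contr := fun U F h1 h2 h3 z hz => (L.contr U F h1 h2 h3 z hz).add continuousAt_const
  subN := fun z hz => (L.subN z hz).add_const _ (by
      filter_upwards [L.isOpen.mem_nhds hz] with x hx using L.contN x hx)
  subr := fun U F h1 h2 h3 z hz => (L.subr U F h1 h2 h3 z hz).add_const _ (by
      filter_upwards [h1.mem_nhds hz] with x hx using L.contr U F h1 h2 h3 x hx)
  low := fun z hz φ hφ => by have := L.low z hz φ hφ; linarith
  up := fun z hz φ hφ => by have := L.up z hz φ hφ; linarith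
  uniq := fun z hz φ hφ φ' hφ' hne h => by
    have := L.uniq z hz φ hφ φ' hφ' hne (by linarith); linarith
  lc := fun U F h1 h2 h3 z hz h4 h5 => by
    filter_upwards [L.lc U F h1 h2 h3 z hz (by linarith) (by linarith)] with w hw
    linarith
  grow := by
    obtain ⟨C, R, h1, h2⟩ := L.grow
    refine ⟨C + |c/2|, R, fun z hz => ?_, fun z hz => ⟨(h2 z hz).1, (h2 z hz).2.1, ?_⟩⟩
    · have := h1 z hz; have := neg_abs_le (c/2); linarith
    · have := (h2 z hz).2.2; have := neg_abs_le (c/2); linarith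
  null := by
    refine measure_mono_null (fun z hz => ?_) L.null
    have h2 : N z + -(c/2) = 0 / 2 := hz.2
    exact ⟨hz.1, by linarith⟩

lemma enlarge (L : LimData A B f E N r c) {E' : Set ℂ} (hE' : E'.Finite) (h : E ⊆ E') :
    LimData A B f E' N r c where
  finE := hE'
  EA := fun z hz => h (L.EA z hz)
  contN := fun z hz => L.contN z fun h' => hz (h h')
  contr := fun U F h1 h2 h3 => L.contr U F h1 (h2.trans (Set.compl_subset_compl.2 h)) h3
  subN := fun z hz => L.subN z fun h' => hz (h h')
  subr := fun U F h1 h2 h3 => L.subr U F h1 (h2.trans (Set.compl_subset_compl.2 h)) h3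
  low := fun z hz => L.low z fun h' => hz (h h')
  up := fun z hz => L.up z fun h' => hz (h h')
  uniq := fun z hz => L.uniq z fun h' => hz (h h')
  lc := fun U F h1 h2 h3 => L.lc U F h1 (h2.trans (Set.compl_subset_compl.2 h)) h3
  grow := by
    obtain ⟨C, R, h1, h2⟩ := L.grow
    obtain ⟨R', hR'⟩ := hE'.isBounded.exists_norm_le
    refine ⟨C, max R (R' + 1), fun z hz => h1 z fun h' => hz (h h'), fun z hz => ⟨fun hz' => ?_,
      (h2 z ((le_max_left _ _).trans hz)).2⟩⟩
    have := hR' z hz'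
    have := (le_max_right R (R' + 1)).trans hz
    linarith
  null := by
    refine measure_mono_null (fun z hz => ?_) L.null
    exact ⟨fun h' => hz.1 (h h'), hz.2⟩

lemma dich (L : LimData A B f E N r 0) {z : ℂ} (hz : z ∉ E) {φ : ℂ} (hφ : φ ≠ 0) :
    (r z φ = N z ∧ 0 ≤ N z) ∨ (r z φ = -N z ∧ 0 < N z) := by
  have h0 := L.half hz
  rcases eq_or_lt_of_le (L.up z hz φ hφ) with h | h
  · exact Or.inl ⟨h, by linarith⟩
  · have := L.rlt hz hφ h
    exact Or.inr ⟨by linarith, by linarith⟩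

lemma neg_submean (L : LimData A B f E N r 0) {z : ℂ} (hz : z ∉ E) (h : 0 < N z) :
    SubMean (fun w => -N w) z := by
  obtain ⟨φ, hφ, h1⟩ := L.D_of_gt hz (by linarith)
  obtain ⟨ρ, hρ, hρE, -, hF⟩ := L.ball hz univ_mem
  obtain ⟨F, hF, hFw⟩ := hF z φ hφ
  have hc := L.contr _ F Metric.isOpen_ball hρE hF z (Metric.mem_ball_self hρ)
  have h2 : ∀ᶠ w in 𝓝 z, r w (F w) < 0 := hc.eventually_lt_const (by simp only [hFw]; linarith)
  refine (L.subr _ F Metric.isOpen_ball hρE hF z (Metric.mem_ball_self hρ)).congr ?_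
  filter_upwards [h2, Metric.ball_mem_nhds z hρ] with w hw hwb
  rcases L.dich (hρE hwb) (hF w hwb).1 with h | h <;> linarith

end LimData

lemma submean_sq {q : ℂ → ℝ} {z : ℂ} (hq : SubMean q z) (hn : 0 ≤ q z ∨ SubMean (fun w => - q w) z)
    (hc : ∀ᶠ w in 𝓝 z, ContinuousAt q w) : SubMean (fun w => q w ^ 2) z := by
  have key : SubMean (fun w => 2 * q z * q w) z := by
    rcases hn with h | h
    · exact hq.mul_const (by linarith)
    · rcases le_total 0 (q z) with h0 | h0
      · exact hq.mul_const (by linarith)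
      · have := h.mul_const (c := - (2 * q z)) (by linarith)
        exact this.congr (Eventually.of_forall fun x => by simp)
  have hc2 : ∀ᶠ w in 𝓝 z, ContinuousAt (fun w => q w ^ 2) w := by
    filter_upwards [hc] with w hw using hw.pow 2
  have hc3 : ∀ᶠ w in 𝓝 z, ContinuousAt (fun w => 2 * q z * q w + -(q z)^2) w := by
    filter_upwards [hc] with w hw using (continuousAt_const.mul hw).add continuousAt_const
  have k2 := key.add_const (-(q z)^2) (by
    filter_upwards [hc] with w hw using continuousAt_const.mul hw)
  filter_upwards [k2, ev_circleIntegrable hc2, ev_circleIntegrable hc3] with r h1 h2 h3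
  have := Real.circleAverage_mono h3 h2 (fun x _ => by nlinarith [sq_nonneg (q x - q z)])
  nlinarith

lemma preconn_far (R : ℝ) (hR : 0 < R) : IsPreconnected {z : ℂ | R < ‖z‖} := by
  have h : {z : ℂ | R < ‖z‖} = Complex.exp '' {w : ℂ | Real.log R < w.re} := by
    ext z
    constructor
    · intro hz
      have hz : R < ‖z‖ := hz
      have hz0 : z ≠ 0 := by rintro rfl; simp at hz; linarith
      refine ⟨Complex.log z, ?_, Complex.exp_log hz0⟩
      show Real.log R < _
      rw [Complex.log_re]; exact Real.log_lt_log hR hz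
    · rintro ⟨w, hw, rfl⟩
      have hw : Real.log R < w.re := hw
      show R < _
      rw [Complex.norm_exp]
      rwa [← Real.log_lt_iff_lt_exp hR]
  rw [h]
  refine IsPreconnected.image ?_ _ Complex.continuous_exp.continuousOn
  exact (convex_halfSpace_re_gt _).isPreconnected

section
variable {A B : ℂ[X]} {f : ℂ → ℂ} {E : Set ℂ} {N₁ N₂ : ℂ → ℝ} {r₁ r₂ : ℂ → ℂ → ℝ}

/-- same sheet -/
def Same (r₁ r₂ : ℂ → ℂ → ℝ) (z : ℂ) : Prop := ∃ φ, φ ≠ 0 ∧ r₁ z φ < 0 ∧ r₂ z φ < 0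

open Classical in
noncomputable def Psi (N₁ N₂ : ℂ → ℝ) (r₁ r₂ : ℂ → ℂ → ℝ) (z : ℂ) : ℝ :=
  if Same r₁ r₂ z then (N₁ z - N₂ z) ^ 2 else (N₁ z + N₂ z) ^ 2

lemma Same.symm {z : ℂ} (h : Same r₁ r₂ z) : Same r₂ r₁ z := by
  obtain ⟨φ, h1, h2, h3⟩ := h; exact ⟨φ, h1, h3, h2⟩

lemma Psi_symm : Psi N₁ N₂ r₁ r₂ = Psi N₂ N₁ r₂ r₁ := by
  ext z
  unfold Psi
  by_cases h : Same r₁ r₂ z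
  · simp only [h, h.symm, if_true]; ring
  · have : ¬ Same r₂ r₁ z := fun h' => h h'.symm
    simp only [h, this, if_false]; ring

/-- local description of `Psi` near a point of `N₂ > 0`. -/
lemma Psi_local (L₁ : LimData A B f E N₁ r₁ 0) (L₂ : LimData A B f E N₂ r₂ 0) {z : ℂ} (hz : z ∉ E)
    (h2 : 0 < N₂ z) : ∃ U F, IsOpen U ∧ z ∈ U ∧ U ⊆ Eᶜ ∧ Br A B F U ∧
      (∀ w ∈ U, 0 < N₂ w ∧ r₂ w (F w) = - N₂ w ∧ Psi N₁ N₂ r₁ r₂ w = (N₂ w + r₁ w (F w)) ^ 2 ∧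
        (Same r₁ r₂ w ↔ r₁ w (F w) < 0)) := by
  obtain ⟨φ, hφ, h1⟩ := L₂.D_of_gt hz (by linarith)
  obtain ⟨ρ, hρ, hρE, -, hF⟩ := L₂.ball hz univ_mem
  obtain ⟨F, hF, hFw⟩ := hF z φ hφ
  have hc := L₂.contr _ F Metric.isOpen_ball hρE hF z (Metric.mem_ball_self hρ)
  have h3 : ∀ᶠ w in 𝓝 z, r₂ w (F w) < 0 := hc.eventually_lt_const (by simp only [hFw]; linarith)
  obtain ⟨U, hUs, hU, hzU⟩ := mem_nhds_iff.1 (inter_mem h3 (Metric.ball_mem_nhds z hρ))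
  have hUb : U ⊆ Metric.ball z ρ := fun x hx => (hUs hx).2
  refine ⟨U, F, hU, hzU, hUb.trans hρE, hF.mono hUb, fun w hw => ?_⟩
  have hw1 : r₂ w (F w) < 0 := (hUs hw).1
  have hwE := hρE (hUb hw)
  have hF0 := (hF w (hUb hw)).1
  have hN2 : 0 < N₂ w ∧ r₂ w (F w) = - N₂ w := by
    rcases L₂.dich hwE hF0 with h | h
    · linarith
    · exact ⟨h.2, h.1⟩
  have hS : Same r₁ r₂ w ↔ r₁ w (F w) < 0 := by
    constructor
    · rintro ⟨ψ, k1, k2, k3⟩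
      have : ψ = F w := L₂.uniq' hwE k1 hF0 (by linarith) (by linarith)
      rwa [← this]
    · intro h; exact ⟨F w, hF0, h, hw1⟩
  refine ⟨hN2.1, hN2.2, ?_, hS⟩
  unfold Psi
  rcases L₁.dich hwE hF0 with h | h
  · have : ¬ Same r₁ r₂ w := by rw [hS]; linarith
    simp only [this, if_false]; rw [h.1]; ring
  · have : Same r₁ r₂ w := by rw [hS]; linarith
    simp only [this, if_true]; rw [h.1]; ring

lemma Psi_prop (L₁ : LimData A B f E N₁ r₁ 0) (L₂ : LimData A B f E N₂ r₂ 0) {z : ℂ} (hz : z ∉ E)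
    (h2 : 0 < N₂ z) : ContinuousAt (Psi N₁ N₂ r₁ r₂) z ∧ SubMean (Psi N₁ N₂ r₁ r₂) z := by
  obtain ⟨U, F, hU, hzU, hUE, hF, h⟩ := Psi_local L₁ L₂ hz h2
  have heq : (fun w => (N₂ w + r₁ w (F w)) ^ 2) =ᶠ[𝓝 z] Psi N₁ N₂ r₁ r₂ := by
    filter_upwards [hU.mem_nhds hzU] with w hw
    exact (h w hw).2.2.1.symm
  have hc1 := L₁.contr U F hU hUE hF
  have hcq : ∀ᶠ w in 𝓝 z, ContinuousAt (fun w => N₂ w + r₁ w (F w)) w := by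
    filter_upwards [hU.mem_nhds hzU] with w hw using (L₂.contN w (hUE hw)).add (hc1 w hw)
  have e1 : ∀ᶠ w in 𝓝 z, ContinuousAt N₂ w := by
    filter_upwards [hU.mem_nhds hzU] with w hw using L₂.contN w (hUE hw)
  have e2 : ∀ᶠ w in 𝓝 z, ContinuousAt (fun w => r₁ w (F w)) w := by
    filter_upwards [hU.mem_nhds hzU] with w hw using hc1 w hw
  refine ⟨(hcq.self_of_nhds.pow 2).congr heq, SubMean.congr heq (submean_sq ?_ ?_ hcq)⟩
  · exact (L₂.subN z hz).add (L₁.subr U F hU hUE hF z hzU) e1 e2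
  · rcases L₁.dich hz (hF z hzU).1 with k | k
    · left; rw [k.1]; linarith
    · right
      have n1 := L₂.neg_submean hz h2
      have n2 := L₁.subN z hz
      have := n1.add n2 (by filter_upwards [e1] with w hw using hw.neg)
        (by filter_upwards [hU.mem_nhds hzU] with w hw using L₁.contN w (hUE hw))
      refine this.congr ?_
      have hneg : ∀ᶠ w in 𝓝 z, r₁ w (F w) < 0 :=
        (hc1 z hzU).eventually_lt_const (by simp only [k.1]; linarith)
      filter_upwards [hneg, hU.mem_nhds hzU] with w hw hwU
      rcases L₁.dich (hUE hwU) (hF w hwU).1 with k' | k' <;> linarith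

lemma Psi_nonneg (z : ℂ) : 0 ≤ Psi N₁ N₂ r₁ r₂ z := by
  unfold Psi; split_ifs <;> positivity

lemma Psi_const (L₁ : LimData A B f E N₁ r₁ 0) (L₂ : LimData A B f E N₂ r₂ 0) :
    ∃ d, 0 ≤ d ∧ ∀ z ∉ E, Psi N₁ N₂ r₁ r₂ z = d ^ 2 := by
  have hall : ∀ z ∉ E, ContinuousAt (Psi N₁ N₂ r₁ r₂) z ∧ SubMean (Psi N₁ N₂ r₁ r₂) z := by
    intro z hz
    have h1 := L₁.half hz
    have h2 := L₂.half hz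
    rcases eq_or_lt_of_le h2 with h2 | h2
    · rcases eq_or_lt_of_le h1 with h1 | h1
      · have h0 : Psi N₁ N₂ r₁ r₂ z = 0 := by
          unfold Psi; rw [← h1, ← h2]; simp
        constructor
        · rw [ContinuousAt, h0]
          have : Tendsto (fun w => (N₁ w + N₂ w) ^ 2) (𝓝 z) (𝓝 0) := by
            have := ((Tendsto.add (L₁.contN z hz) (L₂.contN z hz)).pow 2)
            simpa [← h1, ← h2] using this
          refine squeeze_zero' (Eventually.of_forall fun w => Psi_nonneg w) ?_ this
          filter_upwards [L₁.isOpen.mem_nhds hz] with w hw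
          have k1 := L₁.half hw
          have k2 := L₂.half hw
          unfold Psi; split_ifs <;> nlinarith
        · refine Eventually.of_forall fun r => ?_
          rw [h0]
          exact Real.circleAverage_nonneg_of_nonneg fun x _ => Psi_nonneg x
      · rw [Psi_symm]; exact Psi_prop L₂ L₁ hz (by linarith)
    · exact Psi_prop L₁ L₂ hz (by linarith)
  obtain ⟨C₁, R₁, hR₁, p1, p2⟩ := L₁.far
  obtain ⟨C₂, R₂, hR₂, q1, q2⟩ := L₂.far
  have hbd : ∃ M, ∀ z ∉ E, Psi N₁ N₂ r₁ r₂ z ≤ M := by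
    set R := max R₁ R₂
    refine ⟨max ((C₁ + Real.log (1 + R) + (C₂ + Real.log (1 + R)))^2)
      ((|C₁| + |C₂| + Real.log 2)^2), fun z hz => ?_⟩
    have k1 := L₁.half hz
    have k2 := L₂.half hz
    rcases le_total ‖z‖ R with hzR | hzR
    · apply le_max_of_le_left
      have : Real.log (1 + ‖z‖) ≤ Real.log (1 + R) := Real.log_le_log (by positivity) (by linarith)
      have := p1 z hz
      have := q1 z hz
      have h1 : Psi N₁ N₂ r₁ r₂ z ≤ (N₁ z + N₂ z) ^ 2 := by
        unfold Psi; split_ifs <;> nlinarith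
      refine h1.trans (pow_le_pow_left₀ (by linarith) (by linarith) 2)
    · apply le_max_of_le_right
      obtain ⟨a1, a2, a3, a4⟩ := p2 z ((le_max_left _ _).trans hzR)
      obtain ⟨b1, b2, b3, b4⟩ := q2 z ((le_max_right _ _).trans hzR)
      have hd1 := L₁.rlt hz a2 a4
      have hd2 := L₂.rlt hz a2 b4
      have hS : Same r₁ r₂ z := ⟨f z, a2, by linarith, by linarith⟩
      have hz1 : 1 ≤ ‖z‖ := by linarith [(le_max_left R₁ R₂).trans hzR]
      have hlog : Real.log (1 + ‖z‖) ≤ Real.log 2 + Real.log ‖z‖ := by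
        rw [← Real.log_mul (by norm_num) (by positivity)]
        exact Real.log_le_log (by positivity) (by linarith)
      have := p1 z hz
      have := q1 z hz
      have := le_abs_self C₁
      have := le_abs_self C₂
      unfold Psi; simp only [hS, if_true]
      exact sq_le_sq' (by linarith) (by linarith)
  obtain ⟨k, hk⟩ := liouville L₁.finE (fun z hz => (hall z hz).1.continuousWithinAt) hbd
    (fun z hz => (hall z hz).2)
  obtain ⟨y, hy⟩ := (compl_finite_connected L₁.finE).nonempty
  have hk0 : 0 ≤ k := by rw [← hk y hy]; exact Psi_nonneg y
  exact ⟨√k, Real.sqrt_nonneg _, fun z hz => by rw [hk z hz, Real.sq_sqrt hk0]⟩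

lemma LimData.exists_pos {c : ℝ} {N : ℂ → ℝ} {r : ℂ → ℂ → ℝ} (L : LimData A B f E N r c) {z : ℂ}
    (hz : z ∉ E) {s : Set ℂ} (hs : s ∈ 𝓝 z) : ∃ w ∈ s, w ∉ E ∧ c / 2 < N w := by
  by_contra hcon
  push Not at hcon
  have h1 : s ∩ Eᶜ ∈ 𝓝 z := inter_mem hs (L.isOpen.mem_nhds hz)
  have h2 : s ∩ Eᶜ ⊆ {z | z ∉ E ∧ N z = c / 2} := fun w hw =>
    ⟨hw.2, le_antisymm (hcon w hw.1 hw.2) (L.half hw.2)⟩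
  have := measure_mono_null h2 L.null
  exact (Measure.measure_pos_of_mem_nhds volume h1).ne' this

lemma uniq_aux (L₁ : LimData A B f E N₁ r₁ 0) (L₂ : LimData A B f E N₂ r₂ 0) {d : ℝ} (hd : 0 < d)
    (hP : ∀ z ∉ E, Psi N₁ N₂ r₁ r₂ z = d ^ 2)
    (hfar : ∃ R, ∀ z, R < ‖z‖ → N₁ z - N₂ z = d) : False := by
  obtain ⟨C₁, R₁, hR₁, p1, p2⟩ := L₁.far
  obtain ⟨R, hR⟩ := hfar
  have hdS : ∀ w ∉ E, Same r₁ r₂ w → N₁ w - N₂ w = d ∨ N₂ w - N₁ w = d := by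
    intro w hw hS
    have := hP w hw
    unfold Psi at this
    simp only [hS, if_true] at this
    rcases sq_eq_sq_iff_eq_or_eq_neg.1 this with h | h
    · left; exact h
    · right; linarith
  have hdN : ∀ w ∉ E, ¬ Same r₁ r₂ w → N₁ w + N₂ w = d := by
    intro w hw hS
    have := hP w hw
    unfold Psi at this
    simp only [hS, if_false] at this
    have k1 := L₁.half hw
    have k2 := L₂.half hw
    exact (sq_eq_sq₀ (by linarith) hd.le).1 this
  have hSpos : ∀ w ∉ E, Same r₁ r₂ w → 0 < N₁ w ∧ 0 < N₂ w := by
    rintro w hw ⟨φ, h1, h2, h3⟩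
    constructor
    · rcases L₁.dich hw h1 with h | h <;> linarith
    · rcases L₂.dich hw h1 with h | h <;> linarith
  -- Y₋ is empty
  set O : Set ℂ := {w | w ∉ E ∧ Same r₁ r₂ w ∧ N₂ w - N₁ w = d} with hO
  have hOo : ∀ w ∈ O, ∀ᶠ y in 𝓝 w, y ∈ O := by
    rintro w ⟨hw, hS, hw2⟩
    obtain ⟨U, F, hU, hzU, hUE, hF, h⟩ := Psi_local L₁ L₂ hw (hSpos w hw hS).2
    have h1 := ((h w hzU).2.2.2).1 hS
    filter_upwards [hU.mem_nhds hzU, (L₁.contr U F hU hUE hF w hzU).eventually_lt_const h1,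
      ((L₂.contN w hw).sub (L₁.contN w hw)).eventually_const_lt (u := 0) (by simpa [hw2] using hd)]
      with y y1 y2 y3
    have hSy := ((h y y1).2.2.2).2 y2
    refine ⟨hUE y1, hSy, ?_⟩
    have y3 : 0 < N₂ y - N₁ y := y3
    rcases hdS y (hUE y1) hSy with k | k <;> linarith
  have hOem : O = ∅ := by
    have := liou_ext (O := O) (h := N₁) L₁.finE (fun w hw => hw.1)
      (isOpen_iff_mem_nhds.2 hOo) L₁.contN (fun w hw => (hSpos w hw.1 hw.2.1).1)
      (fun w hw => L₁.subN w hw.1) ?_ ?_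
    · rcases this with h0 | ⟨k, hk⟩
      · exact h0
      · exact (L₁.ne_const k fun w hw => (hk w hw).2).elim
    · intro w hw hwO hpos
      by_cases h2 : 0 < N₂ w
      · obtain ⟨U, F, hU, hzU, hUE, hF, h⟩ := Psi_local L₁ L₂ hw h2
        by_cases hS : Same r₁ r₂ w
        · have hw2 : N₁ w - N₂ w = d := (hdS w hw hS).resolve_right fun h' => hwO ⟨hw, hS, h'⟩
          filter_upwards [((L₁.contN w hw).sub (L₂.contN w hw)).eventually_const_lt (u := 0)
            (by simpa [hw2] using hd)] with y hy hyO
          have hy : 0 < N₁ y - N₂ y := hy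
          have := hyO.2.2
          linarith
        · have h1 : 0 < r₁ w (F w) := by
            rcases L₁.dich hw (hF w hzU).1 with k | k
            · linarith
            · exact (hS (((h w hzU).2.2.2).2 (by linarith))).elim
          filter_upwards [hU.mem_nhds hzU,
            (L₁.contr U F hU hUE hF w hzU).eventually_const_lt h1] with y y1 y2 hyO
          have := ((h y y1).2.2.2).1 hyO.2.1
          linarith
      · have h20 : N₂ w = 0 := le_antisymm (not_lt.1 h2) (by have := L₂.half hw; linarith)
        filter_upwards [((L₂.contN w hw).sub (L₁.contN w hw)).eventually_lt_const (u := 0)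
            (by simp [h20, hpos])] with y hy hyO
        have hy : N₂ y - N₁ y < 0 := hy
        have := hyO.2.2
        linarith
    · set R' := max R 0
      refine ⟨C₁ + Real.log (1 + R'), fun w hw => ?_⟩
      rcases le_or_gt ‖w‖ R' with hwR | hwR
      · have := p1 w hw.1
        have : Real.log (1 + ‖w‖) ≤ Real.log (1 + R') := Real.log_le_log (by positivity) (by linarith)
        linarith
      · have := hR w ((le_max_left R 0).trans_lt hwR)
        have := hw.2.2
        linarith
  have hpos : ∀ z ∉ E, 0 < N₁ z := by
    intro z hz
    by_contra hn
    have h10 : N₁ z = 0 := le_antisymm (not_lt.1 hn) (by have := L₁.half hz; linarith)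
    have hnS : ¬ Same r₁ r₂ z := fun h => by have := (hSpos z hz h).1; linarith
    have h2z : N₂ z = d := by have := hdN z hz hnS; linarith
    have hev : ∀ᶠ w in 𝓝 z, w ∉ E ∧ N₁ w + N₂ w = d := by
      filter_upwards [L₁.isOpen.mem_nhds hz, (L₁.contN z hz).eventually_lt_const (u := d)
        (by rw [h10]; exact hd)] with w w1 w2
      refine ⟨w1, ?_⟩
      by_cases hS : Same r₁ r₂ w
      · rcases hdS w w1 hS with k | k
        · have := L₂.half w1; linarith
        · have : w ∈ O := ⟨w1, hS, k⟩
          rw [hOem] at this; exact this.elim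
      · exact hdN w w1 hS
    have hsub : SubMean (fun w => - N₁ w) z := by
      have h2 : SubMean N₂ z := L₂.subN z hz
      have := h2.add_const (-d) (by
        filter_upwards [L₁.isOpen.mem_nhds hz] with x hx using L₂.contN x hx)
      refine this.congr ?_
      filter_upwards [hev] with w hw
      linarith [hw.2]
    have h1 := (hsub.and (ev_sphere_subset (L₁.isOpen.mem_nhds hz)))
    obtain ⟨δ, hδ, h2⟩ := mem_nhdsGT_iff_exists_Ioo_subset.1 h1
    obtain ⟨w, hw, hwE, hwp⟩ := L₁.exists_pos hz (Metric.ball_mem_nhds z hδ)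
    have hwp : 0 < N₁ w := by linarith
    have hwz : w ≠ z := by rintro rfl; linarith
    have hposd : 0 < dist w z := dist_pos.2 hwz
    obtain ⟨g1, g2⟩ := h2 ⟨hposd, hw⟩
    have hsph : Metric.sphere z (dist w z) ⊆ Eᶜ := Metric.sphere_subset_closedBall.trans g2
    have := mean_eq (v := fun w => - N₁ w) (m := 0) hposd
      (fun x hx => (L₁.contN x (hsph hx)).neg.continuousWithinAt)
      (fun x hx => by have := L₁.half (hsph hx); simp; linarith)
      (by simpa [h10] using g1) w (by rw [Metric.mem_sphere])
    simp at this
    linarith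
  obtain ⟨k, hk⟩ := liouville L₁.finE (v := fun w => - N₁ w)
    (fun z hz => (L₁.contN z hz).neg.continuousWithinAt)
    ⟨0, fun z hz => by have := hpos z hz; linarith⟩ (fun z hz => L₁.neg_submean hz (hpos z hz))
  exact L₁.ne_const (-k) fun z hz => by have := hk z hz; linarith

lemma uniq_lim0 (L₁ : LimData A B f E N₁ r₁ 0) (L₂ : LimData A B f E N₂ r₂ 0) :
    ∀ z ∉ E, N₁ z = N₂ z := by
  obtain ⟨d, hd, hP⟩ := Psi_const L₁ L₂
  have hd0 : d = 0 := by
    by_contra hne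
    have hdpos : 0 < d := lt_of_le_of_ne hd (Ne.symm hne)
    obtain ⟨C₁, R₁, hR₁, p1, p2⟩ := L₁.far
    obtain ⟨C₂, R₂, hR₂, q1, q2⟩ := L₂.far
    set R := max R₁ R₂ with hR
    have hR1 : 1 ≤ R := hR₁.trans (le_max_left _ _)
    have hfar : ∀ z ∈ {z : ℂ | R < ‖z‖}, z ∉ E ∧ (N₁ z - N₂ z = d ∨ N₂ z - N₁ z = d) := by
      intro z hz
      have hzR : R < ‖z‖ := hz
      obtain ⟨a1, a2, a3, a4⟩ := p2 z ((le_max_left _ _).trans hzR.le)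
      obtain ⟨b1, b2, b3, b4⟩ := q2 z ((le_max_right _ _).trans hzR.le)
      have hd1 := L₁.rlt a1 a2 a4
      have hd2 := L₂.rlt a1 a2 b4
      have hS : Same r₁ r₂ z := ⟨f z, a2, by linarith, by linarith⟩
      have := hP z a1
      unfold Psi at this
      simp only [hS, if_true] at this
      refine ⟨a1, ?_⟩
      rcases sq_eq_sq_iff_eq_or_eq_neg.1 this with h | h
      · left; exact h
      · right; linarith
    have hcl := @clopen_all _ (preconn_far R (by linarith)) (fun z => 0 < N₁ z - N₂ z)
      (fun x hx hp => ((L₁.contN x (hfar x hx).1).sub (L₂.contN x (hfar x hx).1)).eventually_const_lt hp)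
      (fun x hx hp => by
        have : N₁ x - N₂ x < 0 := by
          rcases (hfar x hx).2 with h | h <;> linarith
        filter_upwards [((L₁.contN x (hfar x hx).1).sub
          (L₂.contN x (hfar x hx).1)).eventually_lt_const this] with y hy
        exact not_lt.2 (le_of_lt hy))
    by_cases hex : ∃ x0 ∈ {z : ℂ | R < ‖z‖}, 0 < N₁ x0 - N₂ x0
    · obtain ⟨x0, h1, h2⟩ := hex
      refine uniq_aux L₁ L₂ hdpos hP ⟨R, fun z hz => ?_⟩
      have := hcl h1 h2 z hz
      rcases (hfar z hz).2 with h | h <;> linarith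
    · push Not at hex
      refine uniq_aux L₂ L₁ hdpos (by rw [Psi_symm]; exact hP) ⟨R, fun z hz => ?_⟩
      have := hex z hz
      rcases (hfar z hz).2 with h | h <;> linarith
  intro z hz
  have := hP z hz
  have k1 := L₁.half hz
  have k2 := L₂.half hz
  rw [hd0] at this
  unfold Psi at this
  split_ifs at this
  · nlinarith
  · nlinarith

lemma uniq_lim {E₁ E₂ : Set ℂ} {c₁ c₂ : ℝ} (L₁ : LimData A B f E₁ N₁ r₁ c₁)
    (L₂ : LimData A B f E₂ N₂ r₂ c₂) {z : ℂ} (h1 : z ∉ E₁) (h2 : z ∉ E₂) :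
    N₁ z - c₁ / 2 = N₂ z - c₂ / 2 := by
  have hf := L₁.finE.union L₂.finE
  have := uniq_lim0 (L₁.shift.enlarge hf Set.subset_union_left)
    (L₂.shift.enlarge hf Set.subset_union_right) z (by simp [h1, h2])
  linarith
end

lemma gron_aux {V : Type*} [NormedAddCommGroup V] [NormedSpace ℝ V] {g g' : ℝ → V} {K T : ℝ}
    (hg : ∀ t ∈ Set.Icc 0 T, HasDerivAt g (g' t) t) (hb : ∀ t ∈ Set.Icc 0 T, ‖g' t‖ ≤ K * ‖g t‖)
    (hT : 0 ≤ T) : ‖g T‖ ≤ ‖g 0‖ * Real.exp (K * T) := by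
  have := norm_le_gronwallBound_of_norm_deriv_right_le (f := g) (f' := g') (δ := ‖g 0‖) (K := K) (ε := 0)
    (a := 0) (b := T) (fun t ht => (hg t ht).continuousAt.continuousWithinAt)
    (fun t ht => (hg t ⟨ht.1, ht.2.le⟩).hasDerivWithinAt) le_rfl
    (fun t ht => by simpa using hb t ⟨ht.1, ht.2.le⟩) T ⟨hT, le_rfl⟩
  simpa [gronwallBound_ε0] using this

lemma line_deriv {V : Type*} [NormedAddCommGroup V] [NormedSpace ℂ V] {W : ℂ → V} {W' : V}
    {z e : ℂ} {t : ℝ} (h : HasDerivAt W W' (z + t * e)) :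
    HasDerivAt (fun s : ℝ => W (z + s * e)) (e • W') t := by
  have h1 : HasDerivAt (fun s : ℝ => z + (s:ℂ) * e) e t := by
    have := (Complex.ofRealCLM.hasDerivAt (x := t)).mul_const e
    simpa using this.const_add z
  exact h.scomp t h1

lemma gron {V : Type*} [NormedAddCommGroup V] [NormedSpace ℂ V] {W W' : ℂ → V} {S : Set ℂ} {K : ℝ}
    (hS : Convex ℝ S) (hW : ∀ z ∈ S, HasDerivAt W (W' z) z) (hb : ∀ z ∈ S, ‖W' z‖ ≤ K * ‖W z‖)
    {z₁ z₂ : ℂ} (h1 : z₁ ∈ S) (h2 : z₂ ∈ S) :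
    ‖W z₂‖ ≤ ‖W z₁‖ * Real.exp (K * ‖z₂ - z₁‖) := by
  have hmem : ∀ t ∈ Set.Icc (0:ℝ) 1, z₁ + t * (z₂ - z₁) ∈ S := fun t ht => by
    have := hS.add_smul_sub_mem h1 h2 ht
    simpa using this
  have := gron_aux (g := fun t : ℝ => W (z₁ + t * (z₂ - z₁)))
    (g' := fun t : ℝ => (z₂ - z₁) • W' (z₁ + t * (z₂ - z₁))) (K := K * ‖z₂ - z₁‖) (T := 1)
    (fun t ht => line_deriv (hW _ (hmem t ht)))
    (fun t ht => by
      rw [norm_smul]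
      have := hb _ (hmem t ht)
      nlinarith [norm_nonneg (z₂ - z₁)]) zero_le_one
  simpa using this

/-- determinant -/
def Dt (u v : ℂ × ℂ) : ℂ := u.1 * v.2 - u.2 * v.1

lemma Dt_le (u v : ℂ × ℂ) : ‖Dt u v‖ ≤ 2 * ‖u‖ * ‖v‖ := by
  have h1 := norm_fst_le u
  have h2 := norm_snd_le u
  have h3 := norm_fst_le v
  have h4 := norm_snd_le v
  have := norm_sub_le (u.1 * v.2) (u.2 * v.1)
  rw [norm_mul, norm_mul] at this
  unfold Dt
  nlinarith [norm_nonneg u.1, norm_nonneg u.2, norm_nonneg v.1, norm_nonneg v.2, norm_nonneg u, norm_nonneg v,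
    mul_le_mul h1 h4 (norm_nonneg _) (norm_nonneg _), mul_le_mul h2 h3 (norm_nonneg _) (norm_nonneg _)]

lemma Dt_choose (u v : ℂ × ℂ) (hv : v ≠ 0) : ∃ μ : ℂ, ‖μ‖ ≤ ‖u‖ / ‖v‖ ∧ ‖u - μ • v‖ = ‖Dt u v‖ / ‖v‖ := by
  have hv' : 0 < ‖v‖ := norm_pos_iff.2 hv
  rcases le_total ‖v.1‖ ‖v.2‖ with h | h
  · have hn : ‖v‖ = ‖v.2‖ := by rw [Prod.norm_def, max_eq_right h]
    have h0 : v.2 ≠ 0 := by rw [← norm_pos_iff, ← hn]; exact hv'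
    refine ⟨u.2 / v.2, ?_, ?_⟩
    · rw [norm_div, hn]
      gcongr
      exact norm_snd_le u
    · have : u - (u.2 / v.2) • v = (Dt u v / v.2, 0) := by
        ext
        · simp [Dt]; field_simp
        · simp; field_simp; simp
      rw [this, Prod.norm_def, hn]; simp [norm_div]
      positivity
  · have hn : ‖v‖ = ‖v.1‖ := by rw [Prod.norm_def, max_eq_left h]
    have h0 : v.1 ≠ 0 := by rw [← norm_pos_iff, ← hn]; exact hv'
    refine ⟨u.1 / v.1, ?_, ?_⟩
    · rw [norm_div, hn]
      gcongr
      exact norm_fst_le u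
    · have : u - (u.1 / v.1) • v = (0, - Dt u v / v.1) := by
        ext
        · simp; field_simp; simp
        · simp [Dt]; field_simp
      rw [this, Prod.norm_def, hn]; simp [norm_div]
      positivity

/-- `W` solves the first order system on `S` -/
def Sol (n : ℕ) (b V : ℂ → ℂ) (S : Set ℂ) (W : ℂ → ℂ × ℂ) : Prop :=
  ∀ z ∈ S, HasDerivAt W ((n : ℂ) * (W z).2, - b z * (W z).2 + ((n:ℂ) + 1) * V z * (W z).1) z

lemma Sol.sub_smul {n : ℕ} {b V : ℂ → ℂ} {S : Set ℂ} {W W' : ℂ → ℂ × ℂ} (h : Sol n b V S W)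
    (h' : Sol n b V S W') (μ : ℂ) : Sol n b V S (fun z => W z - μ • W' z) := fun z hz => by
  refine ((h z hz).sub ((h' z hz).const_smul μ)).congr_deriv ?_
  ext <;> simp <;> ring

lemma Sol.mono {n : ℕ} {b V : ℂ → ℂ} {S S' : Set ℂ} {W : ℂ → ℂ × ℂ} (h : Sol n b V S W) (hs : S' ⊆ S) :
    Sol n b V S' W := fun z hz => h z (hs hz)

lemma Sol.bound {n : ℕ} (hn : 1 ≤ n) {b V : ℂ → ℂ} {S : Set ℂ} {W : ℂ → ℂ × ℂ} {M : ℝ}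
    (hb : ∀ z ∈ S, ‖b z‖ ≤ M) (hV : ∀ z ∈ S, ‖V z‖ ≤ M) {z : ℂ} (hz : z ∈ S) :
    ‖((n : ℂ) * (W z).2, - b z * (W z).2 + ((n:ℂ) + 1) * V z * (W z).1)‖ ≤ n * (3 * M + 1) * ‖W z‖ := by
  have hn' : (1:ℝ) ≤ n := by exact_mod_cast hn
  have h1 := norm_fst_le (W z)
  have h2 := norm_snd_le (W z)
  have hM : 0 ≤ M := (norm_nonneg _).trans (hb z hz)
  have hw := norm_nonneg (W z)
  have hmw : 0 ≤ M * ‖W z‖ := mul_nonneg hM hw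
  rw [Prod.norm_def]
  apply max_le
  · simp only [norm_mul, Complex.norm_natCast]
    nlinarith [mul_nonneg (Nat.cast_nonneg (α := ℝ) n) hmw]
  · refine (norm_add_le _ _).trans ?_
    simp only [norm_mul, norm_neg]
    have h3 : ‖(n:ℂ) + 1‖ ≤ 2 * n := by
      refine (norm_add_le _ _).trans ?_
      simp; linarith
    have h4 : ‖b z‖ * ‖(W z).2‖ ≤ M * ‖W z‖ := mul_le_mul (hb z hz) h2 (norm_nonneg _) hM
    have h5 : ‖V z‖ * ‖(W z).1‖ ≤ M * ‖W z‖ := mul_le_mul (hV z hz) h1 (norm_nonneg _) hM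
    have h6 : ‖(n:ℂ) + 1‖ * (‖V z‖ * ‖(W z).1‖) ≤ (2 * n) * (M * ‖W z‖) :=
      mul_le_mul h3 h5 (by positivity) (by positivity)
    nlinarith [mul_nonneg (Nat.cast_nonneg (α := ℝ) n) hw]

lemma Sol.gron {n : ℕ} (hn : 1 ≤ n) {b V : ℂ → ℂ} {S : Set ℂ} {W : ℂ → ℂ × ℂ} {M : ℝ}
    (hb : ∀ z ∈ S, ‖b z‖ ≤ M) (hV : ∀ z ∈ S, ‖V z‖ ≤ M) (hS : Convex ℝ S) (hW : Sol n b V S W)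
    {z₁ z₂ : ℂ} (h1 : z₁ ∈ S) (h2 : z₂ ∈ S) :
    ‖W z₂‖ ≤ ‖W z₁‖ * Real.exp (n * (3 * M + 1) * ‖z₂ - z₁‖) :=
  _root_.gron hS hW (fun _ hz => Sol.bound hn hb hV hz) h1 h2

/-- local constancy of the ratio -/
lemma Sol.lc {n : ℕ} (hn : 1 ≤ n) {b V : ℂ → ℂ} {S : Set ℂ} {p r : ℂ → ℂ × ℂ} {M : ℝ}
    (hb : ∀ z ∈ S, ‖b z‖ ≤ M) (hV : ∀ z ∈ S, ‖V z‖ ≤ M) (hS : Convex ℝ S) (hp : Sol n b V S p)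
    (hr : Sol n b V S r) {z₁ z₂ : ℂ} (h1 : z₁ ∈ S) (h2 : z₂ ∈ S) (hr0 : r z₁ ≠ 0)
    (hD : 2 * ‖Dt (p z₁) (r z₁)‖ * Real.exp (n * (3 * M + 1) * ‖z₂ - z₁‖) ^ 2 ≤ ‖r z₁‖ * ‖p z₁‖) :
    ‖p z₂‖ * ‖r z₁‖ ≤ 3 * (‖p z₁‖ * ‖r z₂‖) := by
  set τ := Real.exp (n * (3 * M + 1) * ‖z₂ - z₁‖) with hτ
  have hτpos : 0 < τ := Real.exp_pos _
  obtain ⟨μ, hμ, hμ2⟩ := Dt_choose (p z₁) (r z₁) hr0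
  have hR : 0 < ‖r z₁‖ := norm_pos_iff.2 hr0
  have g1 := Sol.gron hn hb hV hS (hp.sub_smul hr μ) h1 h2
  have g2 := Sol.gron hn hb hV hS hp h2 h1
  rw [norm_sub_rev z₁ z₂, ← hτ] at g2
  rw [← hτ] at g1
  simp only [hμ2] at g1
  have g3 : ‖p z₂‖ ≤ ‖Dt (p z₁) (r z₁)‖ / ‖r z₁‖ * τ + ‖p z₁‖ / ‖r z₁‖ * ‖r z₂‖ := by
    have : ‖p z₂‖ ≤ ‖p z₂ - μ • r z₂‖ + ‖μ • r z₂‖ := by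
      have := norm_add_le (p z₂ - μ • r z₂) (μ • r z₂)
      simpa using this
    rw [norm_smul] at this
    have := mul_le_mul_of_nonneg_right hμ (norm_nonneg (r z₂))
    linarith
  have g4 : ‖p z₂‖ * ‖r z₁‖ ≤ ‖Dt (p z₁) (r z₁)‖ * τ + ‖p z₁‖ * ‖r z₂‖ := by
    have := mul_le_mul_of_nonneg_right g3 hR.le
    field_simp at this
    linarith
  have g5 : 2 * ‖Dt (p z₁) (r z₁)‖ * τ ≤ ‖r z₁‖ * ‖p z₂‖ := by
    have : 2 * ‖Dt (p z₁) (r z₁)‖ * τ * τ ≤ ‖r z₁‖ * ‖p z₂‖ * τ := by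
      have := mul_le_mul_of_nonneg_left g2 hR.le
      nlinarith
    exact le_of_mul_le_mul_right this hτpos
  nlinarith [mul_nonneg (norm_nonneg (p z₁)) (norm_nonneg (r z₂))]

lemma cone {a b a' b' : ℝ → ℂ} {l T : ℝ} (hT : 0 ≤ T) (hl : 0 < l)
    (ha : ∀ t ∈ Set.Icc 0 T, HasDerivAt a (a' t) t) (hb : ∀ t ∈ Set.Icc 0 T, HasDerivAt b (b' t) t)
    (hae : ∀ t ∈ Set.Icc 0 T, ‖a' t - l * a t‖ ≤ l / 64 * (‖a t‖ + ‖b t‖))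
    (hbe : ∀ t ∈ Set.Icc 0 T, ‖b' t + l * b t‖ ≤ l / 64 * (‖a t‖ + ‖b t‖))
    (h0 : ‖b 0‖ ≤ 2 * ‖a 0‖) : 3 * ‖a 0‖ ^ 2 * Real.exp (l * T) ≤ 4 * ‖a T‖ ^ 2 := by
  set θ : ℝ → ℝ := fun t => 16 * ‖a t‖ ^ 2 - ‖b t‖ ^ 2 with hθ
  set ψ : ℝ → ℝ := fun t => θ t * Real.exp (-(l * t)) with hψ
  have hd : ∀ t ∈ Set.Icc 0 T, HasDerivAt ψ
      ((16 * (2 * inner ℝ (a t) (a' t)) - 2 * inner ℝ (b t) (b' t)) * Real.exp (-(l * t))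
        + θ t * (Real.exp (-(l * t)) * (-l))) t := by
    intro t ht
    have h1 : HasDerivAt θ (16 * (2 * inner ℝ (a t) (a' t)) - 2 * inner ℝ (b t) (b' t)) t :=
      ((ha t ht).norm_sq.const_mul 16).sub (hb t ht).norm_sq
    have h2 : HasDerivAt (fun t => Real.exp (-(l * t))) (Real.exp (-(l * t)) * (-l)) t := by
      have := ((hasDerivAt_id t).const_mul l).neg.exp
      simpa using this
    exact h1.mul h2
  have hmono : MonotoneOn ψ (Set.Icc 0 T) := by
    apply monotoneOn_of_deriv_nonneg (convex_Icc 0 T)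
    · exact fun t ht => (hd t ht).continuousAt.continuousWithinAt
    · exact fun t ht => (hd t (interior_subset ht)).differentiableAt.differentiableWithinAt
    · intro t ht
      have ht := interior_subset ht
      rw [(hd t ht).deriv]
      have e1 : inner ℝ (a t) (a' t) = l * ‖a t‖ ^ 2 + inner ℝ (a t) (a' t - l * a t) := by
        rw [inner_sub_right]
        have : ((l:ℂ) * a t) = l • a t := by simp
        rw [this, inner_smul_right, real_inner_self_eq_norm_sq]; ring
      have e2 : inner ℝ (b t) (b' t) = - l * ‖b t‖ ^ 2 + inner ℝ (b t) (b' t + l * b t) := by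
        rw [inner_add_right]
        have : ((l:ℂ) * b t) = l • b t := by simp
        rw [this, inner_smul_right, real_inner_self_eq_norm_sq]; ring
      have i1 : - (‖a t‖ * (l / 64 * (‖a t‖ + ‖b t‖))) ≤ inner ℝ (a t) (a' t - l * a t) := by
        have := neg_le_of_abs_le (abs_real_inner_le_norm (a t) (a' t - l * a t))
        have := mul_le_mul_of_nonneg_left (hae t ht) (norm_nonneg (a t))
        linarith
      have i2 : inner ℝ (b t) (b' t + l * b t) ≤ ‖b t‖ * (l / 64 * (‖a t‖ + ‖b t‖)) := by
        have := real_inner_le_norm (b t) (b' t + l * b t)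
        have := mul_le_mul_of_nonneg_left (hbe t ht) (norm_nonneg (b t))
        linarith
      have key : 0 ≤ (16 * (2 * inner ℝ (a t) (a' t)) - 2 * inner ℝ (b t) (b' t)) - l * θ t := by
        rw [e1, e2]
        simp only [hθ]
        set x := ‖a t‖
        set y := ‖b t‖
        have hx : 0 ≤ x := norm_nonneg _
        have hy : 0 ≤ y := norm_nonneg _
        have : 0 ≤ l * (16 * x ^ 2 + 3 * y ^ 2 - (x + y / 16) * (x + y) / 2) := by
          apply mul_nonneg hl.le
          nlinarith [sq_nonneg (x - y), mul_nonneg hx hy]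
        nlinarith
      have := mul_nonneg key (Real.exp_pos (-(l * t))).le
      linarith
  have := hmono ⟨le_rfl, hT⟩ ⟨hT, le_rfl⟩ hT
  simp only [hψ, hθ] at this
  simp only [mul_zero, neg_zero, Real.exp_zero, mul_one, Real.exp_neg] at this
  have he := Real.exp_pos (l * T)
  rw [← div_eq_mul_inv, le_div_iff₀ he] at this
  have h3 : 12 * ‖a 0‖ ^ 2 ≤ 16 * ‖a 0‖ ^ 2 - ‖b 0‖ ^ 2 := by nlinarith [norm_nonneg (b 0), norm_nonneg (a 0)]
  have := mul_le_mul_of_nonneg_right h3 he.le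
  nlinarith [sq_nonneg ‖b T‖]

lemma Sol.cone {n : ℕ} (hn : 1 ≤ n) {b V : ℂ → ℂ} {S : Set ℂ} {W : ℂ → ℂ × ℂ} {M ε : ℝ} {k : ℂ}
    (hk : k ≠ 0)
    (hb : ∀ z ∈ S, ‖b z‖ ≤ M) (hV : ∀ z ∈ S, ‖V z‖ ≤ M) (hVk : ∀ z ∈ S, ‖V z - k ^ 2‖ ≤ ε)
    (hS : Convex ℝ S) (hW : Sol n b V S W)
    (hε : M / 2 + (n * ε + M) / (2 * ‖k‖) ≤ n * ‖k‖ / 64)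
    {z : ℂ} {T : ℝ} (hT : 0 ≤ T) (h1 : z ∈ S) (h2 : z + T * (‖k‖ / k) ∈ S)
    (hdom : ‖(W z).2 - k * (W z).1‖ ≤ 2 * ‖(W z).2 + k * (W z).1‖) :
    ‖W z‖ * Real.exp (n * ‖k‖ * T / 2) ≤ 2 * (1 + ‖k‖) * (1 + 1 / ‖k‖) * ‖W (z + T * (‖k‖ / k))‖ := by
  have hk' : 0 < ‖k‖ := norm_pos_iff.2 hk
  have hkc : (‖k‖:ℂ) ≠ 0 := by exact_mod_cast hk'.ne'
  set e : ℂ := ‖k‖ / k with he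
  have hek : e * k = ‖k‖ := by rw [he]; field_simp
  have hen : ‖e‖ = 1 := by rw [he, norm_div]; simp [hk'.ne']
  have hn' : (1:ℝ) ≤ n := by exact_mod_cast hn
  have hmem : ∀ t ∈ Set.Icc (0:ℝ) T, z + t * e ∈ S := fun t ht => by
    rcases eq_or_lt_of_le hT with h0 | h0
    · have : t = 0 := le_antisymm (h0 ▸ ht.2) ht.1
      simpa [this] using h1
    · have := hS.add_smul_sub_mem h1 h2 (t := t / T) ⟨by have := ht.1; positivity, by rw [div_le_one h0]; exact ht.2⟩
      have h3 : (T:ℂ) ≠ 0 := by exact_mod_cast h0.ne'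
      have h4 : z + (t / T) • (z + T * e - z) = z + t * e := by
        simp; field_simp
      rwa [h4] at this
  set g : ℝ → ℂ × ℂ := fun t => W (z + t * e) with hg
  have hg1 : ∀ t ∈ Set.Icc (0:ℝ) T, HasDerivAt (fun t => (g t).1) (e * (n * (g t).2)) t := fun t ht => by
    have := line_deriv (hW _ (hmem t ht))
    exact (ContinuousLinearMap.fst ℝ ℂ ℂ).hasFDerivAt.comp_hasDerivAt t this
  have hg2 : ∀ t ∈ Set.Icc (0:ℝ) T, HasDerivAt (fun t => (g t).2)
      (e * (- b (z + t * e) * (g t).2 + ((n:ℂ) + 1) * V (z + t * e) * (g t).1)) t := fun t ht => by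
    have := line_deriv (hW _ (hmem t ht))
    exact (ContinuousLinearMap.snd ℝ ℂ ℂ).hasFDerivAt.comp_hasDerivAt t this
  have hM : 0 ≤ M := (norm_nonneg _).trans (hb z h1)
  have herr : ∀ t ∈ Set.Icc (0:ℝ) T, ‖e * (- b (z + t * e) * (g t).2
      + (n * (V (z + t * e) - k ^ 2) + V (z + t * e)) * (g t).1)‖ ≤
      (n * ‖k‖) / 64 * (‖(g t).2 + k * (g t).1‖ + ‖(g t).2 - k * (g t).1‖) := by
    intro t ht
    set x := (g t).1
    set y := (g t).2
    set s := ‖y + k * x‖ + ‖y - k * x‖ with hs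
    have hs0 : 0 ≤ s := by positivity
    have hy : ‖y‖ ≤ s / 2 := by
      have h := norm_add_le (y + k * x) (y - k * x)
      rw [show (y + k * x) + (y - k * x) = 2 * y by ring, norm_mul] at h
      have : ‖(2:ℂ)‖ = 2 := by simp
      rw [this] at h; linarith
    have hx : ‖x‖ ≤ s / (2 * ‖k‖) := by
      have h := norm_sub_le (y + k * x) (y - k * x)
      have h3 : (y + k * x) - (y - k * x) = 2 * k * x := by ring
      rw [h3, norm_mul, norm_mul] at h
      rw [le_div_iff₀ (by positivity)]
      have : ‖(2:ℂ)‖ = 2 := by simp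
      rw [this] at h; linarith
    have k1 := hb _ (hmem t ht)
    have k2 := hV _ (hmem t ht)
    have k3 := hVk _ (hmem t ht)
    rw [norm_mul, hen, one_mul]
    refine (norm_add_le _ _).trans ?_
    rw [norm_mul, norm_mul, norm_neg]
    have k4 : ‖n * (V (z + t * e) - k ^ 2) + V (z + t * e)‖ ≤ n * ε + M := by
      refine (norm_add_le _ _).trans ?_
      rw [norm_mul, Complex.norm_natCast]
      nlinarith
    have k5 : ‖b (z + t * e)‖ * ‖y‖ ≤ M * (s / 2) := mul_le_mul k1 hy (norm_nonneg _) hM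
    have k6 : ‖n * (V (z + t * e) - k ^ 2) + V (z + t * e)‖ * ‖x‖ ≤ (n * ε + M) * (s / (2 * ‖k‖)) :=
      mul_le_mul k4 hx (norm_nonneg _) ((norm_nonneg _).trans k4)
    have k7 : M * (s / 2) + (n * ε + M) * (s / (2 * ‖k‖)) = (M / 2 + (n * ε + M) / (2 * ‖k‖)) * s := by
      field_simp
    nlinarith
  have main := _root_.cone (a := fun t => (g t).2 + k * (g t).1) (b := fun t => (g t).2 - k * (g t).1)
    (l := n * ‖k‖) hT (by positivity)
    (fun t ht => (hg2 t ht).add ((hg1 t ht).const_mul k))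
    (fun t ht => (hg2 t ht).sub ((hg1 t ht).const_mul k))
    (fun t ht => by
      refine le_of_eq_of_le ?_ (herr t ht)
      congr 1
      push_cast
      rw [← hek]; ring)
    (fun t ht => by
      refine le_of_eq_of_le ?_ (herr t ht)
      congr 1
      push_cast
      rw [← hek]; ring)
    (by simpa [hg] using hdom)
  simp only [hg] at main
  simp only [Complex.ofReal_zero, zero_mul, add_zero] at main
  set U := W (z + T * e)
  have u1 : ‖U.2 + k * U.1‖ ≤ (1 + ‖k‖) * ‖U‖ := by
    refine (norm_add_le _ _).trans ?_
    rw [norm_mul]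
    nlinarith [norm_fst_le U, norm_snd_le U]
  set aa := ‖(W z).2 + k * (W z).1‖ with haa
  have haa0 : 0 ≤ aa := norm_nonneg _
  have u2 : ‖W z‖ ≤ 3 / 2 * (1 + 1 / ‖k‖) * aa := by
    have hy : ‖(W z).2‖ ≤ 3 / 2 * aa := by
      have h := norm_add_le ((W z).2 + k * (W z).1) ((W z).2 - k * (W z).1)
      rw [show ((W z).2 + k * (W z).1) + ((W z).2 - k * (W z).1) = 2 * (W z).2 by ring, norm_mul] at h
      have : ‖(2:ℂ)‖ = 2 := by simp
      rw [this] at h; linarith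
    have hx : ‖(W z).1‖ ≤ 3 / 2 * (1 / ‖k‖) * aa := by
      have h := norm_sub_le ((W z).2 + k * (W z).1) ((W z).2 - k * (W z).1)
      have h3 : ((W z).2 + k * (W z).1) - ((W z).2 - k * (W z).1) = 2 * k * (W z).1 := by ring
      rw [h3, norm_mul, norm_mul] at h
      have : ‖(2:ℂ)‖ = 2 := by simp
      rw [this] at h
      have : ‖k‖ * ‖(W z).1‖ ≤ 3 / 2 * aa := by linarith
      calc ‖(W z).1‖ = (‖k‖ * ‖(W z).1‖) / ‖k‖ := by field_simp
        _ ≤ (3 / 2 * aa) / ‖k‖ := by gcongr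
        _ = _ := by ring
    rw [Prod.norm_def]
    have : 0 ≤ 1 / ‖k‖ * aa := by positivity
    apply max_le <;> linarith
  have e1 : Real.exp (n * ‖k‖ * T) = Real.exp (n * ‖k‖ * T / 2) ^ 2 := by
    rw [← Real.exp_nat_mul]; congr 1; push_cast; ring
  rw [e1] at main
  set q := Real.exp (n * ‖k‖ * T / 2)
  have hq : 0 < q := Real.exp_pos _
  have m2 : 3 / 2 * aa * q ≤ 2 * ‖U.2 + k * U.1‖ := by
    apply le_of_sq_le_sq _ (by positivity)
    nlinarith
  calc ‖W z‖ * q ≤ 3 / 2 * (1 + 1 / ‖k‖) * aa * q := by gcongr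
    _ = (1 + 1 / ‖k‖) * (3 / 2 * aa * q) := by ring
    _ ≤ (1 + 1 / ‖k‖) * (2 * ((1 + ‖k‖) * ‖U‖)) := by
        gcongr ?_ * ?_; linarith
    _ = _ := by ring

lemma log_mean_ge {g : ℂ → ℂ} {z : ℂ} {r : ℝ} (hr : 0 < r) (hg : AnalyticOnNhd ℂ g (Metric.closedBall z r))
    (h0 : g z ≠ 0) : Real.log ‖g z‖ ≤ Real.circleAverage (fun x => Real.log ‖g x‖) z r := by
  have ha : |r| = r := abs_of_pos hr
  rw [AnalyticOnNhd.circleAverage_log_norm hr.ne' (by rwa [ha]) h0]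
  have : 0 ≤ ∑ᶠ (u : ℂ), ((MeromorphicOn.divisor g (Metric.closedBall z |r|)) u : ℝ) * Real.log (r * ‖z - u‖⁻¹) := by
    refine finsum_nonneg fun u => ?_
    by_cases hu : u ∈ Metric.closedBall z |r|
    · have h1 := MeromorphicOn.AnalyticOnNhd.divisor_nonneg (f := g) (U := Metric.closedBall z |r|) (by rwa [ha]) u
      refine mul_nonneg (by exact_mod_cast h1) ?_
      rcases eq_or_ne u z with rfl | hne
      · simp
      · apply Real.log_nonneg
        have hp : 0 < ‖z - u‖ := norm_pos_iff.2 (sub_ne_zero.2 hne.symm)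
        rw [← div_eq_mul_inv, one_le_div hp, norm_sub_rev, ← dist_eq_norm]
        rw [ha] at hu; exact hu
    · rw [Function.locallyFinsuppWithin.apply_eq_zero_of_notMem _ hu]; simp
  linarith

lemma log_norm_mean {V : Type*} [NormedAddCommGroup V] [NormedSpace ℂ V] {Y : ℂ → V} {z : ℂ} {r : ℝ} (hr : 0 < r)
    (hY : AnalyticOnNhd ℂ Y (Metric.closedBall z r)) (h0 : ∀ w ∈ Metric.closedBall z r, Y w ≠ 0) :
    Real.log ‖Y z‖ ≤ Real.circleAverage (fun x => Real.log ‖Y x‖) z r := by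
  have ha : |r| = r := abs_of_pos hr
  have hzz : z ∈ Metric.closedBall z r := Metric.mem_closedBall_self hr.le
  have hsub : Metric.sphere z r ⊆ Metric.closedBall z r := Metric.sphere_subset_closedBall
  obtain ⟨w0, hw0, hmin⟩ := (isCompact_closedBall z r).exists_isMinOn ⟨z, hzz⟩ (hY.continuousOn.norm)
  set m := ‖Y w0‖ with hm
  have hmpos : 0 < m := norm_pos_iff.2 (h0 w0 hw0)
  obtain ⟨g, hg1, hg2⟩ := exists_dual_vector'' ℂ (Y z)
  set q : ℂ → ℂ := fun w => (m:ℂ)⁻¹ * g (Y w) with hq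
  have hqa : AnalyticOnNhd ℂ q (Metric.closedBall z r) := fun w hw =>
    analyticAt_const.mul ((g.analyticAt _).comp (hY w hw))
  have hYz : 0 < ‖Y z‖ := norm_pos_iff.2 (h0 z hzz)
  have hmc : (m:ℂ) ≠ 0 := by exact_mod_cast hmpos.ne'
  have hqz : ‖q z‖ = m⁻¹ * ‖Y z‖ := by
    simp [hq, hg2, abs_of_pos hmpos]
  have h1 := log_mean_ge hr hqa (by rw [← norm_pos_iff, hqz]; positivity)
  have hcont : ContinuousOn (fun x => Real.log ‖Y x‖) (Metric.sphere z r) :=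
    (hY.continuousOn.mono hsub).norm.log fun x hx => (norm_pos_iff.2 (h0 x (hsub hx))).ne'
  have hI : CircleIntegrable (fun x => Real.log ‖Y x‖) z r := hcont.circleIntegrable hr.le
  have hIc : CircleIntegrable (fun _ : ℂ => - Real.log m) z r := continuousOn_const.circleIntegrable hr.le
  have h2 : Real.circleAverage (fun x => Real.log ‖q x‖) z r ≤
      Real.circleAverage ((fun x => Real.log ‖Y x‖) + fun _ : ℂ => - Real.log m) z r := by
    apply Real.circleAverage_mono
    · apply MeromorphicOn.circleIntegrable_log_norm
      rw [ha]; exact fun x hx => (hqa x (hsub hx)).meromorphicAt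
    · exact hI.add hIc
    · intro x hx
      rw [ha] at hx
      have hYx : m ≤ ‖Y x‖ := hmin (hsub hx)
      have e1 : Real.log ‖Y x‖ + - Real.log m = Real.log (m⁻¹ * ‖Y x‖) := by
        rw [Real.log_mul (by positivity) (by linarith), Real.log_inv]; ring
      simp only [Pi.add_apply]
      rw [e1]
      have hle : ‖q x‖ ≤ m⁻¹ * ‖Y x‖ := by
        simp only [hq, norm_mul, norm_inv, Complex.norm_real, Real.norm_eq_abs, abs_of_pos hmpos]
        gcongr
        have := g.le_of_opNorm_le hg1 (Y x)
        simpa using this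
      have hge : 1 ≤ m⁻¹ * ‖Y x‖ := by
        rw [inv_mul_eq_div, one_le_div hmpos]; exact hYx
      rcases eq_or_ne (q x) 0 with h | h
      · rw [h]; simp; exact Real.log_nonneg hge
      · exact Real.log_le_log (norm_pos_iff.2 h) hle
  rw [Real.circleAverage_add hI hIc, Real.circleAverage_const] at h2
  rw [hqz, Real.log_mul (by positivity) (by linarith), Real.log_inv] at h1
  linarith

section lim
variable {l : Filter ℕ} [l.NeBot] {u : ℕ → ℂ → ℝ} {v : ℂ → ℝ} {z : ℂ} {ρ L : ℝ}

lemma lip_lim (ht : ∀ w ∈ Metric.ball z ρ, Tendsto (fun n => u n w) l (𝓝 (v w)))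
    (hl : ∀ᶠ n in l, ∀ w ∈ Metric.ball z ρ, ∀ w' ∈ Metric.ball z ρ, |u n w - u n w'| ≤ L * ‖w - w'‖) :
    ∀ w ∈ Metric.ball z ρ, ∀ w' ∈ Metric.ball z ρ, |v w - v w'| ≤ L * ‖w - w'‖ := fun w hw w' hw' =>
  le_of_tendsto ((ht w hw).sub (ht w' hw')).abs (hl.mono fun _ h => h w hw w' hw')

lemma cont_of_lip (hρ : 0 < ρ)
    (hl : ∀ w ∈ Metric.ball z ρ, ∀ w' ∈ Metric.ball z ρ, |v w - v w'| ≤ L * ‖w - w'‖) :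
    ∀ w ∈ Metric.ball z ρ, ContinuousAt v w := by
  intro w hw
  have hl' : LipschitzOnWith L.toNNReal v (Metric.ball z ρ) := by
    refine LipschitzOnWith.of_dist_le_mul fun a ha b hb => ?_
    rw [Real.dist_eq, dist_eq_norm]
    refine (hl a ha b hb).trans ?_
    gcongr
    exact Real.le_coe_toNNReal L
  exact hl'.continuousOn.continuousAt (Metric.isOpen_ball.mem_nhds hw)

lemma unif_lim (hρ : 0 < ρ) (ht : ∀ w ∈ Metric.ball z ρ, Tendsto (fun n => u n w) l (𝓝 (v w)))
    (hl : ∀ᶠ n in l, ∀ w ∈ Metric.ball z ρ, ∀ w' ∈ Metric.ball z ρ, |u n w - u n w'| ≤ L * ‖w - w'‖)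
    {K : Set ℂ} (hK : IsCompact K) (hKb : K ⊆ Metric.ball z ρ) {ε : ℝ} (hε : 0 < ε) :
    ∀ᶠ n in l, ∀ w ∈ K, |u n w - v w| ≤ ε := by
  have hv := lip_lim ht hl
  have key : ∀ᶠ n in l, ∀ w ∈ K, w ∈ Metric.ball z ρ → |u n w - v w| ≤ ε := by
    refine hK.induction_on (p := fun s => ∀ᶠ n in l, ∀ w ∈ s, w ∈ Metric.ball z ρ → |u n w - v w| ≤ ε) ?_ ?_ ?_ ?_
    · simp
    · exact fun s t hst h => h.mono fun n hn w hw => hn w (hst hw)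
    · intro s t h1 h2
      filter_upwards [h1, h2] with n a b
      rintro w (hw | hw)
      exacts [a w hw, b w hw]
    · intro x hx
      set δ := ε / (3 * (|L| + 1)) with hδ
      have hδ0 : 0 < δ := by positivity
      refine ⟨Metric.ball x δ, mem_nhdsWithin_of_mem_nhds (Metric.ball_mem_nhds x hδ0), ?_⟩
      have h1 := (ht x (hKb hx))
      rw [Metric.tendsto_nhds] at h1
      filter_upwards [h1 (ε / 3) (by positivity), hl] with n h2 h3 w hw hwb
      have h4 := h3 w hwb x (hKb hx)
      have h5 := hv x (hKb hx) w hwb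
      rw [Real.dist_eq] at h2
      have hd : ‖w - x‖ < δ := by rw [← dist_eq_norm]; exact hw
      rw [norm_sub_rev] at h5
      have h6 : L * ‖w - x‖ ≤ ε / 3 := by
        have e1 : (|L| + 1) * δ = ε / 3 := by rw [hδ]; field_simp
        have := le_abs_self L
        nlinarith [norm_nonneg (w - x), abs_nonneg L]
      have : u n w - v w = (u n w - u n x) + (u n x - v x) + (v x - v w) := by ring
      rw [this]
      have := abs_add_three (u n w - u n x) (u n x - v x) (v x - v w)
      linarith
  exact key.mono fun n hn w hw => hn w hw (hKb hw)

lemma submean_lim (hρ : 0 < ρ) (ht : ∀ w ∈ Metric.ball z ρ, Tendsto (fun n => u n w) l (𝓝 (v w)))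
    (hl : ∀ᶠ n in l, ∀ w ∈ Metric.ball z ρ, ∀ w' ∈ Metric.ball z ρ, |u n w - u n w'| ≤ L * ‖w - w'‖)
    (hs : ∀ᶠ n in l, ∀ r, 0 < r → r < ρ → u n z ≤ Real.circleAverage (u n) z r) : SubMean v z := by
  have hv := cont_of_lip hρ (lip_lim ht hl)
  unfold SubMean
  have : ∀ᶠ r in 𝓝[>] (0:ℝ), r < ρ := nhdsWithin_le_nhds (gt_mem_nhds hρ)
  filter_upwards [this, self_mem_nhdsWithin] with r hr hr0
  have hr0 : 0 < r := hr0
  have hsub : Metric.sphere z r ⊆ Metric.ball z ρ := fun x hx => by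
    rw [Metric.mem_sphere] at hx; rw [Metric.mem_ball, hx]; exact hr
  refine le_of_forall_pos_le_add fun ε hε => ?_
  have h1 := unif_lim hρ ht hl (isCompact_sphere z r) hsub (half_pos hε)
  have h2 := (Metric.tendsto_nhds.1 (ht z (Metric.mem_ball_self hρ))) (ε / 2) (half_pos hε)
  obtain ⟨n, h1, h2, h3, h4⟩ := (h1.and (h2.and (hs.and hl))).exists
  rw [Real.dist_eq] at h2
  have h5 := h3 r hr0 hr
  have hI : CircleIntegrable v z r :=
    ContinuousOn.circleIntegrable hr0.le fun x hx => (hv x (hsub hx)).continuousWithinAt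
  have hIn : CircleIntegrable (u n) z r :=
    ContinuousOn.circleIntegrable hr0.le fun x hx => (cont_of_lip hρ h4 x (hsub hx)).continuousWithinAt
  have hIc : CircleIntegrable (fun _ : ℂ => ε / 2) z r := continuousOn_const.circleIntegrable hr0.le
  have h6 : Real.circleAverage (u n) z r ≤ Real.circleAverage (v + fun _ => ε / 2) z r := by
    apply Real.circleAverage_mono hIn (hI.add hIc)
    intro x hx
    rw [abs_of_pos hr0] at hx
    have := (abs_le.1 (h1 x hx)).2
    simp only [Pi.add_apply]; linarith
  rw [Real.circleAverage_add hI hIc, Real.circleAverage_const] at h6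
  have := (abs_lt.1 h2).1
  linarith
end lim

/-- coefficientwise convergence with bounded degree -/
def PConv (l : Filter ℕ) (H : ℕ → ℂ[X]) (G : ℂ[X]) : Prop :=
  (∃ d, G.natDegree ≤ d ∧ ∀ᶠ n in l, (H n).natDegree ≤ d) ∧ ∀ i, Tendsto (fun n => (H n).coeff i) l (𝓝 (G.coeff i))

lemma PConv.eval {l : Filter ℕ} {H : ℕ → ℂ[X]} {G : ℂ[X]} (h : PConv l H G) (z : ℂ) :
    Tendsto (fun q : ℕ × ℂ => (H q.1).eval q.2) (l ×ˢ 𝓝 z) (𝓝 (G.eval z)) := by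
  obtain ⟨⟨d, hd, hd2⟩, hc⟩ := h
  have h1 : Tendsto (fun q : ℕ × ℂ => ∑ i ∈ Finset.range (d + 1), (H q.1).coeff i * q.2 ^ i) (l ×ˢ 𝓝 z)
      (𝓝 (∑ i ∈ Finset.range (d + 1), G.coeff i * z ^ i)) := by
    refine tendsto_finsetSum _ fun i _ => ?_
    exact ((hc i).comp tendsto_fst).mul (tendsto_snd.pow i)
  rw [eval_eq_sum_range' (Nat.lt_succ_of_le hd)]
  refine h1.congr' ?_
  filter_upwards [tendsto_fst.eventually hd2] with q hq
  rw [eval_eq_sum_range' (Nat.lt_succ_of_le hq)]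

lemma PConv.derivative {l : Filter ℕ} {H : ℕ → ℂ[X]} {G : ℂ[X]} (h : PConv l H G) :
    PConv l (fun n => derivative (H n)) (derivative G) := by
  obtain ⟨⟨d, hd, hd2⟩, hc⟩ := h
  refine ⟨⟨d, (natDegree_derivative_le G).trans ((Nat.sub_le _ _).trans hd), hd2.mono fun n hn =>
    (natDegree_derivative_le _).trans ((Nat.sub_le _ _).trans hn)⟩, fun i => ?_⟩
  simp only [coeff_derivative]
  exact (hc (i + 1)).mul_const _

lemma PConv.const (l : Filter ℕ) (G : ℂ[X]) : PConv l (fun _ => G) G :=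
  ⟨⟨_, le_rfl, Eventually.of_forall fun _ => le_rfl⟩, fun _ => tendsto_const_nhds⟩

lemma ultra_lim (l : Ultrafilter ℕ) {V : Type*} [NormedAddCommGroup V] [ProperSpace V] {x : ℕ → V} {K : ℝ}
    (h : ∀ᶠ n in (l : Filter ℕ), ‖x n‖ ≤ K) : ∃ y, Tendsto x l (𝓝 y) := by
  have hc : IsCompact (Metric.closedBall (0:V) K) := isCompact_closedBall 0 K
  have hm : (Ultrafilter.map x l : Filter V) ≤ 𝓟 (Metric.closedBall (0:V) K) := by
    rw [le_principal_iff]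
    have : ∀ᶠ n in (l : Filter ℕ), x n ∈ Metric.closedBall (0:V) K := h.mono fun n hn => by simpa using hn
    exact this
  obtain ⟨y, _, hy⟩ := hc.ultrafilter_le_nhds _ hm
  exact ⟨y, hy⟩

lemma PConv.exists (l : Ultrafilter ℕ) {H : ℕ → ℂ[X]} {d : ℕ} {K : ℝ}
    (hd : ∀ᶠ n in (l : Filter ℕ), (H n).natDegree ≤ d) (hK : ∀ᶠ n in (l : Filter ℕ), ∀ i, ‖(H n).coeff i‖ ≤ K) :
    ∃ G, PConv l H G := by
  have h1 : ∀ i, ∃ y, Tendsto (fun n => (H n).coeff i) l (𝓝 y) := fun i => ultra_lim l (hK.mono fun n hn => hn i)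
  choose y hy using h1
  have h0 : ∀ i, d < i → y i = 0 := fun i hi => by
    refine tendsto_nhds_unique (hy i) (tendsto_const_nhds.congr' ?_)
    filter_upwards [hd] with n hn
    rw [coeff_eq_zero_of_natDegree_lt (hn.trans_lt hi)]
  refine ⟨∑ i ∈ Finset.range (d + 1), C (y i) * X ^ i, ⟨d, ?_, hd⟩, fun i => ?_⟩
  · refine natDegree_sum_le_of_forall_le _ _ fun i hi => ?_
    exact (natDegree_C_mul_X_pow_le _ _).trans (Nat.lt_succ_iff.1 (Finset.mem_range.1 hi))
  · have : (∑ i ∈ Finset.range (d + 1), C (y i) * X ^ i).coeff i = y i := by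
      simp only [finsetSum_coeff, coeff_C_mul_X_pow, Finset.sum_ite_eq, Finset.mem_range]
      split_ifs with h
      · rfl
      · exact (h0 i (by omega)).symm
    rw [this]; exact hy i

structure Ctx (A B : ℂ[X]) (f : ℂ → ℂ) (R₀ : ℝ) (P Q H G : ℕ → ℂ[X]) (κ : ℕ → ℂ) (d : ℕ) : Prop where
  nobr : ∀ E : Set ℂ, E.Finite → ∀ F, ¬ Br A B F Eᶜ
  hA : A ≠ 0
  hR : 1 ≤ R₀
  fBr : Br A B f {z | R₀ < ‖z‖}
  fge : ∀ z : ℂ, R₀ < ‖z‖ → 1 / 2 ≤ ‖f z‖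
  fle : ∀ z : ℂ, R₀ < ‖z‖ → ‖f z‖ ≤ 2
  degP : ∀ n, (P n).natDegree ≤ n
  degQ : ∀ n, (Q n).natDegree ≤ n
  lim : ∀ n, ∃ M : ℂ, Tendsto (fun z : ℂ => z ^ (n + 1) * ((Q n).eval z * f z - (P n).eval z)) (cobounded ℂ) (𝓝 M)
  ode1 : ∀ n, 1 ≤ n → A * H n * derivative (derivative (P n))
      + ((derivative A - B) * H n - A * derivative (H n)) * derivative (P n)
      = (n : ℂ[X]) * ((n : ℂ[X]) + 1) * G n * P n
  ode2 : ∀ n, 1 ≤ n → A * H n * derivative (derivative (Q n))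
      + ((derivative A + B) * H n - A * derivative (H n)) * derivative (Q n)
      + (H n * derivative B - derivative (H n) * B) * Q n
      = (n : ℂ[X]) * ((n : ℂ[X]) + 1) * G n * Q n
  wr : ∀ n, 1 ≤ n → A * (P n * derivative (Q n) - derivative (P n) * Q n) + B * P n * Q n = C (κ n) * H n
  hκ : ∀ n, 1 ≤ n → κ n ≠ 0
  degH : ∀ n, 1 ≤ n → (H n).natDegree ≤ d
  nH : ∀ n, 1 ≤ n → ∑ i ∈ Finset.range (d + 1), ‖(H n).coeff i‖ = 1
  degG : ∃ e, ∀ n, 1 ≤ n → (G n).natDegree ≤ e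
  nG : ∃ K, ∀ n, 1 ≤ n → ∀ i, ‖(G n).coeff i‖ ≤ K

noncomputable def bb (A B : ℂ[X]) (H : ℕ → ℂ[X]) (n : ℕ) (z : ℂ) : ℂ :=
  ((derivative A - B).eval z * (H n).eval z - A.eval z * (derivative (H n)).eval z) / (A.eval z * (H n).eval z)
noncomputable def VV (A : ℂ[X]) (H G : ℕ → ℂ[X]) (n : ℕ) (z : ℂ) : ℂ := (G n).eval z / (A.eval z * (H n).eval z)
noncomputable def vP (P : ℕ → ℂ[X]) (n : ℕ) (z : ℂ) : ℂ × ℂ := ((P n).eval z, (derivative (P n)).eval z / n)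
noncomputable def vQ (A B : ℂ[X]) (Q : ℕ → ℂ[X]) (n : ℕ) (z : ℂ) : ℂ × ℂ :=
  ((Q n).eval z, ((derivative (Q n)).eval z + (Q n).eval z * B.eval z / A.eval z) / n)
noncomputable def vR (A B : ℂ[X]) (P Q : ℕ → ℂ[X]) (n : ℕ) (φ z : ℂ) : ℂ × ℂ := φ • vQ A B Q n z - vP P n z
noncomputable def vY (A B : ℂ[X]) (P Q : ℕ → ℂ[X]) (n : ℕ) (z : ℂ) : (ℂ × ℂ) × (ℂ × ℂ) := (vP P n z, vQ A B Q n z)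

namespace Ctx
variable {A B : ℂ[X]} {f : ℂ → ℂ} {R₀ : ℝ} {P Q H G : ℕ → ℂ[X]} {κ : ℕ → ℂ} {d : ℕ}

lemma solP (c : Ctx A B f R₀ P Q H G κ d) {n : ℕ} (hn : 1 ≤ n) {S : Set ℂ}
    (hS : ∀ z ∈ S, A.eval z ≠ 0 ∧ (H n).eval z ≠ 0) : Sol n (bb A B H n) (VV A H G n) S (vP P n) := by
  intro z hz
  obtain ⟨h1, h2⟩ := hS z hz
  have hn' : (n:ℂ) ≠ 0 := by exact_mod_cast (by omega : n ≠ 0)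
  have e := congrArg (fun p => p.eval z) (c.ode1 n hn)
  simp only [eval_add, eval_sub, eval_mul, eval_natCast, eval_one] at e
  have := ((P n).hasDerivAt z).prodMk (((derivative (P n)).hasDerivAt z).div_const (n:ℂ))
  refine this.congr_deriv ?_
  ext
  · simp [vP]; field_simp
  · simp only [vP, bb, VV]
    field_simp
    simp only [eval_sub]
    linear_combination e

lemma derQ (c : Ctx A B f R₀ P Q H G κ d) {n : ℕ} (hn : 1 ≤ n) {z : ℂ}
    (h1 : A.eval z ≠ 0) (h2 : (H n).eval z ≠ 0) : HasDerivAt (vQ A B Q n)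
      (((n : ℂ) * (vQ A B Q n z).2, - bb A B H n z * (vQ A B Q n z).2
        + ((n:ℂ) + 1) * VV A H G n z * (vQ A B Q n z).1) - (B.eval z / A.eval z) • vQ A B Q n z) z := by
  have hn' : (n:ℂ) ≠ 0 := by exact_mod_cast (by omega : n ≠ 0)
  have e := congrArg (fun p => p.eval z) (c.ode2 n hn)
  simp only [eval_add, eval_sub, eval_mul, eval_natCast, eval_one] at e
  have := ((Q n).hasDerivAt z).prodMk ((((derivative (Q n)).hasDerivAt z).add
    ((((Q n).hasDerivAt z).mul (B.hasDerivAt z)).div (A.hasDerivAt z) h1)).div_const (n:ℂ))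
  refine this.congr_deriv ?_
  ext
  · simp [vQ]; field_simp; ring
  · simp only [vQ, bb, VV, Prod.snd_sub, Prod.smul_snd, smul_eq_mul]
    field_simp
    simp only [eval_sub]
    simp only [Pi.mul_apply]
    linear_combination (A.eval z) * e

lemma solQ (c : Ctx A B f R₀ P Q H G κ d) {n : ℕ} (hn : 1 ≤ n) {S : Set ℂ}
    (hS : ∀ z ∈ S, (H n).eval z ≠ 0) {F : ℂ → ℂ} (hF : Br A B F S) :
    Sol n (bb A B H n) (VV A H G n) S (fun z => F z • vQ A B Q n z) := by
  intro z hz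
  obtain ⟨h0, h1, h3⟩ := hF z hz
  refine (h3.smul (c.derQ hn h1 (hS z hz))).congr_deriv ?_
  ext
  · simp; field_simp; ring
  · simp; field_simp; ring

lemma solR (c : Ctx A B f R₀ P Q H G κ d) {n : ℕ} (hn : 1 ≤ n) {S : Set ℂ}
    (hS : ∀ z ∈ S, (H n).eval z ≠ 0) {F : ℂ → ℂ} (hF : Br A B F S) :
    Sol n (bb A B H n) (VV A H G n) S (fun z => vR A B P Q n (F z) z) := by
  have := (c.solQ hn hS hF).sub_smul (c.solP hn (fun z hz => ⟨(hF z hz).2.1, hS z hz⟩)) 1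
  simpa [vR] using this

lemma det (c : Ctx A B f R₀ P Q H G κ d) {n : ℕ} (hn : 1 ≤ n) {z : ℂ} (h1 : A.eval z ≠ 0) (φ : ℂ) :
    Dt (vP P n z) (vR A B P Q n φ z) = φ * (κ n * ((H n).eval z / A.eval z) / n) := by
  have hn' : (n:ℂ) ≠ 0 := by exact_mod_cast (by omega : n ≠ 0)
  have e := congrArg (fun p => p.eval z) (c.wr n hn)
  simp only [eval_add, eval_sub, eval_mul, eval_C] at e
  simp only [Dt, vP, vR, vQ, Prod.snd_sub, Prod.smul_snd, smul_eq_mul, Prod.fst_sub, Prod.smul_fst]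
  field_simp
  linear_combination φ * e

lemma det_ne (c : Ctx A B f R₀ P Q H G κ d) {n : ℕ} (hn : 1 ≤ n) {z : ℂ} (h1 : A.eval z ≠ 0)
    (h2 : (H n).eval z ≠ 0) {φ : ℂ} (hφ : φ ≠ 0) : Dt (vP P n z) (vR A B P Q n φ z) ≠ 0 := by
  have hn' : (n:ℂ) ≠ 0 := by exact_mod_cast (by omega : n ≠ 0)
  rw [c.det hn h1]
  have := c.hκ n hn
  positivity

lemma vP_ne (c : Ctx A B f R₀ P Q H G κ d) {n : ℕ} (hn : 1 ≤ n) {z : ℂ} (h1 : A.eval z ≠ 0)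
    (h2 : (H n).eval z ≠ 0) : vP P n z ≠ 0 := fun h => by
  have := c.det_ne hn h1 h2 one_ne_zero
  rw [h] at this; simp [Dt] at this

lemma vR_ne (c : Ctx A B f R₀ P Q H G κ d) {n : ℕ} (hn : 1 ≤ n) {z : ℂ} (h1 : A.eval z ≠ 0)
    (h2 : (H n).eval z ≠ 0) {φ : ℂ} (hφ : φ ≠ 0) : vR A B P Q n φ z ≠ 0 := fun h => by
  have := c.det_ne hn h1 h2 hφ
  rw [h] at this; simp [Dt] at this

lemma vY_ne (c : Ctx A B f R₀ P Q H G κ d) {n : ℕ} (hn : 1 ≤ n) {z : ℂ} (h1 : A.eval z ≠ 0)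
    (h2 : (H n).eval z ≠ 0) : vY A B P Q n z ≠ 0 := fun h => by
  have := c.vP_ne hn h1 h2
  exact this (congrArg Prod.fst h)

lemma gronY (c : Ctx A B f R₀ P Q H G κ d) {n : ℕ} (hn : 1 ≤ n) {S : Set ℂ} (hS : Convex ℝ S) {M : ℝ}
    (h : ∀ z ∈ S, A.eval z ≠ 0 ∧ (H n).eval z ≠ 0) (hb : ∀ z ∈ S, ‖bb A B H n z‖ ≤ M)
    (hV : ∀ z ∈ S, ‖VV A H G n z‖ ≤ M) (hB : ∀ z ∈ S, ‖B.eval z / A.eval z‖ ≤ M) {z₁ z₂ : ℂ} (h1 : z₁ ∈ S)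
    (h2 : z₂ ∈ S) : ‖vY A B P Q n z₂‖ ≤ ‖vY A B P Q n z₁‖ * Real.exp (n * (4 * M + 1) * ‖z₂ - z₁‖) := by
  have hn' : (1:ℝ) ≤ n := by exact_mod_cast hn
  refine gron hS (fun z hz => (c.solP hn h z hz).prodMk (c.derQ hn (h z hz).1 (h z hz).2)) (fun z hz => ?_) h1 h2
  have hM : 0 ≤ M := (norm_nonneg _).trans (hb z hz)
  have k1 := Sol.bound (W := vP P n) hn hb hV hz
  have k2 := Sol.bound (W := vQ A B Q n) hn hb hV hz
  have k3 : ‖vP P n z‖ ≤ ‖vY A B P Q n z‖ := norm_fst_le (vY A B P Q n z)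
  have k4 : ‖vQ A B Q n z‖ ≤ ‖vY A B P Q n z‖ := norm_snd_le (vY A B P Q n z)
  rw [Prod.norm_def]
  change _ ≤ n * (4 * M + 1) * ‖vY A B P Q n z‖
  set y := ‖vY A B P Q n z‖
  have hy : 0 ≤ y := norm_nonneg _
  have hMy : 0 ≤ M * y := mul_nonneg hM hy
  have hnMy : 0 ≤ n * (M * y) := by positivity
  have hc : 0 ≤ n * (3 * M + 1) := by positivity
  apply max_le
  · refine k1.trans ?_
    have := mul_le_mul_of_nonneg_left k3 hc
    nlinarith
  · refine (norm_sub_le _ _).trans ?_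
    rw [norm_smul]
    have := mul_le_mul_of_nonneg_left k4 hc
    have k5 : ‖B.eval z / A.eval z‖ * ‖vQ A B Q n z‖ ≤ M * y := mul_le_mul (hB z hz) k4 (norm_nonneg _) hM
    nlinarith

end Ctx

/-- normalised logarithm -/
noncomputable def lg (n : ℕ) (x : ℝ) : ℝ := (1 / (n:ℝ)) * Real.log x

lemma lg_mul {n : ℕ} {x y : ℝ} (hx : 0 < x) (hy : 0 < y) : lg n (x * y) = lg n x + lg n y := by
  rw [lg, lg, lg, Real.log_mul hx.ne' hy.ne']; ring

lemma lg_mono {n : ℕ} {x y : ℝ} (hx : 0 < x) (h : x ≤ y) : lg n x ≤ lg n y := by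
  unfold lg
  have := Real.log_le_log hx h
  gcongr

lemma lg_exp {n : ℕ} (hn : 1 ≤ n) (K : ℝ) : lg n (Real.exp (n * K)) = K := by
  have : (n:ℝ) ≠ 0 := by exact_mod_cast (by omega : n ≠ 0)
  rw [lg, Real.log_exp]; field_simp

lemma exp_lg {n : ℕ} (hn : 1 ≤ n) {x : ℝ} (hx : 0 < x) : Real.exp (n * lg n x) = x := by
  have : (n:ℝ) ≠ 0 := by exact_mod_cast (by omega : n ≠ 0)
  rw [lg, ← mul_assoc, mul_one_div_cancel this, one_mul, Real.exp_log hx]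

lemma le_of_lg_le {n : ℕ} (hn : 1 ≤ n) {x y : ℝ} (hx : 0 < x) (hy : 0 < y) (h : lg n x ≤ lg n y) : x ≤ y := by
  rw [← exp_lg hn hx, ← exp_lg hn hy]
  gcongr

lemma lg_tendsto (K : ℝ) : Tendsto (fun n => lg n K) atTop (𝓝 0) := by
  have := (tendsto_one_div_atTop_nhds_zero_nat (𝕜 := ℝ)).mul_const (Real.log K)
  simpa [lg] using this

lemma lg_tendsto_n : Tendsto (fun n => lg n n) atTop (𝓝 0) := by
  have h := (Real.isLittleO_log_id_atTop.tendsto_div_nhds_zero).comp (tendsto_natCast_atTop_atTop (R := ℝ))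
  refine h.congr fun n => ?_
  simp [lg]; ring

lemma lg_max {n : ℕ} {x y z K : ℝ} (hx : 0 < x) (hy : 0 < y) (hz : 0 < z) (hK : 0 < K) (h : x ≤ K * (y + z)) :
    lg n x ≤ lg n (2 * K) + max (lg n y) (lg n z) := by
  rcases le_total y z with h1 | h1
  · have : x ≤ (2 * K) * z := by nlinarith
    have := lg_mono (n := n) hx this
    rw [lg_mul (by positivity) hz] at this
    linarith [le_max_right (lg n y) (lg n z)]
  · have : x ≤ (2 * K) * y := by nlinarith
    have := lg_mono (n := n) hx this
    rw [lg_mul (by positivity) hy] at this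
    linarith [le_max_left (lg n y) (lg n z)]

def EE (A Hi : ℂ[X]) : Set ℂ := {z | A.eval z = 0 ∨ Hi.eval z = 0}

def Good (A B : ℂ[X]) (H G : ℕ → ℂ[X]) (n : ℕ) (z : ℂ) (M : ℝ) : Prop :=
  A.eval z ≠ 0 ∧ (H n).eval z ≠ 0 ∧ ‖bb A B H n z‖ ≤ M ∧ ‖VV A H G n z‖ ≤ M ∧ ‖B.eval z / A.eval z‖ ≤ M ∧
    M⁻¹ ≤ ‖(H n).eval z / A.eval z‖ ∧ ‖(H n).eval z / A.eval z‖ ≤ M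

structure UC (A B : ℂ[X]) (f : ℂ → ℂ) (R₀ : ℝ) (P Q H G : ℕ → ℂ[X]) (κ : ℕ → ℂ) (d : ℕ) (l : Ultrafilter ℕ)
    (Hi Gi : ℂ[X]) : Prop extends Ctx A B f R₀ P Q H G κ d where
  hl : (l : Filter ℕ) ≤ atTop
  cH : PConv l H Hi
  cG : PConv l G Gi
  hHi : Hi ≠ 0

lemma Ctx.uc {A B : ℂ[X]} {f : ℂ → ℂ} {R₀ : ℝ} {P Q H G : ℕ → ℂ[X]} {κ : ℕ → ℂ} {d : ℕ}
    (c : Ctx A B f R₀ P Q H G κ d) (l : Ultrafilter ℕ) (hl : (l : Filter ℕ) ≤ atTop) :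
    ∃ Hi Gi, UC A B f R₀ P Q H G κ d l Hi Gi := by
  have h1 : ∀ᶠ n in (l : Filter ℕ), 1 ≤ n := hl (eventually_ge_atTop 1)
  obtain ⟨e, he⟩ := c.degG
  obtain ⟨K, hK⟩ := c.nG
  obtain ⟨Gi, hGi⟩ := PConv.exists l (H := G) (d := e) (K := K) (h1.mono he) (h1.mono hK)
  obtain ⟨Hi, hHi⟩ := PConv.exists l (H := H) (d := d) (K := 1) (h1.mono c.degH) (h1.mono fun n hn i => by
    by_cases hi : i ≤ d
    · rw [← c.nH n hn]
      exact Finset.single_le_sum (f := fun i => ‖(H n).coeff i‖) (fun _ _ => norm_nonneg _) (Finset.mem_range.2 (by omega))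
    · rw [coeff_eq_zero_of_natDegree_lt (by have := c.degH n hn; omega)]; simp)
  refine ⟨Hi, Gi, ⟨c, hl, hHi, hGi, ?_⟩⟩
  rintro rfl
  have h2 : Tendsto (fun n => ∑ i ∈ Finset.range (d + 1), ‖(H n).coeff i‖) l (𝓝 (∑ i ∈ Finset.range (d + 1), ‖(0:ℂ[X]).coeff i‖)) :=
    tendsto_finsetSum _ fun i _ => (hHi.2 i).norm
  have h3 : Tendsto (fun n => ∑ i ∈ Finset.range (d + 1), ‖(H n).coeff i‖) l (𝓝 1) :=
    tendsto_const_nhds.congr' (h1.mono fun n hn => (c.nH n hn).symm)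
  have := tendsto_nhds_unique h2 h3
  simp at this

namespace UC
variable {A B : ℂ[X]} {f : ℂ → ℂ} {R₀ : ℝ} {P Q H G : ℕ → ℂ[X]} {κ : ℕ → ℂ} {d : ℕ} {l : Ultrafilter ℕ} {Hi Gi : ℂ[X]}

lemma ev1 (c : UC A B f R₀ P Q H G κ d l Hi Gi) : ∀ᶠ n in (l : Filter ℕ), 1 ≤ n := c.hl (eventually_ge_atTop 1)

lemma finE (c : UC A B f R₀ P Q H G κ d l Hi Gi) : (EE A Hi).Finite := by
  have h1 : {z | A.eval z = 0}.Finite := A.finite_setOf_isRoot c.hA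
  have h2 : {z | Hi.eval z = 0}.Finite := Hi.finite_setOf_isRoot c.hHi
  exact h1.union h2

lemma openE (c : UC A B f R₀ P Q H G κ d l Hi Gi) : IsOpen (EE A Hi)ᶜ := c.finE.isClosed.isOpen_compl

lemma tendsto_VV (c : UC A B f R₀ P Q H G κ d l Hi Gi) {z : ℂ} (hz : z ∉ EE A Hi) :
    Tendsto (fun q : ℕ × ℂ => VV A H G q.1 q.2) ((l : Filter ℕ) ×ˢ 𝓝 z) (𝓝 (Gi.eval z / (A.eval z * Hi.eval z))) := by
  have h1 : A.eval z ≠ 0 := fun h => hz (Or.inl h)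
  have h2 : Hi.eval z ≠ 0 := fun h => hz (Or.inr h)
  exact (c.cG.eval z).div (((PConv.const l A).eval z).mul (c.cH.eval z)) (mul_ne_zero h1 h2)

lemma loc0 (c : UC A B f R₀ P Q H G κ d l Hi Gi) {z : ℂ} (hz : z ∉ EE A Hi) :
    ∃ M, 1 ≤ M ∧ ∀ᶠ q : ℕ × ℂ in (l : Filter ℕ) ×ˢ 𝓝 z, Good A B H G q.1 q.2 M := by
  have h1 : A.eval z ≠ 0 := fun h => hz (Or.inl h)
  have h2 : Hi.eval z ≠ 0 := fun h => hz (Or.inr h)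
  have tA := (PConv.const l A).eval z
  have tA' := (PConv.const l (derivative A - B)).eval z
  have tB := (PConv.const l B).eval z
  have tH := c.cH.eval z
  have tH' := c.cH.derivative.eval z
  have tb : Tendsto (fun q : ℕ × ℂ => bb A B H q.1 q.2) ((l : Filter ℕ) ×ˢ 𝓝 z) _ :=
    ((tA'.mul tH).sub (tA.mul tH')).div (tA.mul tH) (mul_ne_zero h1 h2)
  have tV := c.tendsto_VV hz
  have tBA := tB.div tA h1
  have tHA := tH.div tA h1
  have hpos : 0 < ‖Hi.eval z / A.eval z‖ := norm_pos_iff.2 (div_ne_zero h2 h1)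
  obtain ⟨M, hM⟩ : ∃ M, 1 < M ∧ ‖((derivative A - B).eval z * Hi.eval z - A.eval z * (derivative Hi).eval z) /
      (A.eval z * Hi.eval z)‖ < M ∧ ‖Gi.eval z / (A.eval z * Hi.eval z)‖ < M ∧ ‖B.eval z / A.eval z‖ < M ∧
      ‖Hi.eval z / A.eval z‖ < M ∧ (‖Hi.eval z / A.eval z‖)⁻¹ < M := by
    have := fun x : ℝ => eventually_gt_atTop x
    exact ((this _).and ((this _).and ((this _).and ((this _).and ((this _).and (this _)))))).exists
  obtain ⟨m0, m1, m2, m3, m4, m5⟩ := hM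
  refine ⟨M, m0.le, ?_⟩
  have m6 : M⁻¹ < ‖Hi.eval z / A.eval z‖ := inv_lt_of_inv_lt₀ hpos m5
  filter_upwards [tA.eventually_ne h1, tH.eventually_ne h2, tb.norm.eventually_lt_const m1,
    tV.norm.eventually_lt_const m2, tBA.norm.eventually_lt_const m3, tHA.norm.eventually_lt_const m4,
    tHA.norm.eventually_const_lt m6] with q q1 q2 q3 q4 q5 q6 q7
  exact ⟨q1, q2, q3.le, q4.le, q5.le, q7.le, q6.le⟩

/-- local package -/
lemma loc (c : UC A B f R₀ P Q H G κ d l Hi Gi) {z : ℂ} (hz : z ∉ EE A Hi) {s : Set ℂ} (hs : s ∈ 𝓝 z) :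
    ∃ ρ M, 0 < ρ ∧ 1 ≤ M ∧ Metric.ball z ρ ⊆ s ∧ Metric.ball z ρ ⊆ (EE A Hi)ᶜ ∧
      (∀ᶠ n in (l : Filter ℕ), 1 ≤ n ∧ ∀ w ∈ Metric.ball z ρ, Good A B H G n w M) := by
  obtain ⟨M, hM, h⟩ := c.loc0 hz
  obtain ⟨pa, hpa, pb, hpb, hab⟩ := eventually_prod_iff.1 h
  obtain ⟨ρ, hρ, hsub⟩ := Metric.mem_nhds_iff.1 (inter_mem (inter_mem hpb hs) (c.openE.mem_nhds hz))
  refine ⟨ρ, M, hρ, hM, fun w hw => (hsub hw).1.2, fun w hw => (hsub hw).2, ?_⟩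
  filter_upwards [hpa, c.ev1] with n hn h1
  exact ⟨h1, fun w hw => hab hn (hsub hw).1.1⟩

end UC

section nlevel
variable {A B : ℂ[X]} {f : ℂ → ℂ} {R₀ : ℝ} {P Q H G : ℕ → ℂ[X]} {κ : ℕ → ℂ} {d : ℕ}

lemma lg_gron {n : ℕ} (hn : 1 ≤ n) {x y K t : ℝ} (hx : 0 < x) (hy : 0 < y) (h : x ≤ y * Real.exp (n * K * t)) :
    lg n x ≤ lg n y + K * t := by
  have := lg_mono (n := n) hx h
  rwa [lg_mul hy (Real.exp_pos _), mul_assoc, lg_exp hn] at this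

lemma Ctx.lipY (c : Ctx A B f R₀ P Q H G κ d) {n : ℕ} (hn : 1 ≤ n) {z : ℂ} {ρ M : ℝ}
    (hg : ∀ w ∈ Metric.ball z ρ, Good A B H G n w M) : ∀ w ∈ Metric.ball z ρ, ∀ w' ∈ Metric.ball z ρ,
    |lg n ‖vY A B P Q n w‖ - lg n ‖vY A B P Q n w'‖| ≤ (4 * M + 1) * ‖w - w'‖ := by
  have key : ∀ w ∈ Metric.ball z ρ, ∀ w' ∈ Metric.ball z ρ,
      lg n ‖vY A B P Q n w‖ ≤ lg n ‖vY A B P Q n w'‖ + (4 * M + 1) * ‖w - w'‖ := fun w hw w' hw' =>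
    lg_gron hn (norm_pos_iff.2 (c.vY_ne hn (hg w hw).1 (hg w hw).2.1))
      (norm_pos_iff.2 (c.vY_ne hn (hg w' hw').1 (hg w' hw').2.1))
      (c.gronY hn (convex_ball z ρ) (fun x hx => ⟨(hg x hx).1, (hg x hx).2.1⟩) (fun x hx => (hg x hx).2.2.1)
        (fun x hx => (hg x hx).2.2.2.1) (fun x hx => (hg x hx).2.2.2.2.1) hw' hw)
  intro w hw w' hw'
  rw [abs_le]
  have h1 := key w hw w' hw'
  have h2 := key w' hw' w hw
  rw [norm_sub_rev] at h2
  constructor <;> linarith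

lemma Sol.lip {n : ℕ} (hn : 1 ≤ n) {z : ℂ} {ρ M : ℝ} {W : ℂ → ℂ × ℂ}
    (hg : ∀ w ∈ Metric.ball z ρ, Good A B H G n w M) (hW : Sol n (bb A B H n) (VV A H G n) (Metric.ball z ρ) W)
    (h0 : ∀ w ∈ Metric.ball z ρ, W w ≠ 0) : ∀ w ∈ Metric.ball z ρ, ∀ w' ∈ Metric.ball z ρ,
    |lg n ‖W w‖ - lg n ‖W w'‖| ≤ (3 * M + 1) * ‖w - w'‖ := by
  have key : ∀ w ∈ Metric.ball z ρ, ∀ w' ∈ Metric.ball z ρ,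
      lg n ‖W w‖ ≤ lg n ‖W w'‖ + (3 * M + 1) * ‖w - w'‖ := fun w hw w' hw' =>
    lg_gron hn (norm_pos_iff.2 (h0 w hw)) (norm_pos_iff.2 (h0 w' hw'))
      (Sol.gron hn (fun x hx => (hg x hx).2.2.1) (fun x hx => (hg x hx).2.2.2.1) (convex_ball z ρ) hW hw' hw)
  intro w hw w' hw'
  rw [abs_le]
  have h1 := key w hw w' hw'
  have h2 := key w' hw' w hw
  rw [norm_sub_rev] at h2
  constructor <;> linarith

lemma Ctx.lipR (c : Ctx A B f R₀ P Q H G κ d) {n : ℕ} (hn : 1 ≤ n) {z : ℂ} {ρ M : ℝ} {F : ℂ → ℂ}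
    (hF : Br A B F (Metric.ball z ρ))
    (hg : ∀ w ∈ Metric.ball z ρ, Good A B H G n w M) : ∀ w ∈ Metric.ball z ρ, ∀ w' ∈ Metric.ball z ρ,
    |lg n ‖vR A B P Q n (F w) w‖ - lg n ‖vR A B P Q n (F w') w'‖| ≤ (3 * M + 1) * ‖w - w'‖ :=
  Sol.lip (W := fun w => vR A B P Q n (F w) w) hn hg (c.solR hn (fun w hw => (hg w hw).2.1) hF)
    (fun w hw => c.vR_ne hn (hg w hw).1 (hg w hw).2.1 (hF w hw).1)

lemma vR_le (n : ℕ) (φ z : ℂ) : ‖vR A B P Q n φ z‖ ≤ (1 + ‖φ‖) * ‖vY A B P Q n z‖ := by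
  have k3 : ‖vP P n z‖ ≤ ‖vY A B P Q n z‖ := norm_fst_le (vY A B P Q n z)
  have k4 : ‖vQ A B Q n z‖ ≤ ‖vY A B P Q n z‖ := norm_snd_le (vY A B P Q n z)
  refine (norm_sub_le _ _).trans ?_
  rw [norm_smul]
  nlinarith [norm_nonneg φ]

lemma vY_le_PR (n : ℕ) {φ : ℂ} (hφ : φ ≠ 0) (z : ℂ) :
    ‖vY A B P Q n z‖ ≤ (1 + 1 / ‖φ‖) * (‖vP P n z‖ + ‖vR A B P Q n φ z‖) := by
  have h : ‖φ‖ * ‖vQ A B Q n z‖ ≤ ‖vP P n z‖ + ‖vR A B P Q n φ z‖ := by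
    rw [← norm_smul]
    have : φ • vQ A B Q n z = vP P n z + vR A B P Q n φ z := by simp [vR]
    rw [this]; exact norm_add_le _ _
  have hp : 0 < ‖φ‖ := norm_pos_iff.2 hφ
  have h2 : ‖vQ A B Q n z‖ ≤ 1 / ‖φ‖ * (‖vP P n z‖ + ‖vR A B P Q n φ z‖) := by
    rw [one_div, ← div_eq_inv_mul, le_div_iff₀ hp]; linarith
  rw [vY, Prod.norm_def]
  have := norm_nonneg (vR A B P Q n φ z)
  have := norm_nonneg (vP P n z)
  have : 0 ≤ 1 / ‖φ‖ * (‖vP P n z‖ + ‖vR A B P Q n φ z‖) := by positivity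
  apply max_le <;> simp only <;> linarith

lemma vY_le_RR (n : ℕ) {φ φ' : ℂ} (hφ : φ ≠ φ') (z : ℂ) :
    ‖vY A B P Q n z‖ ≤ ((1 + ‖φ‖) / ‖φ - φ'‖ + 1) * (‖vR A B P Q n φ z‖ + ‖vR A B P Q n φ' z‖) := by
  have hp : 0 < ‖φ - φ'‖ := norm_pos_iff.2 (sub_ne_zero.2 hφ)
  set s := ‖vR A B P Q n φ z‖ + ‖vR A B P Q n φ' z‖ with hs
  have hs0 : 0 ≤ s := by positivity
  have h2 : ‖vQ A B Q n z‖ ≤ s / ‖φ - φ'‖ := by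
    rw [le_div_iff₀ hp, mul_comm, ← norm_smul]
    have : (φ - φ') • vQ A B Q n z = vR A B P Q n φ z - vR A B P Q n φ' z := by simp [vR, sub_smul]
    rw [this]; exact norm_sub_le _ _
  have h3 : ‖vP P n z‖ ≤ ‖φ‖ * ‖vQ A B Q n z‖ + s := by
    have : vP P n z = φ • vQ A B Q n z - vR A B P Q n φ z := by simp [vR]
    rw [this]
    refine (norm_sub_le _ _).trans ?_
    rw [norm_smul]
    have := norm_nonneg (vR A B P Q n φ' z)
    linarith
  have h4 : ‖φ‖ * ‖vQ A B Q n z‖ ≤ ‖φ‖ * (s / ‖φ - φ'‖) := by gcongr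
  have h5 : ((1 + ‖φ‖) / ‖φ - φ'‖ + 1) * s = s / ‖φ - φ'‖ + ‖φ‖ * (s / ‖φ - φ'‖) + s := by field_simp
  rw [h5, vY, Prod.norm_def]
  have : 0 ≤ ‖φ‖ * (s / ‖φ - φ'‖) := by positivity
  have : 0 ≤ s / ‖φ - φ'‖ := by positivity
  apply max_le <;> simp only <;> linarith

end nlevel

lemma max_ext {k : ℂ → ℂ} {R₀ R₁ C : ℝ} {M : ℂ} (h0 : 0 ≤ R₀) (h01 : R₀ < R₁)
    (hk : DifferentiableOn ℂ k {z | R₀ < ‖z‖})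
    (hM : Tendsto k (cobounded ℂ) (𝓝 M)) (hC : ∀ z : ℂ, ‖z‖ = R₁ → ‖k z‖ ≤ C) {z : ℂ} (hz : R₁ ≤ ‖z‖) : ‖k z‖ ≤ C := by
  classical
  have hR1 : 0 < R₁ := h0.trans_lt h01
  have hop : IsOpen {z : ℂ | R₀ < ‖z‖} := isOpen_lt continuous_const continuous_norm
  set g : ℂ → ℂ := Function.update (fun u => k u⁻¹) 0 M with hg
  have hg1 : ∀ u, u ≠ 0 → g u = k u⁻¹ := fun u hu => by simp [hg, hu]
  set U : Set ℂ := Metric.ball 0 (R₀⁻¹) with hU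
  obtain ⟨r, hr1, hr2⟩ : ∃ r, R₁⁻¹ < r ∧ ∀ u : ℂ, ‖u‖ < r → u ≠ 0 → R₀ < ‖u⁻¹‖ := by
    refine ⟨((R₀ + R₁) / 2)⁻¹, by
      apply inv_strictAnti₀ <;> linarith, fun u hu hu0 => ?_⟩
    rw [norm_inv]
    have : 0 < ‖u‖ := norm_pos_iff.2 hu0
    have h2 : (R₀ + R₁) / 2 < ‖u‖⁻¹ := by
      rw [lt_inv_comm₀ (by linarith) this]; exact hu
    linarith
  have hr0 : 0 < r := (inv_pos.2 hR1).trans hr1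
  have hd : DifferentiableOn ℂ g (Metric.ball 0 r) := by
    rw [← Complex.differentiableOn_compl_singleton_and_continuousAt_iff (Metric.ball_mem_nhds (0:ℂ) hr0)]
    constructor
    · intro u hu
      have hu0 : u ≠ 0 := hu.2
      have hu1 : ‖u‖ < r := by simpa using hu.1
      have h1 : DifferentiableAt ℂ (fun u => k u⁻¹) u :=
        DifferentiableAt.comp (f := fun u : ℂ => u⁻¹) u ((hk _ (hr2 u hu1 hu0)).differentiableAt (hop.mem_nhds (hr2 u hu1 hu0)))
          (differentiableAt_inv hu0)
      refine (h1.congr_of_eventuallyEq ?_).differentiableWithinAt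
      filter_upwards [isOpen_ne.mem_nhds hu0] with v hv
      exact hg1 v hv
    · rw [continuousAt_update_same]
      exact hM.comp tendsto_inv₀_nhdsNE_zero
  have hcl : DiffContOnCl ℂ g (Metric.ball 0 R₁⁻¹) := by
    refine DifferentiableOn.diffContOnCl (hd.mono ?_)
    rw [closure_ball _ (inv_pos.2 hR1).ne']
    exact Metric.closedBall_subset_ball hr1
  have hz0 : z ≠ 0 := norm_pos_iff.1 (hR1.trans_le hz)
  have := Complex.norm_le_of_forall_mem_frontier_norm_le (C := C) Metric.isBounded_ball hcl (z := z⁻¹) (fun u hu => by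
    rw [frontier_ball _ (inv_pos.2 hR1).ne'] at hu
    have hu1 : ‖u‖ = R₁⁻¹ := by simpa using hu
    have hu0 : u ≠ 0 := norm_pos_iff.1 (by rw [hu1]; positivity)
    rw [hg1 u hu0]
    apply hC; rw [norm_inv, hu1, inv_inv]) (by
      rw [closure_ball _ (inv_pos.2 hR1).ne']
      simp only [mem_closedBall_zero_iff, norm_inv]
      exact inv_anti₀ hR1 hz)
  rwa [hg1 _ (inv_ne_zero hz0), inv_inv] at this

lemma bw {p : ℂ[X]} {n : ℕ} (hp : p.natDegree ≤ n) {zb : ℂ} {ρ M : ℝ} (hρ : 0 < ρ)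
    (hM : ∀ z ∈ Metric.closedBall zb ρ, ‖p.eval z‖ ≤ M) {z : ℂ} (hz : ρ ≤ ‖z - zb‖) :
    ‖p.eval z‖ ≤ M * (‖z - zb‖ / ρ) ^ n := by
  set q := reflect n (p.comp (X + C zb)) with hq
  have hdeg : (p.comp (X + C zb)).natDegree ≤ n := by
    rw [natDegree_comp]; simpa using hp
  have hev : ∀ u : ℂ, u ≠ 0 → q.eval u⁻¹ * u ^ n = p.eval (u + zb) := fun u hu => by
    letI := invertibleOfNonzero hu
    have := eval₂_reflect_mul_pow (RingHom.id ℂ) u n (p.comp (X + C zb)) hdeg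
    simpa [eval₂_eq_eval_map, invOf_eq_inv] using this
  have hw : 0 < ‖z - zb‖ := hρ.trans_le hz
  have hw0 : z - zb ≠ 0 := norm_pos_iff.1 hw
  have hcl : DiffContOnCl ℂ (fun u => q.eval u) (Metric.ball 0 ρ⁻¹) := q.differentiable.diffContOnCl
  have := Complex.norm_le_of_forall_mem_frontier_norm_le (C := M * (ρ⁻¹) ^ n) Metric.isBounded_ball hcl (z := (z - zb)⁻¹) (fun u hu => by
    rw [frontier_ball _ (inv_pos.2 hρ).ne'] at hu
    have hu1 : ‖u‖ = ρ⁻¹ := by simpa using hu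
    have hu0 : u ≠ 0 := norm_pos_iff.1 (by rw [hu1]; positivity)
    have h1 := hev u⁻¹ (inv_ne_zero hu0)
    rw [inv_inv] at h1
    have h2 : q.eval u = p.eval (u⁻¹ + zb) * u ^ n := by
      rw [← h1, inv_pow, mul_assoc, inv_mul_cancel₀ (pow_ne_zero _ hu0), mul_one]
    change ‖q.eval u‖ ≤ _
    rw [h2, norm_mul, norm_pow, hu1]
    gcongr
    apply hM
    simp [hu1]) (by
      rw [closure_ball _ (inv_pos.2 hρ).ne']
      simp only [mem_closedBall_zero_iff, norm_inv]
      exact inv_anti₀ hρ hz)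
  have h1 := hev (z - zb) hw0
  rw [sub_add_cancel] at h1
  rw [← h1, norm_mul, norm_pow, div_eq_mul_inv, mul_pow]
  calc _ ≤ (M * ρ⁻¹ ^ n) * ‖z - zb‖ ^ n := by gcongr
    _ = _ := by ring

lemma bw' {p : ℂ[X]} {n : ℕ} (hp : p.natDegree ≤ n) {zb : ℂ} {ρ M : ℝ} (hρ : 0 < ρ) 
    (hM : ∀ z ∈ Metric.closedBall zb ρ, ‖p.eval z‖ ≤ M) (z : ℂ) :
    ‖p.eval z‖ ≤ M * (1 + ‖z - zb‖ / ρ) ^ n := by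
  have hM0 : 0 ≤ M := (norm_nonneg _).trans (hM zb (Metric.mem_closedBall_self hρ.le))
  rcases le_total ρ ‖z - zb‖ with h | h
  · refine (bw hp hρ hM h).trans ?_
    gcongr; linarith
  · refine (hM z (by rwa [mem_closedBall_iff_norm])).trans ?_
    apply le_mul_of_one_le_right hM0
    apply one_le_pow₀
    have : 0 ≤ ‖z - zb‖ / ρ := by positivity
    linarith

/-- uniform growth in one basis -/
lemma bw2 (zb : ℂ) {ρ : ℝ} (hρ : 0 < ρ) : ∃ K, 1 ≤ K ∧ ∀ (n : ℕ) (p : ℂ[X]) (M : ℝ), 1 ≤ n → p.natDegree ≤ n →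
    (∀ z ∈ Metric.closedBall zb ρ, ‖p.eval z‖ ≤ M) → ∀ z : ℂ, ‖p.eval z‖ ≤ M * (K * (1 + ‖z‖)) ^ n ∧
      ‖(derivative p).eval z‖ ≤ M * (K * (1 + ‖z‖)) ^ n := by
  refine ⟨2 * (1 + (1 + ‖zb‖) / ρ), ?_, fun n p M hn hp hM => ?_⟩
  · have : 0 ≤ (1 + ‖zb‖) / ρ := by positivity
    linarith
  have hM0 : 0 ≤ M := (norm_nonneg _).trans (hM zb (Metric.mem_closedBall_self hρ.le))
  have key : ∀ z : ℂ, ‖p.eval z‖ ≤ M * ((1 + (1 + ‖zb‖) / ρ) * (1 + ‖z‖)) ^ n := fun z => by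
    refine (bw' hp hρ hM z).trans ?_
    gcongr
    have h1 : ‖z - zb‖ ≤ ‖z‖ + ‖zb‖ := norm_sub_le _ _
    have h2 : ‖z - zb‖ / ρ ≤ (‖z‖ + ‖zb‖) / ρ := by gcongr
    have h3 : (1 + (1 + ‖zb‖) / ρ) * (1 + ‖z‖) - (1 + (‖z‖ + ‖zb‖) / ρ) = ‖z‖ + (1 + ‖zb‖ * ‖z‖) / ρ := by
      field_simp; ring
    have h4 : 0 ≤ ‖z‖ + (1 + ‖zb‖ * ‖z‖) / ρ := by positivity
    linarith
  intro z
  constructor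
  · refine (key z).trans ?_
    gcongr
    have : 0 ≤ (1 + ‖zb‖) / ρ := by positivity
    linarith
  · have hd := Complex.norm_deriv_le_of_forall_mem_sphere_norm_le (f := fun z => p.eval z) (c := z) one_pos
      p.differentiable.diffContOnCl (C := M * (2 * (1 + (1 + ‖zb‖) / ρ) * (1 + ‖z‖)) ^ n) (fun w hw => by
        refine (key w).trans ?_
        have h1 : ‖w - z‖ = 1 := by simpa using hw
        have h2 : ‖w‖ ≤ 1 + ‖z‖ := by
          have := norm_add_le (w - z) z
          rw [sub_add_cancel, h1] at this; exact this
        have h3 : 0 ≤ (1 + ‖zb‖) / ρ := by positivity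
        gcongr M * ?_ ^ n
        nlinarith [norm_nonneg z])
    rwa [Polynomial.deriv, div_one] at hd

lemma far_decay {f : ℂ → ℂ} {R₀ : ℝ} (h0 : 0 ≤ R₀) {p q : ℂ[X]} {n : ℕ} (hf : DifferentiableOn ℂ f {z | R₀ < ‖z‖})
    (hM : ∃ M : ℂ, Tendsto (fun z : ℂ => z ^ (n + 1) * (q.eval z * f z - p.eval z)) (cobounded ℂ) (𝓝 M))
    {R₁ C : ℝ} (h01 : R₀ < R₁) (h1 : 1 ≤ R₁) (hC : ∀ z : ℂ, ‖z‖ = R₁ → ‖q.eval z * f z - p.eval z‖ ≤ C) {z : ℂ} (hz : 2 * R₁ ≤ ‖z‖) :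
    ‖q.eval z * f z - p.eval z‖ ≤ C * (2 * R₁ / ‖z‖) ^ (n + 1) ∧
    ‖deriv (fun z => q.eval z * f z - p.eval z) z‖ ≤ C * (2 * R₁ / ‖z‖) ^ (n + 1) := by
  obtain ⟨M, hM⟩ := hM
  have hR : 0 < R₁ := by linarith
  have hd : DifferentiableOn ℂ (fun z => q.eval z * f z - p.eval z) {z | R₀ < ‖z‖} :=
    (q.differentiable.differentiableOn.mul hf).sub p.differentiable.differentiableOn
  have hC0 : 0 ≤ C := (norm_nonneg _).trans (hC (R₁ : ℂ) (by simp [abs_of_pos hR]))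
  have key : ∀ w : ℂ, R₁ ≤ ‖w‖ → ‖q.eval w * f w - p.eval w‖ ≤ C * (R₁ / ‖w‖) ^ (n + 1) := fun w hw => by
    have := max_ext (k := fun z : ℂ => z ^ (n + 1) * (q.eval z * f z - p.eval z)) h0 h01
      ((differentiable_id.pow _).differentiableOn.mul hd) hM (C := R₁ ^ (n + 1) * C) (fun z hz => by
        rw [norm_mul, norm_pow, hz]
        gcongr; exact hC z hz) hw
    rw [norm_mul, norm_pow] at this
    have hw0 : 0 < ‖w‖ := hR.trans_le hw
    rw [div_pow, mul_div_assoc', le_div_iff₀ (by positivity)]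
    linarith
  have hz0 : 0 < ‖z‖ := by linarith
  constructor
  · refine (key z (by linarith)).trans ?_
    gcongr; linarith
  · have := Complex.norm_deriv_le_of_forall_mem_sphere_norm_le (f := fun z => q.eval z * f z - p.eval z) (c := z) one_pos
      (DifferentiableOn.diffContOnCl (hd.mono fun w hw => ?_)) (C := C * (2 * R₁ / ‖z‖) ^ (n + 1)) (fun w hw => by
        have h1 : ‖w - z‖ = 1 := by simpa using hw
        have h2 : ‖z‖ ≤ 1 + ‖w‖ := by
          have := norm_sub_le w (w - z)
          rw [sub_sub_cancel, h1] at this; linarith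
        refine (key w (by linarith)).trans ?_
        gcongr C * ?_ ^ _
        have hw0 : 0 < ‖w‖ := by linarith
        rw [div_le_div_iff₀ hw0 hz0]
        nlinarith)
    · rwa [div_one] at this
    · rw [closure_ball _ one_ne_zero] at hw
      have h1 : ‖w - z‖ ≤ 1 := by simpa [dist_eq_norm] using hw
      have h2 : ‖z‖ ≤ 1 + ‖w‖ := by
          have := norm_sub_le w (w - z)
          rw [sub_sub_cancel] at this; linarith
      change R₀ < ‖w‖
      linarith

namespace UC
variable {A B : ℂ[X]} {f : ℂ → ℂ} {R₀ : ℝ} {P Q H G : ℕ → ℂ[X]} {κ : ℕ → ℂ} {d : ℕ} {l : Ultrafilter ℕ} {Hi Gi : ℂ[X]}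

lemma bdY (c : UC A B f R₀ P Q H G κ d l Hi Gi) {zb z : ℂ} (hzb : zb ∉ EE A Hi) (hz : z ∉ EE A Hi) :
    ∃ K, ∀ᶠ n in (l : Filter ℕ), |lg n ‖vY A B P Q n z‖ - lg n ‖vY A B P Q n zb‖| ≤ K := by
  have tr : ∀ x ∈ (EE A Hi)ᶜ, ∃ ρ, 0 < ρ ∧ ∀ w ∈ Metric.ball x ρ, ∀ w' ∈ Metric.ball x ρ,
      (∃ K, ∀ᶠ n in (l : Filter ℕ), |lg n ‖vY A B P Q n w‖ - lg n ‖vY A B P Q n zb‖| ≤ K) →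
      (∃ K, ∀ᶠ n in (l : Filter ℕ), |lg n ‖vY A B P Q n w'‖ - lg n ‖vY A B P Q n zb‖| ≤ K) := by
    intro x hx
    obtain ⟨ρ, M, hρ, hM, -, -, hg⟩ := c.loc hx univ_mem
    refine ⟨ρ, hρ, fun w hw w' hw' ⟨K, hK⟩ => ⟨K + (4 * M + 1) * ‖w - w'‖, ?_⟩⟩
    filter_upwards [hg, hK] with n hn hK
    have := c.lipY hn.1 hn.2 w hw w' hw'
    rw [abs_le] at *
    constructor <;> linarith [this.1, this.2, hK.1, hK.2]
  refine clopen_all (p := fun z => ∃ K, ∀ᶠ n in (l : Filter ℕ), |lg n ‖vY A B P Q n z‖ - lg n ‖vY A B P Q n zb‖| ≤ K)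
    (compl_finite_connected c.finE).isPreconnected ?_ ?_ hzb ?_ z hz
  · intro x hx hp
    obtain ⟨ρ, hρ, h⟩ := tr x hx
    filter_upwards [Metric.ball_mem_nhds x hρ] with y hy
    exact h x (Metric.mem_ball_self hρ) y hy hp
  · intro x hx hp
    obtain ⟨ρ, hρ, h⟩ := tr x hx
    filter_upwards [Metric.ball_mem_nhds x hρ] with y hy hq
    exact hp (h y hy x (Metric.mem_ball_self hρ) hq)
  · exact ⟨0, Eventually.of_forall fun n => by simp⟩

lemma growPQ (c : UC A B f R₀ P Q H G κ d l Hi Gi) {zb : ℂ} (hzb : zb ∉ EE A Hi) :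
    ∃ K, 1 ≤ K ∧ ∀ᶠ n in (l : Filter ℕ), 1 ≤ n ∧ ∀ z : ℂ,
      ‖(P n).eval z‖ ≤ ‖vY A B P Q n zb‖ * (K * (1 + ‖z‖)) ^ n ∧
      ‖(derivative (P n)).eval z‖ ≤ ‖vY A B P Q n zb‖ * (K * (1 + ‖z‖)) ^ n ∧
      ‖(Q n).eval z‖ ≤ ‖vY A B P Q n zb‖ * (K * (1 + ‖z‖)) ^ n ∧
      ‖(derivative (Q n)).eval z‖ ≤ ‖vY A B P Q n zb‖ * (K * (1 + ‖z‖)) ^ n := by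
  obtain ⟨ρ, M, hρ, hM, -, -, hg⟩ := c.loc hzb univ_mem
  obtain ⟨K, hK, h⟩ := bw2 zb (half_pos hρ)
  refine ⟨Real.exp ((4 * M + 1) * ρ) * K, ?_, ?_⟩
  · have : 1 ≤ Real.exp ((4 * M + 1) * ρ) := Real.one_le_exp (by positivity)
    nlinarith
  filter_upwards [hg] with n hn
  obtain ⟨h1, hg⟩ := hn
  have key : ∀ w ∈ Metric.closedBall zb (ρ / 2), ‖vY A B P Q n w‖ ≤ ‖vY A B P Q n zb‖ * Real.exp ((4 * M + 1) * ρ) ^ n := by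
    intro w hw
    have hw1 : w ∈ Metric.ball zb ρ := Metric.closedBall_subset_ball (half_lt_self hρ) hw
    have hw2 : ‖w - zb‖ ≤ ρ := by rw [← mem_closedBall_iff_norm]; exact Metric.ball_subset_closedBall hw1
    refine (c.gronY h1 (convex_ball zb ρ) (fun x hx => ⟨(hg x hx).1, (hg x hx).2.1⟩) (fun x hx => (hg x hx).2.2.1)
        (fun x hx => (hg x hx).2.2.2.1) (fun x hx => (hg x hx).2.2.2.2.1) (Metric.mem_ball_self hρ) hw1).trans ?_
    rw [← Real.exp_nat_mul, ← mul_assoc]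
    gcongr
  refine ⟨h1, fun z => ?_⟩
  have hP := h n (P n) _ h1 (c.degP n) (fun w hw => (((norm_fst_le (vP P n w)).trans (norm_fst_le (vY A B P Q n w))).trans (key w hw))) z
  have hQ := h n (Q n) _ h1 (c.degQ n) (fun w hw => (((norm_fst_le (vQ A B Q n w)).trans (norm_snd_le (vY A B P Q n w))).trans (key w hw))) z
  have e : ‖vY A B P Q n zb‖ * (Real.exp ((4 * M + 1) * ρ) * K * (1 + ‖z‖)) ^ n
     = ‖vY A B P Q n zb‖ * Real.exp ((4 * M + 1) * ρ) ^ n * (K * (1 + ‖z‖)) ^ n := by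
    rw [mul_assoc _ K, mul_pow, mul_assoc]
  rw [e]
  exact ⟨hP.1, hP.2, hQ.1, hQ.2⟩

lemma growY (c : UC A B f R₀ P Q H G κ d l Hi Gi) {zb : ℂ} (hzb : zb ∉ EE A Hi) :
    ∃ K, 1 ≤ K ∧ ∀ᶠ n in (l : Filter ℕ), 1 ≤ n ∧ ∀ z : ℂ,
      ‖vY A B P Q n z‖ ≤ (1 + ‖B.eval z / A.eval z‖) * (‖vY A B P Q n zb‖ * (K * (1 + ‖z‖)) ^ n) := by
  obtain ⟨K, hK, h⟩ := c.growPQ hzb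
  refine ⟨K, hK, ?_⟩
  filter_upwards [h] with n hn
  refine ⟨hn.1, fun z => ?_⟩
  obtain ⟨h1, h2, h3, h4⟩ := hn.2 z
  have hn1 : (1:ℝ) ≤ ‖(n:ℂ)‖ := by simpa using hn.1
  set y := ‖vY A B P Q n zb‖ * (K * (1 + ‖z‖)) ^ n
  have hy : 0 ≤ y := (norm_nonneg _).trans h1
  have hb : 0 ≤ ‖B.eval z / A.eval z‖ := norm_nonneg _
  have hyy : y ≤ (1 + ‖B.eval z / A.eval z‖) * y := by nlinarith
  rw [vY, Prod.norm_def, vP, vQ, Prod.norm_def, Prod.norm_def]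
  refine max_le (max_le (h1.trans hyy) ?_) (max_le (h3.trans hyy) ?_)
  · simp only
    rw [norm_div _ (n:ℂ)]
    exact ((div_le_self (norm_nonneg _) hn1).trans h2).trans hyy
  · simp only
    rw [norm_div]
    refine (div_le_self (norm_nonneg _) hn1).trans ((norm_add_le _ _).trans ?_)
    rw [mul_div_assoc, norm_mul]
    nlinarith

lemma decR (c : UC A B f R₀ P Q H G κ d l Hi Gi) {zb : ℂ} (hzb : zb ∉ EE A Hi) :
    ∃ K R, 1 ≤ K ∧ R₀ < R ∧ ∀ᶠ n in (l : Filter ℕ), 1 ≤ n ∧ ∀ z : ℂ, R ≤ ‖z‖ → 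
      ‖vR A B P Q n (f z) z‖ ≤ 3 * ‖vY A B P Q n zb‖ * (K / ‖z‖) ^ n := by
  obtain ⟨K, hK, h⟩ := c.growPQ hzb
  have hR := c.hR
  have hfd : DifferentiableOn ℂ f {z | R₀ < ‖z‖} := fun z hz => (c.fBr z hz).2.2.differentiableAt.differentiableWithinAt
  refine ⟨K * (1 + (R₀ + 1)) * (2 * (R₀ + 1)), 2 * (R₀ + 1), ?_, by linarith, ?_⟩
  · have : 1 ≤ K * (1 + (R₀ + 1)) := by nlinarith
    nlinarith
  filter_upwards [h] with n hn
  refine ⟨hn.1, fun z hz => ?_⟩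
  have hn1 : (1:ℝ) ≤ ‖(n:ℂ)‖ := by simpa using hn.1
  set y := ‖vY A B P Q n zb‖ with hy
  have hy0 : 0 ≤ y := norm_nonneg _
  have hz1 : R₀ < ‖z‖ := by linarith
  obtain ⟨k1, k2⟩ := far_decay (C := 3 * y * (K * (1 + (R₀ + 1))) ^ n) (by linarith) hfd (c.lim n) (R₁ := R₀ + 1) (by linarith) (by linarith) (fun w hw => by
    obtain ⟨h1, h2, h3, h4⟩ := hn.2 w
    have hf := c.fle w (by linarith)
    rw [hw] at h1 h3
    refine (norm_sub_le _ _).trans ?_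
    rw [norm_mul]
    have := norm_nonneg ((Q n).eval w)
    nlinarith) hz
  have hzp : 0 < ‖z‖ := by linarith
  have hle : 2 * (R₀ + 1) / ‖z‖ ≤ 1 := by rw [div_le_one hzp]; exact hz
  have hfin : 3 * y * (K * (1 + (R₀ + 1))) ^ n * (2 * (R₀ + 1) / ‖z‖) ^ (n + 1) ≤ 3 * y * (K * (1 + (R₀ + 1)) * (2 * (R₀ + 1)) / ‖z‖) ^ n := by
    rw [mul_div_assoc (K * (1 + (R₀ + 1))), mul_pow (K * (1 + (R₀ + 1))), ← mul_assoc]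
    apply mul_le_mul_of_nonneg_left _ (by positivity)
    apply pow_le_pow_of_le_one (by positivity) hle (by omega)
  have hder : HasDerivAt (fun z => (Q n).eval z * f z - (P n).eval z) 
      ((derivative (Q n)).eval z * f z + (Q n).eval z * (B.eval z * f z / A.eval z) - (derivative (P n)).eval z) z := 
    (((Q n).hasDerivAt z).mul (c.fBr z hz1).2.2).sub ((P n).hasDerivAt z)
  rw [hder.deriv] at k2
  have e : vR A B P Q n (f z) z = ((Q n).eval z * f z - (P n).eval z, ((derivative (Q n)).eval z * f z + (Q n).eval z * (B.eval z * f z / A.eval z) - (derivative (P n)).eval z) / n) := by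
    ext
    · simp [vR, vQ, vP]; ring
    · simp [vR, vQ, vP]; ring
  rw [e, Prod.norm_def]
  refine max_le (k1.trans hfin) ?_
  simp only
  rw [norm_div]
  exact ((div_le_self (norm_nonneg _) hn1).trans k2).trans hfin

lemma far_pos (c : UC A B f R₀ P Q H G κ d l Hi Gi) {zb : ℂ} (hzb : zb ∉ EE A Hi) {R : ℝ}
    (hE : ∀ z ∈ EE A Hi, ‖z‖ < R) (hR : ‖zb‖ < R) : ∃ z, ‖z‖ = R ∧ 
      ∀ᶠ n in (l : Filter ℕ), lg n ‖vY A B P Q n zb‖ - 1 ≤ lg n ‖vY A B P Q n z‖ := by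
  have hR0 : 0 < R := (norm_nonneg _).trans_lt hR
  set pv : ℕ → ℂ → (ℂ × ℂ) × (ℂ × ℂ) := fun n z => (((P n).eval z, (derivative (P n)).eval z / n), 
    ((Q n).eval z, (derivative (Q n)).eval z / n)) with hpv
  have hpd : ∀ n, Differentiable ℂ (pv n) := fun n => 
    ((P n).differentiable.prodMk ((derivative (P n)).differentiable.div_const _)).prodMk 
    ((Q n).differentiable.prodMk ((derivative (Q n)).differentiable.div_const _))
  -- comparison
  have cmp1 : ∀ n, 1 ≤ n → ∀ z, ‖vY A B P Q n z‖ ≤ (1 + ‖B.eval z / A.eval z‖) * ‖pv n z‖ := by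
    intro n hn z
    have hn1 : (1:ℝ) ≤ ‖(n:ℂ)‖ := by simpa using hn
    have a1 : ‖((P n).eval z, (derivative (P n)).eval z / (n:ℂ))‖ ≤ ‖pv n z‖ := norm_fst_le (pv n z)
    have a2 : ‖((Q n).eval z, (derivative (Q n)).eval z / (n:ℂ))‖ ≤ ‖pv n z‖ := norm_snd_le (pv n z)
    have a3 := (norm_fst_le _).trans a2
    have a4 := (norm_snd_le _).trans a2
    simp only at a3 a4
    have hb : 0 ≤ ‖B.eval z / A.eval z‖ := norm_nonneg _
    have hyy : ‖pv n z‖ ≤ (1 + ‖B.eval z / A.eval z‖) * ‖pv n z‖ := by nlinarith [norm_nonneg (pv n z)]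
    rw [vY, Prod.norm_def, vP, vQ]
    refine max_le (a1.trans hyy) ?_
    rw [Prod.norm_def]
    refine max_le (a3.trans hyy) ?_
    simp only
    rw [add_div]
    refine (norm_add_le _ _).trans ?_
    have : ‖eval z (Q n) * eval z B / eval z A / (n:ℂ)‖ ≤ ‖B.eval z / A.eval z‖ * ‖pv n z‖ := by
      rw [norm_div]
      refine (div_le_self (norm_nonneg _) hn1).trans ?_
      rw [mul_div_assoc, norm_mul, mul_comm]
      gcongr
    linarith
  have cmp2 : ∀ n, 1 ≤ n → ∀ z, ‖pv n z‖ ≤ (1 + ‖B.eval z / A.eval z‖) * ‖vY A B P Q n z‖ := by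
    intro n hn z
    have hn1 : (1:ℝ) ≤ ‖(n:ℂ)‖ := by simpa using hn
    have a1 : ‖vP P n z‖ ≤ ‖vY A B P Q n z‖ := norm_fst_le (vY A B P Q n z)
    have a2 : ‖vQ A B Q n z‖ ≤ ‖vY A B P Q n z‖ := norm_snd_le (vY A B P Q n z)
    have a3 := (norm_fst_le _).trans a2
    have a4 := (norm_snd_le _).trans a2
    rw [vQ] at a3 a4
    rw [vP] at a1
    simp only at a3 a4
    set Y := ‖vY A B P Q n z‖ 
    have hY : 0 ≤ Y := norm_nonneg _
    have hb : 0 ≤ ‖B.eval z / A.eval z‖ := norm_nonneg _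
    have hyy : Y ≤ (1 + ‖B.eval z / A.eval z‖) * Y := by nlinarith
    rw [hpv, Prod.norm_def]
    refine max_le (a1.trans hyy) ?_
    simp only
    rw [Prod.norm_def]
    refine max_le (a3.trans hyy) ?_
    simp only
    have e : (derivative (Q n)).eval z / (n:ℂ) = (eval z (derivative (Q n)) + eval z (Q n) * eval z B / eval z A) / (n:ℂ)
      - eval z (Q n) * eval z B / eval z A / (n:ℂ) := by ring
    rw [e]
    refine (norm_sub_le _ _).trans ?_
    have : ‖eval z (Q n) * eval z B / eval z A / (n:ℂ)‖ ≤ ‖B.eval z / A.eval z‖ * Y := by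
      rw [norm_div]
      refine (div_le_self (norm_nonneg _) hn1).trans ?_
      rw [mul_div_assoc, norm_mul, mul_comm]
      gcongr
    linarith
  have hmx : ∀ n, ∃ w, ‖w‖ = R ∧ ‖pv n zb‖ ≤ ‖pv n w‖ := fun n => by
    obtain ⟨w, hw, hm⟩ := Complex.exists_mem_frontier_isMaxOn_norm (U := Metric.ball (0:ℂ) R) Metric.isBounded_ball
      ⟨0, Metric.mem_ball_self hR0⟩ (hpd n).diffContOnCl
    rw [frontier_ball _ hR0.ne'] at hw
    refine ⟨w, by simpa using hw, ?_⟩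
    exact hm (subset_closure (by simpa using hR))
  choose w hw hwm using hmx
  obtain ⟨z, hz⟩ := ultra_lim l (x := w) (K := R) (Eventually.of_forall fun n => (hw n).le)
  have hzR : ‖z‖ = R := tendsto_nhds_unique hz.norm (by simp only [hw]; exact tendsto_const_nhds)
  have hzE : z ∉ EE A Hi := fun h => by have := hE z h; linarith
  refine ⟨z, hzR, ?_⟩
  obtain ⟨ρ, M, hρ, hM, -, -, hg⟩ := c.loc hzE univ_mem
  have hB1 : ∀ x ∈ Metric.ball z ρ, True := fun _ _ => trivial
  have t1 : ∀ᶠ n in (l : Filter ℕ), w n ∈ Metric.ball z (min ρ (1 / (4 * (4 * M + 1)))) :=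
    hz.eventually (Metric.ball_mem_nhds z (by positivity))
  have t2 : ∀ᶠ n in (l : Filter ℕ), lg n (1 + ‖B.eval zb / A.eval zb‖) < 1 / 4 := c.hl ((lg_tendsto _).eventually_lt_const (by norm_num))
  have t3 : ∀ᶠ n in (l : Filter ℕ), lg n (1 + M) < 1 / 4 := c.hl ((lg_tendsto _).eventually_lt_const (by norm_num))
  have t4 := c.loc hzb univ_mem
  obtain ⟨ρ', M', hρ', -, -, -, hg'⟩ := t4
  filter_upwards [hg, t1, t2, t3, hg'] with n hn hwn h2 h3 hn'
  have hzbg := hn'.2 zb (Metric.mem_ball_self hρ')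
  have hwb : w n ∈ Metric.ball z ρ := Metric.ball_subset_ball (min_le_left _ _) hwn
  have hwd : ‖w n - z‖ ≤ 1 / (4 * (4 * M + 1)) := by
    rw [← mem_closedBall_iff_norm]; exact Metric.ball_subset_closedBall (Metric.ball_subset_ball (min_le_right _ _) hwn)
  have lip := c.lipY hn.1 hn.2 (w n) hwb z (Metric.mem_ball_self hρ)
  have lip2 : |lg n ‖vY A B P Q n (w n)‖ - lg n ‖vY A B P Q n z‖| ≤ 1 / 4 := by
    refine lip.trans ?_
    calc (4 * M + 1) * ‖w n - z‖ ≤ (4 * M + 1) * (1 / (4 * (4 * M + 1))) := by gcongr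
      _ = 1 / 4 := by field_simp
  have gw := hn.2 (w n) hwb
  have p1 : 0 < ‖vY A B P Q n zb‖ := norm_pos_iff.2 (c.vY_ne hn.1 hzbg.1 hzbg.2.1)
  have p2 : 0 < ‖vY A B P Q n (w n)‖ := norm_pos_iff.2 (c.vY_ne hn.1 gw.1 gw.2.1)
  have ch : ‖vY A B P Q n zb‖ ≤ (1 + ‖B.eval zb / A.eval zb‖) * ((1 + M) * ‖vY A B P Q n (w n)‖) := by
    refine (cmp1 n hn.1 zb).trans ?_
    gcongr
    refine (hwm n).trans ((cmp2 n hn.1 (w n)).trans ?_)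
    gcongr
    exact gw.2.2.2.2.1
  have := lg_mono (n := n) p1 ch
  rw [lg_mul (by positivity) (by positivity), lg_mul (by positivity) p2] at this
  rw [abs_le] at lip2
  linarith [lip2.1]

end UC

section nlevel2
variable {A B : ℂ[X]} {f : ℂ → ℂ} {R₀ : ℝ} {P Q H G : ℕ → ℂ[X]} {κ : ℕ → ℂ} {d : ℕ}

lemma Dt_swap (u v : ℂ × ℂ) : ‖Dt u v‖ = ‖Dt v u‖ := by
  rw [← norm_neg]; congr 1; simp [Dt]; ring

lemma Ctx.det_le (c : Ctx A B f R₀ P Q H G κ d) {n : ℕ} (hn : 1 ≤ n) {z φ : ℂ} {M : ℝ} (hg : Good A B H G n z M) :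
    ‖Dt (vP P n z) (vR A B P Q n φ z)‖ ≤ ‖φ‖ * M * ‖κ n‖ := by
  have hn1 : (1:ℝ) ≤ ‖(n:ℂ)‖ := by simpa using hn
  rw [c.det hn hg.1, norm_mul, norm_div, norm_mul, mul_assoc]
  gcongr
  refine (div_le_self (by positivity) hn1).trans ?_
  rw [mul_comm]; gcongr; exact hg.2.2.2.2.2.2

lemma Ctx.dich (c : Ctx A B f R₀ P Q H G κ d) {n : ℕ} (hn : 1 ≤ n) {z : ℂ} {ρ M : ℝ} {F : ℂ → ℂ} (hM : 1 ≤ M)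
    (hF : Br A B F (Metric.ball z ρ)) (hg : ∀ w ∈ Metric.ball z ρ, Good A B H G n w M) {z₁ z₂ : ℂ}
    (h1 : z₁ ∈ Metric.ball z ρ) (h2 : z₂ ∈ Metric.ball z ρ) :
    (lg n ‖vR A B P Q n (F z₂) z₂‖ + lg n ‖vP P n z₁‖ ≤ lg n 3 + (lg n ‖vR A B P Q n (F z₁) z₁‖ + lg n ‖vP P n z₂‖) ∧
     lg n ‖vP P n z₂‖ + lg n ‖vR A B P Q n (F z₁) z₁‖ ≤ lg n 3 + (lg n ‖vP P n z₁‖ + lg n ‖vR A B P Q n (F z₂) z₂‖)) ∨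
    lg n ‖vR A B P Q n (F z₁) z₁‖ + lg n ‖vP P n z₁‖ ≤ lg n (2 * (‖F z₁‖ * M)) + lg n ‖κ n‖ + 2 * (3 * M + 1) * ‖z₂ - z₁‖ := by
  have pr : ∀ w ∈ Metric.ball z ρ, 0 < ‖vR A B P Q n (F w) w‖ := fun w hw =>
    norm_pos_iff.2 (c.vR_ne hn (hg w hw).1 (hg w hw).2.1 (hF w hw).1)
  have pp : ∀ w ∈ Metric.ball z ρ, 0 < ‖vP P n w‖ := fun w hw =>
    norm_pos_iff.2 (c.vP_ne hn (hg w hw).1 (hg w hw).2.1)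
  have sP := c.solP hn (S := Metric.ball z ρ) fun w hw => ⟨(hg w hw).1, (hg w hw).2.1⟩
  have sR := c.solR hn (fun w hw => (hg w hw).2.1) hF
  have hb := fun x hx => (hg x hx).2.2.1
  have hV := fun x hx => (hg x hx).2.2.2.1
  have pκ : 0 < ‖κ n‖ := norm_pos_iff.2 (c.hκ n hn)
  have pF : 0 < ‖F z₁‖ := norm_pos_iff.2 (hF z₁ h1).1
  by_cases hD : 2 * ‖Dt (vP P n z₁) (vR A B P Q n (F z₁) z₁)‖ * Real.exp (n * (3 * M + 1) * ‖z₂ - z₁‖) ^ 2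
      ≤ ‖vR A B P Q n (F z₁) z₁‖ * ‖vP P n z₁‖
  · left
    constructor
    · have := Sol.lc hn hb hV (convex_ball z ρ) sR sP h1 h2 (norm_pos_iff.1 (pp z₁ h1)) (by
        rw [Dt_swap, mul_comm ‖vP P n z₁‖]; exact hD)
      have := lg_mono (n := n) (mul_pos (pr z₂ h2) (pp z₁ h1)) this
      rwa [lg_mul (pr z₂ h2) (pp z₁ h1), lg_mul (by norm_num) (mul_pos (pr z₁ h1) (pp z₂ h2)), lg_mul (pr z₁ h1) (pp z₂ h2)] at this
    · have := Sol.lc hn hb hV (convex_ball z ρ) sP sR h1 h2 (norm_pos_iff.1 (pr z₁ h1)) hD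
      have := lg_mono (n := n) (mul_pos (pp z₂ h2) (pr z₁ h1)) this
      rwa [lg_mul (pp z₂ h2) (pr z₁ h1), lg_mul (by norm_num) (mul_pos (pp z₁ h1) (pr z₂ h2)), lg_mul (pp z₁ h1) (pr z₂ h2)] at this
  · right
    push Not at hD
    have k1 := c.det_le (φ := F z₁) hn (hg z₁ h1)
    have k2 : ‖vR A B P Q n (F z₁) z₁‖ * ‖vP P n z₁‖ ≤ (2 * (‖F z₁‖ * M)) * ‖κ n‖ * Real.exp (n * (2 * (3 * M + 1)) * ‖z₂ - z₁‖) := by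
      refine hD.le.trans ?_
      rw [← Real.exp_nat_mul]
      have e : ((2:ℕ):ℝ) * (n * (3 * M + 1) * ‖z₂ - z₁‖) = n * (2 * (3 * M + 1)) * ‖z₂ - z₁‖ := by push_cast; ring
      rw [e, mul_assoc 2 (‖F z₁‖ * M)]
      gcongr
    have := lg_gron hn (mul_pos (pr z₁ h1) (pp z₁ h1)) (by positivity) k2
    rwa [lg_mul (pr z₁ h1) (pp z₁ h1), lg_mul (by positivity) pκ] at this

lemma Ctx.low_lg (c : Ctx A B f R₀ P Q H G κ d) {n : ℕ} (hn : 1 ≤ n) {z φ : ℂ} {M : ℝ} (hM : 1 ≤ M)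
    (hg : Good A B H G n z M) (hφ : φ ≠ 0) :
    lg n ‖κ n‖ ≤ lg n (2 * M / ‖φ‖) + lg n n + (lg n ‖vP P n z‖ + lg n ‖vR A B P Q n φ z‖) := by
  have pr : 0 < ‖vR A B P Q n φ z‖ := norm_pos_iff.2 (c.vR_ne hn hg.1 hg.2.1 hφ)
  have pp : 0 < ‖vP P n z‖ := norm_pos_iff.2 (c.vP_ne hn hg.1 hg.2.1)
  have pκ : 0 < ‖κ n‖ := norm_pos_iff.2 (c.hκ n hn)
  have pφ : 0 < ‖φ‖ := norm_pos_iff.2 hφ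
  have pn : 0 < (n:ℝ) := by exact_mod_cast hn
  have h := Dt_le (vP P n z) (vR A B P Q n φ z)
  rw [c.det hn hg.1, norm_mul, norm_div, norm_mul] at h
  have hnn : ‖(n:ℂ)‖ = n := by simp
  rw [hnn] at h
  have h2 : ‖φ‖ * (‖κ n‖ * M⁻¹ / n) ≤ 2 * ‖vP P n z‖ * ‖vR A B P Q n φ z‖ := by
    refine le_trans ?_ h
    gcongr
    exact hg.2.2.2.2.2.1
  have h3 : ‖κ n‖ ≤ (2 * M / ‖φ‖ * n) * (‖vP P n z‖ * ‖vR A B P Q n φ z‖) := by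
    have : ‖κ n‖ = ‖φ‖ * (‖κ n‖ * M⁻¹ / n) * (M * n / ‖φ‖) := by field_simp
    rw [this]
    calc _ ≤ 2 * ‖vP P n z‖ * ‖vR A B P Q n φ z‖ * (M * n / ‖φ‖) := by gcongr
      _ = _ := by ring
  have := lg_mono (n := n) pκ h3
  rwa [lg_mul (by positivity) (by positivity), lg_mul (by positivity) pn, lg_mul pp pr] at this

lemma lgP_le (c : Ctx A B f R₀ P Q H G κ d) {n : ℕ} (hn : 1 ≤ n) {z : ℂ} {M : ℝ} (hg : Good A B H G n z M) :
    lg n ‖vP P n z‖ ≤ lg n ‖vY A B P Q n z‖ :=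
  lg_mono (norm_pos_iff.2 (c.vP_ne hn hg.1 hg.2.1)) (norm_fst_le (vY A B P Q n z))

lemma lgR_le (c : Ctx A B f R₀ P Q H G κ d) {n : ℕ} (hn : 1 ≤ n) {z φ : ℂ} {M : ℝ} (hg : Good A B H G n z M) (hφ : φ ≠ 0) :
    lg n ‖vR A B P Q n φ z‖ ≤ lg n (1 + ‖φ‖) + lg n ‖vY A B P Q n z‖ := by
  have := lg_mono (n := n) (norm_pos_iff.2 (c.vR_ne hn hg.1 hg.2.1 hφ)) (vR_le (A := A) (B := B) (P := P) (Q := Q) n φ z)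
  rwa [lg_mul (by positivity) (norm_pos_iff.2 (c.vY_ne hn hg.1 hg.2.1))] at this

lemma lgY_le_PR (c : Ctx A B f R₀ P Q H G κ d) {n : ℕ} (hn : 1 ≤ n) {z φ : ℂ} {M : ℝ} (hg : Good A B H G n z M) (hφ : φ ≠ 0) :
    lg n ‖vY A B P Q n z‖ ≤ lg n (2 * (1 + 1 / ‖φ‖)) + max (lg n ‖vP P n z‖) (lg n ‖vR A B P Q n φ z‖) :=
  lg_max (norm_pos_iff.2 (c.vY_ne hn hg.1 hg.2.1)) (norm_pos_iff.2 (c.vP_ne hn hg.1 hg.2.1))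
    (norm_pos_iff.2 (c.vR_ne hn hg.1 hg.2.1 hφ)) (by positivity) (vY_le_PR n hφ z)

lemma lgY_le_RR (c : Ctx A B f R₀ P Q H G κ d) {n : ℕ} (hn : 1 ≤ n) {z φ φ' : ℂ} {M : ℝ} (hg : Good A B H G n z M)
    (hφ : φ ≠ 0) (hφ' : φ' ≠ 0) (hne : φ ≠ φ') :
    lg n ‖vY A B P Q n z‖ ≤ lg n (2 * ((1 + ‖φ‖) / ‖φ - φ'‖ + 1)) + max (lg n ‖vR A B P Q n φ z‖) (lg n ‖vR A B P Q n φ' z‖) :=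
  lg_max (norm_pos_iff.2 (c.vY_ne hn hg.1 hg.2.1)) (norm_pos_iff.2 (c.vR_ne hn hg.1 hg.2.1 hφ))
    (norm_pos_iff.2 (c.vR_ne hn hg.1 hg.2.1 hφ')) (by positivity) (vY_le_RR n hne z)

end nlevel2

namespace UC
variable {A B : ℂ[X]} {f : ℂ → ℂ} {R₀ : ℝ} {P Q H G : ℕ → ℂ[X]} {κ : ℕ → ℂ} {d : ℕ} {l : Ultrafilter ℕ} {Hi Gi : ℂ[X]}

lemma tlg (c : UC A B f R₀ P Q H G κ d l Hi Gi) (K : ℝ) : Tendsto (fun n => lg n K) l (𝓝 0) := (lg_tendsto K).mono_left c.hl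

lemma tlgn (c : UC A B f R₀ P Q H G κ d l Hi Gi) : Tendsto (fun n => lg n n) l (𝓝 0) := lg_tendsto_n.mono_left c.hl

lemma goodAt (c : UC A B f R₀ P Q H G κ d l Hi Gi) {z : ℂ} (hz : z ∉ EE A Hi) :
    ∃ M, 1 ≤ M ∧ ∀ᶠ n in (l : Filter ℕ), 1 ≤ n ∧ Good A B H G n z M := by
  obtain ⟨ρ, M, hρ, hM, -, -, hg⟩ := c.loc hz univ_mem
  exact ⟨M, hM, hg.mono fun n hn => ⟨hn.1, hn.2 z (Metric.mem_ball_self hρ)⟩⟩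

def DD (A B : ℂ[X]) (P Q : ℕ → ℂ[X]) (l : Ultrafilter ℕ) (z φ : ℂ) : Prop := φ ≠ 0 ∧ ∃ δ > 0, ∀ᶠ n in (l : Filter ℕ),
    lg n ‖vR A B P Q n φ z‖ ≤ lg n ‖vY A B P Q n z‖ - δ

lemma kbd (c : UC A B f R₀ P Q H G κ d l Hi Gi) {zb : ℂ} (hzb : zb ∉ EE A Hi) :
    ∃ K, ∀ᶠ n in (l : Filter ℕ), K ≤ lg n ‖κ n‖ - 2 * lg n ‖vY A B P Q n zb‖ := by
  by_contra hcon
  push Not at hcon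
  have hneg : ∀ K, ∀ᶠ n in (l : Filter ℕ), lg n ‖κ n‖ - 2 * lg n ‖vY A B P Q n zb‖ < K := hcon
  -- transport
  have tr : ∀ x, x ∉ EE A Hi → ∃ ρ, 0 < ρ ∧ Metric.ball x ρ ⊆ (EE A Hi)ᶜ ∧ ∀ F, Br A B F (Metric.ball x ρ) →
      ∀ w ∈ Metric.ball x ρ, ∀ w' ∈ Metric.ball x ρ, DD A B P Q l w (F w) → DD A B P Q l w' (F w') := by
    intro x hx
    obtain ⟨ρ, M, hρ, hM, -, hsub, hg⟩ := c.loc hx univ_mem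
    refine ⟨ρ, hρ, hsub, fun F hF w hw w' hw' ⟨h0, δ, hδ, hD⟩ => ⟨(hF w' hw').1, δ / 2, half_pos hδ, ?_⟩⟩
    obtain ⟨K1, hK1⟩ := c.bdY hzb (hsub hw)
    obtain ⟨K2, hK2⟩ := c.bdY hzb (hsub hw')
    have e1 := (c.tlg 3).eventually_lt_const (show (0:ℝ) < δ / 8 by linarith)
    have e2 := (c.tlg (2 * (1 + 1 / ‖F w‖))).eventually_lt_const (show (0:ℝ) < δ / 8 by linarith)
    have e3 := (c.tlg (2 * (‖F w‖ * M))).eventually_lt_const (show (0:ℝ) < δ / 8 by linarith)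
    filter_upwards [hg, hD, hK1, hK2, e1, e2, e3, hneg (-(K1 + K2 + 2 * (3 * M + 1) * ‖w' - w‖ + (3 * M + 1) * ‖w' - w‖ + 2 * δ))]
      with n hn hD hK1 hK2 e1 e2 e3 hk
    rw [abs_le] at hK1 hK2
    have k1 := lgY_le_PR c.toCtx hn.1 (hn.2 w hw) h0
    have k2 : lg n ‖vY A B P Q n w‖ ≤ δ / 8 + lg n ‖vP P n w‖ := by
      rcases le_total (lg n ‖vP P n w‖) (lg n ‖vR A B P Q n (F w) w‖) with h | h
      · rw [max_eq_right h] at k1; linarith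
      · rw [max_eq_left h] at k1; linarith
    have k3 := lgP_le c.toCtx hn.1 (hn.2 w' hw')
    rcases c.dich hn.1 hM hF hn.2 hw hw' with ⟨h, -⟩ | h
    · linarith
    · have := c.lipR hn.1 hF hn.2 w' hw' w hw
      rw [abs_le] at this
      linarith [this.2, hK1.1, hK2.1, hK1.2, hK2.2]
  have hun : ∀ z, z ∉ EE A Hi → ∀ φ φ', DD A B P Q l z φ → DD A B P Q l z φ' → φ = φ' := by
    rintro z hz φ φ' ⟨h0, δ, hδ, hD⟩ ⟨h0', δ', hδ', hD'⟩
    by_contra hne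
    obtain ⟨M, hM, hg⟩ := c.goodAt hz
    have e1 := (c.tlg (2 * ((1 + ‖φ‖) / ‖φ - φ'‖ + 1))).eventually_lt_const (show (0:ℝ) < min δ δ' by positivity)
    obtain ⟨n, hn, h1, h2, h3⟩ := (hg.and (hD.and (hD'.and e1))).exists
    have := lgY_le_RR c.toCtx hn.1 hn.2 h0 h0' hne
    have m1 := min_le_left δ δ'
    have m2 := min_le_right δ δ'
    rcases le_total (lg n ‖vR A B P Q n φ z‖) (lg n ‖vR A B P Q n φ' z‖) with h | h
    · rw [max_eq_right h] at this; linarith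
    · rw [max_eq_left h] at this; linarith
  have hne : ∃ z, z ∉ EE A Hi ∧ ∃ φ, DD A B P Q l z φ := by
    obtain ⟨K, R, hK, hR, hdec⟩ := c.decR hzb
    obtain ⟨RE, hRE⟩ := c.finE.isBounded.exists_norm_le
    set R' := max (max R (RE + 1)) (max (‖zb‖ + 1) (K * Real.exp 3)) with hR'
    have hr1 : R ≤ R' := (le_max_left _ _).trans (le_max_left _ _)
    have hr2 : RE + 1 ≤ R' := (le_max_right _ _).trans (le_max_left _ _)
    have hr3 : ‖zb‖ + 1 ≤ R' := (le_max_left _ _).trans (le_max_right _ _)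
    have hr4 : K * Real.exp 3 ≤ R' := (le_max_right _ _).trans (le_max_right _ _)
    obtain ⟨z, hz, hf⟩ := c.far_pos hzb (R := R') (fun z hz => by have := hRE z hz; linarith) (by linarith)
    have hzE : z ∉ EE A Hi := fun h => by have := hRE z h; linarith
    have hfz : f z ≠ 0 := (c.fBr z (by change R₀ < ‖z‖; rw [hz]; linarith)).1
    refine ⟨z, hzE, f z, hfz, 1, one_pos, ?_⟩
    obtain ⟨M, hM, hg⟩ := c.goodAt hzE
    obtain ⟨M', hM', hg'⟩ := c.goodAt hzb
    filter_upwards [hdec, hf, hg, hg', (c.tlg 3).eventually_lt_const (show (0:ℝ) < 1 by norm_num)] with n h1 h2 hn hn' e3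
    have h3 := h1.2 z (by rw [hz]; exact hr1)
    have p1 : 0 < ‖vY A B P Q n zb‖ := norm_pos_iff.2 (c.vY_ne hn.1 hn'.2.1 hn'.2.2.1)
    have hR0 : 0 < R' := by linarith [norm_nonneg zb]
    have h4 : ‖vR A B P Q n (f z) z‖ ≤ 3 * ‖vY A B P Q n zb‖ * Real.exp (n * (-3) * 1) := by
      refine h3.trans ?_
      have e : (n:ℝ) * (-3) * 1 = n * (-3) := by ring
      rw [e, Real.exp_nat_mul, hz]
      gcongr
      rw [div_le_iff₀ hR0, Real.exp_neg, inv_mul_eq_div, le_div_iff₀ (Real.exp_pos _)]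
      exact hr4
    have := lg_gron hn.1 (norm_pos_iff.2 (c.vR_ne hn.1 hn.2.1 hn.2.2.1 hfz)) (by positivity) h4
    rw [lg_mul (by norm_num) p1] at this
    linarith
  -- global branch
  have hA0 : ∀ z, z ∉ EE A Hi → A.eval z ≠ 0 := fun z hz h => hz (Or.inl h)
  obtain ⟨z0, hz0, hp0⟩ := hne
  have hall : ∀ z ∈ (EE A Hi)ᶜ, ∃ φ, DD A B P Q l z φ := by
    refine clopen_all (compl_finite_connected c.finE).isPreconnected ?_ ?_ hz0 hp0
    · rintro x hx ⟨φ, hφ⟩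
      obtain ⟨ρ, hρ, hsub, h⟩ := tr x hx
      obtain ⟨F, hF, hFx⟩ := exists_branch (B := B) (w := x) (fun z hz => hA0 z (hsub hz)) hφ.1
      filter_upwards [Metric.ball_mem_nhds x hρ] with y hy
      exact ⟨F y, h F hF x (Metric.mem_ball_self hρ) y hy (by rwa [hFx])⟩
    · intro x hx hnp
      obtain ⟨ρ, hρ, hsub, h⟩ := tr x hx
      filter_upwards [Metric.ball_mem_nhds x hρ] with y hy
      rintro ⟨φ, hφ⟩
      obtain ⟨F, hF, hFx⟩ := exists_branch (B := B) (w := y) (fun z hz => hA0 z (hsub hz)) hφ.1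
      exact hnp ⟨F x, h F hF y hy x (Metric.mem_ball_self hρ) (by rwa [hFx])⟩
  choose! F hF using hall
  refine c.nobr (EE A Hi) c.finE F fun z hz => ?_
  obtain ⟨ρ, hρ, hsub, h⟩ := tr z hz
  obtain ⟨F', hF', hFz⟩ := exists_branch (B := B) (w := z) (fun z hz => hA0 z (hsub hz)) (hF z hz).1
  have heq : F =ᶠ[𝓝 z] F' := by
    filter_upwards [Metric.ball_mem_nhds z hρ] with y hy
    exact hun y (hsub hy) _ _ (hF y (hsub hy)) (h F' hF' z (Metric.mem_ball_self hρ) y hy (by rw [hFz]; exact hF z hz))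
  obtain ⟨g1, g2, g3⟩ := hF' z (Metric.mem_ball_self hρ)
  refine ⟨(hF z hz).1, g2, ?_⟩
  rw [← hFz]
  exact g3.congr_of_eventuallyEq heq

end UC

lemma lg_submean {V : Type*} [NormedAddCommGroup V] [NormedSpace ℂ V] [CompleteSpace V] {Y : ℂ → V} {z : ℂ} {ρ : ℝ} {n : ℕ} (hn : 1 ≤ n)
    (hY : DifferentiableOn ℂ Y (Metric.ball z ρ)) (h0 : ∀ w ∈ Metric.ball z ρ, Y w ≠ 0) (ν : ℝ) {r : ℝ} (hr : 0 < r) (hrρ : r < ρ) :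
    lg n ‖Y z‖ - ν ≤ Real.circleAverage (fun w => lg n ‖Y w‖ - ν) z r := by
  have ha : |r| = r := abs_of_pos hr
  have hsub : Metric.closedBall z r ⊆ Metric.ball z ρ := Metric.closedBall_subset_ball hrρ
  set e : ℂ := ((Real.exp (n * (-ν)) : ℝ) : ℂ) with he
  have he1 : ‖e‖ = Real.exp (n * (-ν)) := by rw [he, Complex.norm_real, Real.norm_of_nonneg (Real.exp_pos _).le]
  have he0 : e ≠ 0 := norm_pos_iff.1 (by rw [he1]; exact Real.exp_pos _)
  have key : ∀ w ∈ Metric.closedBall z r, lg n ‖Y w‖ - ν = (1 / (n:ℝ)) • Real.log ‖e • Y w‖ := by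
    intro w hw
    rw [norm_smul, he1]
    change _ = lg n _
    rw [lg_mul (Real.exp_pos _) (norm_pos_iff.2 (h0 w (hsub hw))), lg_exp hn]
    ring
  rw [key z (Metric.mem_closedBall_self hr.le), Real.circleAverage_congr_sphere (f₂ := fun w => (1 / (n:ℝ)) • Real.log ‖e • Y w‖)
    (fun w hw => key w (Metric.sphere_subset_closedBall (by rwa [ha] at hw))), Real.circleAverage_fun_smul]
  simp only [smul_eq_mul]
  gcongr
  refine log_norm_mean (Y := fun w => e • Y w) hr ?_ (fun w hw => smul_ne_zero he0 (h0 w (hsub hw)))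
  exact ((hY.const_smul e).analyticOnNhd Metric.isOpen_ball).mono hsub

structure Lims (A B : ℂ[X]) (P Q : ℕ → ℂ[X]) (κ : ℕ → ℂ) (l : Ultrafilter ℕ) (E : Set ℂ) (zb : ℂ)
    (N pl : ℂ → ℝ) (r : ℂ → ℂ → ℝ) (c : ℝ) : Prop where
  hzb : zb ∉ E
  tN : ∀ z ∉ E, Tendsto (fun n => lg n ‖vY A B P Q n z‖ - lg n ‖vY A B P Q n zb‖) l (𝓝 (N z))
  tp : ∀ z ∉ E, Tendsto (fun n => lg n ‖vP P n z‖ - lg n ‖vY A B P Q n zb‖) l (𝓝 (pl z))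
  tr : ∀ z ∉ E, ∀ φ ≠ 0, Tendsto (fun n => lg n ‖vR A B P Q n φ z‖ - lg n ‖vY A B P Q n zb‖) l (𝓝 (r z φ))
  tc : Tendsto (fun n => lg n ‖κ n‖ - 2 * lg n ‖vY A B P Q n zb‖) l (𝓝 c)

namespace UC
variable {A B : ℂ[X]} {f : ℂ → ℂ} {R₀ : ℝ} {P Q H G : ℕ → ℂ[X]} {κ : ℕ → ℂ} {d : ℕ} {l : Ultrafilter ℕ} {Hi Gi : ℂ[X]}

lemma exists_lims (c : UC A B f R₀ P Q H G κ d l Hi Gi) : ∃ zb N pl r k, Lims A B P Q κ l (EE A Hi) zb N pl r k := by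
  obtain ⟨zb, hzb⟩ : ∃ zb, zb ∉ EE A Hi := by
    by_contra h
    push Not at h
    exact Set.infinite_univ (c.finE.subset fun z _ => h z)
  have tl : ∀ {x : ℕ → ℝ} (K K' : ℝ), (∀ᶠ n in (l : Filter ℕ), K ≤ x n ∧ x n ≤ K') → ∃ y, Tendsto x l (𝓝 y) := fun K K' h =>
    ultra_lim l (K := max |K| |K'|) (h.mono fun n hn => by
      rw [Real.norm_eq_abs]; exact abs_le_max_abs_abs hn.1 hn.2)
  obtain ⟨k0, hk0⟩ := c.kbd hzb
  have hN : ∀ z, ∃ y, z ∉ EE A Hi → Tendsto (fun n => lg n ‖vY A B P Q n z‖ - lg n ‖vY A B P Q n zb‖) l (𝓝 y) := fun z => by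
    by_cases hz : z ∈ EE A Hi
    · exact ⟨0, fun h => absurd hz h⟩
    obtain ⟨K, hK⟩ := c.bdY hzb hz
    obtain ⟨y, hy⟩ := tl (-K) K (hK.mono fun n hn => abs_le.1 hn)
    exact ⟨y, fun _ => hy⟩
  have hp : ∀ z, ∃ y, z ∉ EE A Hi → Tendsto (fun n => lg n ‖vP P n z‖ - lg n ‖vY A B P Q n zb‖) l (𝓝 y) := fun z => by
    by_cases hz : z ∈ EE A Hi
    · exact ⟨0, fun h => absurd hz h⟩
    obtain ⟨K, hK⟩ := c.bdY hzb hz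
    obtain ⟨M, hM, hg⟩ := c.goodAt hz
    obtain ⟨y, hy⟩ := tl (x := fun n => lg n ‖vP P n z‖ - lg n ‖vY A B P Q n zb‖) (k0 - K - 3) K (by
      filter_upwards [hK, hg, hk0, c.tlgn.eventually_lt_const one_pos, (c.tlg (2 * M / ‖(1:ℂ)‖)).eventually_lt_const one_pos,
        (c.tlg (1 + ‖(1:ℂ)‖)).eventually_lt_const one_pos] with n hK hn hk e1 e2 e3
      have k1 := lgP_le c.toCtx hn.1 hn.2
      have k2 := c.low_lg hn.1 hM hn.2 one_ne_zero
      have k3 := lgR_le c.toCtx hn.1 hn.2 one_ne_zero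
      rw [abs_le] at hK
      constructor <;> linarith [hK.1, hK.2])
    exact ⟨y, fun _ => hy⟩
  have hr : ∀ z φ, ∃ y, z ∉ EE A Hi → φ ≠ 0 → Tendsto (fun n => lg n ‖vR A B P Q n φ z‖ - lg n ‖vY A B P Q n zb‖) l (𝓝 y) := fun z φ => by
    by_cases hz : z ∈ EE A Hi
    · exact ⟨0, fun h => absurd hz h⟩
    by_cases hφ : φ = 0
    · exact ⟨0, fun _ h => absurd hφ h⟩
    obtain ⟨K, hK⟩ := c.bdY hzb hz
    obtain ⟨M, hM, hg⟩ := c.goodAt hz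
    obtain ⟨y, hy⟩ := tl (x := fun n => lg n ‖vR A B P Q n φ z‖ - lg n ‖vY A B P Q n zb‖) (k0 - K - 3) (K + 1) (by
      filter_upwards [hK, hg, hk0, c.tlgn.eventually_lt_const one_pos, (c.tlg (2 * M / ‖φ‖)).eventually_lt_const one_pos,
        (c.tlg (1 + ‖φ‖)).eventually_lt_const one_pos] with n hK hn hk e1 e2 e3
      have k1 := lgP_le c.toCtx hn.1 hn.2
      have k2 := c.low_lg hn.1 hM hn.2 hφ
      have k3 := lgR_le c.toCtx hn.1 hn.2 hφ
      rw [abs_le] at hK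
      constructor <;> linarith [hK.1, hK.2])
    exact ⟨y, fun _ _ => hy⟩
  have hc : ∃ y, Tendsto (fun n => lg n ‖κ n‖ - 2 * lg n ‖vY A B P Q n zb‖) l (𝓝 y) := by
    obtain ⟨M, hM, hg⟩ := c.goodAt hzb
    refine tl k0 3 ?_
    filter_upwards [hg, hk0, c.tlgn.eventually_lt_const one_pos, (c.tlg (2 * M / ‖(1:ℂ)‖)).eventually_lt_const one_pos,
        (c.tlg (1 + ‖(1:ℂ)‖)).eventually_lt_const one_pos] with n hn hk e1 e2 e3
    have k1 := lgP_le c.toCtx hn.1 hn.2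
    have k2 := c.low_lg hn.1 hM hn.2 one_ne_zero
    have k3 := lgR_le c.toCtx hn.1 hn.2 one_ne_zero
    constructor <;> linarith
  choose N hN using hN
  choose pl hp using hp
  choose r hr using hr
  obtain ⟨k, hk⟩ := hc
  exact ⟨zb, N, pl, r, k, hzb, hN, hp, fun z hz φ hφ => hr z φ hz hφ, hk⟩

variable {zb : ℂ} {N pl : ℂ → ℝ} {r : ℂ → ℂ → ℝ} {k : ℝ}

lemma lipN (c : UC A B f R₀ P Q H G κ d l Hi Gi) (L : Lims A B P Q κ l (EE A Hi) zb N pl r k) {z : ℂ} {ρ M : ℝ}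
    (hsub : Metric.ball z ρ ⊆ (EE A Hi)ᶜ) 
    (hg : ∀ᶠ n in (l : Filter ℕ), 1 ≤ n ∧ ∀ w ∈ Metric.ball z ρ, Good A B H G n w M) :
    ∀ w ∈ Metric.ball z ρ, ∀ w' ∈ Metric.ball z ρ, |N w - N w'| ≤ (4 * M + 1) * ‖w - w'‖ := by
  refine lip_lim (l := (l : Filter ℕ)) (u := fun n z => lg n ‖vY A B P Q n z‖ - lg n ‖vY A B P Q n zb‖) (fun w hw => L.tN w (hsub hw)) ?_
  filter_upwards [hg] with n hn w hw w' hw'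
  rw [sub_sub_sub_cancel_right]
  exact c.lipY hn.1 hn.2 w hw w' hw'

lemma lipr (c : UC A B f R₀ P Q H G κ d l Hi Gi) (L : Lims A B P Q κ l (EE A Hi) zb N pl r k) {z : ℂ} {ρ M : ℝ} {F : ℂ → ℂ}
    (hsub : Metric.ball z ρ ⊆ (EE A Hi)ᶜ) (hF : Br A B F (Metric.ball z ρ))
    (hg : ∀ᶠ n in (l : Filter ℕ), 1 ≤ n ∧ ∀ w ∈ Metric.ball z ρ, Good A B H G n w M) :
    ∀ w ∈ Metric.ball z ρ, ∀ w' ∈ Metric.ball z ρ, |r w (F w) - r w' (F w')| ≤ (3 * M + 1) * ‖w - w'‖ := by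
  refine lip_lim (l := (l : Filter ℕ)) (u := fun n z => lg n ‖vR A B P Q n (F z) z‖ - lg n ‖vY A B P Q n zb‖) (v := fun w => r w (F w))
     (fun w hw => L.tr w (hsub hw) _ (hF w hw).1) ?_
  filter_upwards [hg] with n hn w hw w' hw'
  rw [sub_sub_sub_cancel_right]
  exact c.lipR hn.1 hF hn.2 w hw w' hw'

lemma lim_up (c : UC A B f R₀ P Q H G κ d l Hi Gi) (L : Lims A B P Q κ l (EE A Hi) zb N pl r k) {z φ : ℂ} (hz : z ∉ EE A Hi) (hφ : φ ≠ 0) :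
    r z φ ≤ N z := by
  obtain ⟨M, hM, hg⟩ := c.goodAt hz
  have h := (c.tlg (1 + ‖φ‖)).add (L.tN z hz)
  rw [zero_add] at h
  refine le_of_tendsto_of_tendsto (L.tr z hz φ hφ) h ?_
  filter_upwards [hg] with n hn
  have := lgR_le c.toCtx hn.1 hn.2 hφ
  linarith

lemma lim_pup (c : UC A B f R₀ P Q H G κ d l Hi Gi) (L : Lims A B P Q κ l (EE A Hi) zb N pl r k) {z : ℂ} (hz : z ∉ EE A Hi) :
    pl z ≤ N z := by
  obtain ⟨M, hM, hg⟩ := c.goodAt hz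
  refine le_of_tendsto_of_tendsto (L.tp z hz) (L.tN z hz) ?_
  filter_upwards [hg] with n hn
  have := lgP_le c.toCtx hn.1 hn.2
  linarith

lemma lim_low (c : UC A B f R₀ P Q H G κ d l Hi Gi) (L : Lims A B P Q κ l (EE A Hi) zb N pl r k) {z φ : ℂ} (hz : z ∉ EE A Hi) (hφ : φ ≠ 0) :
    k ≤ pl z + r z φ := by
  obtain ⟨M, hM, hg⟩ := c.goodAt hz
  have h := ((c.tlg (2 * M / ‖φ‖)).add c.tlgn).add ((L.tp z hz).add (L.tr z hz φ hφ))
  rw [zero_add, zero_add] at h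
  refine le_of_tendsto_of_tendsto L.tc h ?_
  filter_upwards [hg] with n hn
  have := c.low_lg hn.1 hM hn.2 hφ
  linarith

lemma lim_p (c : UC A B f R₀ P Q H G κ d l Hi Gi) (L : Lims A B P Q κ l (EE A Hi) zb N pl r k) {z φ : ℂ} (hz : z ∉ EE A Hi) (hφ : φ ≠ 0)
    (h : r z φ < N z) : pl z = N z := by
  obtain ⟨M, hM, hg⟩ := c.goodAt hz
  have h1 := (c.tlg (2 * (1 + 1 / ‖φ‖))).add ((L.tp z hz).max (L.tr z hz φ hφ))
  rw [zero_add] at h1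
  have h2 : N z ≤ max (pl z) (r z φ) := by
    refine le_of_tendsto_of_tendsto (L.tN z hz) h1 ?_
    filter_upwards [hg] with n hn
    have := lgY_le_PR c.toCtx hn.1 hn.2 hφ
    rw [max_sub_sub_right]
    linarith
  refine le_antisymm (c.lim_pup L hz) ?_
  rcases le_max_iff.1 h2 with h3 | h3
  · exact h3
  · linarith

lemma lim_uniq (c : UC A B f R₀ P Q H G κ d l Hi Gi) (L : Lims A B P Q κ l (EE A Hi) zb N pl r k) {z φ φ' : ℂ} (hz : z ∉ EE A Hi) (hφ : φ ≠ 0)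
    (hφ' : φ' ≠ 0) (hne : φ ≠ φ') (h : r z φ < N z) : r z φ' = N z := by
  obtain ⟨M, hM, hg⟩ := c.goodAt hz
  have h1 := (c.tlg (2 * ((1 + ‖φ‖) / ‖φ - φ'‖ + 1))).add ((L.tr z hz φ hφ).max (L.tr z hz φ' hφ'))
  rw [zero_add] at h1
  have h2 : N z ≤ max (r z φ) (r z φ') := by
    refine le_of_tendsto_of_tendsto (L.tN z hz) h1 ?_
    filter_upwards [hg] with n hn
    have := lgY_le_RR c.toCtx hn.1 hn.2 hφ hφ' hne
    rw [max_sub_sub_right]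
    linarith
  refine le_antisymm (c.lim_up L hz hφ') ?_
  rcases le_max_iff.1 h2 with h3 | h3
  · linarith
  · exact h3

lemma lim_lc (c : UC A B f R₀ P Q H G κ d l Hi Gi) (L : Lims A B P Q κ l (EE A Hi) zb N pl r k) {U : Set ℂ} {F : ℂ → ℂ}
    (hU : IsOpen U) (hF : Br A B F U) {z : ℂ} (hz : z ∈ U) (hzE : z ∉ EE A Hi) (h1 : r z (F z) < N z) (h2 : k < N z + r z (F z)) :
    ∀ᶠ w in 𝓝 z, N w - r w (F w) = N z - r z (F z) := by
  obtain ⟨ρ, M, hρ, hM, hsU, hsub, hg⟩ := c.loc hzE (hU.mem_nhds hz)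
  have hF' := hF.mono hsU
  have hzb := Metric.mem_ball_self (x := z) hρ
  have cN := cont_of_lip hρ (c.lipN L hsub hg) z hzb
  have cr := cont_of_lip hρ (c.lipr L hsub hF' hg) z hzb
  have e1 : ∀ᶠ w in 𝓝 z, r w (F w) < N w := cr.eventually_lt cN h1
  have e2 : ∀ᶠ w in 𝓝 z, 2 * (3 * M + 1) * ‖w - z‖ < N z + r z (F z) - k := by
    have : Tendsto (fun w => 2 * (3 * M + 1) * ‖w - z‖) (𝓝 z) (𝓝 (2 * (3 * M + 1) * ‖z - z‖)) :=
      (by fun_prop : Continuous fun w => 2 * (3 * M + 1) * ‖w - z‖).tendsto z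
    refine this.eventually_lt_const ?_
    simp; linarith
  filter_upwards [e1, e2, Metric.ball_mem_nhds z hρ] with w w1 w2 hw
  have hz0 := (hF' z hzb).1
  have hw0 := (hF' w hw).1
  have pz := c.lim_p L hzE hz0 h1
  have pw := c.lim_p L (hsub hw) hw0 w1
  have tpz := L.tp z hzE
  have tpw := L.tp w (hsub hw)
  have trz := L.tr z hzE _ hz0
  have trw := L.tr w (hsub hw) _ hw0
  rw [pz] at tpz
  rw [pw] at tpw
  have nr : ¬ ∀ᶠ n in (l : Filter ℕ), lg n ‖vR A B P Q n (F z) z‖ + lg n ‖vP P n z‖ ≤ lg n (2 * (‖F z‖ * M)) + lg n ‖κ n‖ + 2 * (3 * M + 1) * ‖w - z‖ := by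
    intro h
    have t := ((c.tlg (2 * (‖F z‖ * M))).add L.tc).add_const (2 * (3 * M + 1) * ‖w - z‖)
    have := le_of_tendsto_of_tendsto (trz.add tpz) t (h.mono fun n hn => by linarith)
    linarith
  have ev := (Ultrafilter.eventually_or (f := l)).1 (hg.mono fun n hn => c.dich hn.1 hM hF' hn.2 hzb hw)
  have ev := ev.resolve_right nr
  have i1 := le_of_tendsto_of_tendsto (trw.add tpz) ((c.tlg 3).add (trz.add tpw)) (ev.mono fun n hn => by linarith [hn.1])
  have i2 := le_of_tendsto_of_tendsto (tpw.add trz) ((c.tlg 3).add (tpz.add trw)) (ev.mono fun n hn => by linarith [hn.2])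
  linarith

lemma lim_subN (c : UC A B f R₀ P Q H G κ d l Hi Gi) (L : Lims A B P Q κ l (EE A Hi) zb N pl r k) {z : ℂ} (hz : z ∉ EE A Hi) :
    SubMean N z := by
  obtain ⟨ρ, M, hρ, hM, -, hsub, hg⟩ := c.loc hz univ_mem
  refine submean_lim (l := (l : Filter ℕ)) (u := fun n z => lg n ‖vY A B P Q n z‖ - lg n ‖vY A B P Q n zb‖) hρ (fun w hw => L.tN w (hsub hw)) (L := 4 * M + 1) ?_ ?_
  · filter_upwards [hg] with n hn w hw w' hw'
    rw [sub_sub_sub_cancel_right]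
    exact c.lipY hn.1 hn.2 w hw w' hw'
  · filter_upwards [hg] with n hn s hs hsρ
    refine lg_submean (Y := vY A B P Q n) hn.1 (fun w hw => ?_) (fun w hw => c.vY_ne hn.1 (hn.2 w hw).1 (hn.2 w hw).2.1) _ hs hsρ
    exact ((c.solP hn.1 (S := Metric.ball z ρ) (fun x hx => ⟨(hn.2 x hx).1, (hn.2 x hx).2.1⟩) w hw).prodMk 
      (c.derQ hn.1 (hn.2 w hw).1 (hn.2 w hw).2.1)).differentiableAt.differentiableWithinAt

lemma lim_subr (c : UC A B f R₀ P Q H G κ d l Hi Gi) (L : Lims A B P Q κ l (EE A Hi) zb N pl r k) {U : Set ℂ} {F : ℂ → ℂ}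
    (hU : IsOpen U) (hF : Br A B F U) {z : ℂ} (hzU : z ∈ U) (hz : z ∉ EE A Hi) :
    SubMean (fun w => r w (F w)) z := by
  obtain ⟨ρ, M, hρ, hM, hsU, hsub, hg⟩ := c.loc hz (hU.mem_nhds hzU)
  have hF' := hF.mono hsU
  refine submean_lim (l := (l : Filter ℕ)) (u := fun n z => lg n ‖vR A B P Q n (F z) z‖ - lg n ‖vY A B P Q n zb‖) hρ 
    (fun w hw => L.tr w (hsub hw) _ (hF' w hw).1) (L := 3 * M + 1) ?_ ?_
  · filter_upwards [hg] with n hn w hw w' hw'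
    rw [sub_sub_sub_cancel_right]
    exact c.lipR hn.1 hF' hn.2 w hw w' hw'
  · filter_upwards [hg] with n hn s hs hsρ
    refine lg_submean (Y := fun w => vR A B P Q n (F w) w) hn.1 (fun w hw => ?_) 
      (fun w hw => c.vR_ne hn.1 (hn.2 w hw).1 (hn.2 w hw).2.1 (hF' w hw).1) _ hs hsρ
    exact (c.solR hn.1 (S := Metric.ball z ρ) (fun x hx => (hn.2 x hx).2.1) hF' w hw).differentiableAt.differentiableWithinAt

lemma lim_grow (c : UC A B f R₀ P Q H G κ d l Hi Gi) (L : Lims A B P Q κ l (EE A Hi) zb N pl r k) : 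
    ∃ C R, (∀ z ∉ EE A Hi, N z ≤ C + Real.log (1 + ‖z‖)) ∧
    (∀ z, R ≤ ‖z‖ → z ∉ EE A Hi ∧ f z ≠ 0 ∧ r z (f z) ≤ C - Real.log ‖z‖) := by
  obtain ⟨K1, hK1, h1⟩ := c.growY L.hzb
  obtain ⟨K2, R, hK2, hR, h2⟩ := c.decR L.hzb
  obtain ⟨RE, hRE⟩ := c.finE.isBounded.exists_norm_le
  obtain ⟨M', hM', hg'⟩ := c.goodAt L.hzb
  refine ⟨max (Real.log K1) (Real.log K2), max R (RE + 1), fun z hz => ?_, fun z hz => ?_⟩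
  · obtain ⟨M, hM, hg⟩ := c.goodAt hz
    have t := (c.tlg (1 + ‖B.eval z / A.eval z‖)).add_const (Real.log K1 + Real.log (1 + ‖z‖))
    have := le_of_tendsto_of_tendsto (L.tN z hz) t (by
      filter_upwards [h1, hg, hg'] with n h1 hn hn'
      have p1 : 0 < ‖vY A B P Q n zb‖ := norm_pos_iff.2 (c.vY_ne hn.1 hn'.2.1 hn'.2.2.1)
      have hpos : 0 < K1 * (1 + ‖z‖) := by positivity
      have e : (K1 * (1 + ‖z‖)) ^ n = Real.exp (n * Real.log (K1 * (1 + ‖z‖))) := by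
        rw [Real.exp_nat_mul, Real.exp_log hpos]
      have h3 := h1.2 z
      rw [e] at h3
      have := lg_mono (n := n) (norm_pos_iff.2 (c.vY_ne hn.1 hn.2.1 hn.2.2.1)) h3
      rw [lg_mul (by positivity) (by positivity), lg_mul p1 (by positivity), lg_exp hn.1, Real.log_mul (by positivity) (by positivity)] at this
      linarith)
    linarith [le_max_left (Real.log K1) (Real.log K2)]
  · have hz1 : R ≤ ‖z‖ := (le_max_left _ _).trans hz
    have hz2 : RE + 1 ≤ ‖z‖ := (le_max_right _ _).trans hz
    have hzE : z ∉ EE A Hi := fun h => by have := hRE z h; linarith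
    have hfz : f z ≠ 0 := (c.fBr z (by change R₀ < ‖z‖; linarith)).1
    refine ⟨hzE, hfz, ?_⟩
    have hzp : 0 < ‖z‖ := by linarith [c.hR]
    obtain ⟨M, hM, hg⟩ := c.goodAt hzE
    have t := (c.tlg 3).add_const (Real.log K2 - Real.log ‖z‖)
    have := le_of_tendsto_of_tendsto (L.tr z hzE _ hfz) t (by
      filter_upwards [h2, hg, hg'] with n h1 hn hn'
      have p1 : 0 < ‖vY A B P Q n zb‖ := norm_pos_iff.2 (c.vY_ne hn.1 hn'.2.1 hn'.2.2.1)
      have hpos : 0 < K2 / ‖z‖ := by positivity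
      have e : (K2 / ‖z‖) ^ n = Real.exp (n * Real.log (K2 / ‖z‖)) := by
        rw [Real.exp_nat_mul, Real.exp_log hpos]
      have h3 := h1.2 z hz1
      rw [e] at h3
      have := lg_mono (n := n) (norm_pos_iff.2 (c.vR_ne hn.1 hn.2.1 hn.2.2.1 hfz)) h3
      rw [lg_mul (by positivity) (by positivity), lg_mul (by norm_num) p1, lg_exp hn.1, Real.log_div (by positivity) (by positivity)] at this
      linarith)
    linarith [le_max_right (Real.log K1) (Real.log K2)]

lemma limData (c : UC A B f R₀ P Q H G κ d l Hi Gi) (L : Lims A B P Q κ l (EE A Hi) zb N pl r k) 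
    (hnull : volume {z | z ∉ EE A Hi ∧ N z = k / 2} = 0) : LimData A B f (EE A Hi) N r k where
  finE := c.finE
  EA := fun z hz => Or.inl hz
  contN := fun z hz => by
    obtain ⟨ρ, M, hρ, hM, -, hsub, hg⟩ := c.loc hz univ_mem
    exact cont_of_lip hρ (c.lipN L hsub hg) z (Metric.mem_ball_self hρ)
  contr := fun U F hU hUE hF z hz => by
    obtain ⟨ρ, M, hρ, hM, hsU, hsub, hg⟩ := c.loc (hUE hz) (hU.mem_nhds hz)
    exact cont_of_lip hρ (c.lipr L hsub (hF.mono hsU) hg) z (Metric.mem_ball_self hρ)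
  subN := fun z hz => c.lim_subN L hz
  subr := fun U F hU hUE hF z hz => c.lim_subr L hU hF hz (hUE hz)
  low := fun z hz φ hφ => by
    have := c.lim_low L hz hφ
    have := c.lim_pup L hz
    linarith
  up := fun z hz φ hφ => c.lim_up L hz hφ
  uniq := fun z hz φ hφ φ' hφ' hne h => c.lim_uniq L hz hφ hφ' hne h
  lc := fun U F hU hUE hF z hz h1 h2 => c.lim_lc L hU hF hz (hUE hz) h1 h2
  grow := c.lim_grow L
  null := hnull

end UC

lemma porous_null {S : Set ℂ} (h : ∀ z ∈ S, ∃ K : ℕ, ∃ (w : ℕ → ℂ) (δ : ℕ → ℝ), Tendsto δ atTop (𝓝[>] 0) ∧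
    (∀ᶠ j in atTop, z ∈ Metric.closedBall (w j) (K * δ j)) ∧ (∀ᶠ j in atTop, S ∩ Metric.closedBall (w j) (δ j) = ∅)) :
    volume S = 0 := by
  have h1 : ∀ᵐ x ∂(volume.restrict S), ∀ K : ℕ, ∀ (w : ℕ → ℂ) (δ : ℕ → ℝ) (_ : Tendsto δ atTop (𝓝[>] 0))
      (_ : ∀ᶠ j in atTop, x ∈ Metric.closedBall (w j) (K * δ j)),
      Tendsto (fun j => volume (S ∩ Metric.closedBall (w j) (δ j)) / volume (Metric.closedBall (w j) (δ j))) atTop (𝓝 1) := by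
    rw [ae_all_iff]
    intro K
    filter_upwards [IsUnifLocDoublingMeasure.ae_tendsto_measure_inter_div (volume : Measure ℂ) S K] with x hx w δ h1 h2
    exact hx w δ h1 h2
  have h2 : ∀ᵐ x ∂(volume.restrict S), x ∉ S := by
    filter_upwards [h1] with x hx hxS
    obtain ⟨K, w, δ, a1, a2, a3⟩ := h x hxS
    have t := hx K w δ a1 a2
    have t0 : Tendsto (fun j => volume (S ∩ Metric.closedBall (w j) (δ j)) / volume (Metric.closedBall (w j) (δ j))) atTop (𝓝 0) := by
      refine tendsto_const_nhds.congr' ?_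
      filter_upwards [a3] with j hj
      rw [hj]; simp
    exact one_ne_zero (tendsto_nhds_unique t t0)
  rw [ae_iff] at h2
  have h3 : volume.restrict S S = 0 := measure_mono_null (fun x hx => by simpa using hx) h2
  rwa [Measure.restrict_apply_self] at h3

namespace UC
variable {A B : ℂ[X]} {f : ℂ → ℂ} {R₀ : ℝ} {P Q H G : ℕ → ℂ[X]} {κ : ℕ → ℂ} {d : ℕ} {l : Ultrafilter ℕ} {Hi Gi : ℂ[X]}
variable {zb : ℂ} {N pl : ℂ → ℝ} {r : ℂ → ℂ → ℝ} {k : ℝ}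

/-- local setup with `V_n` close to `V z` -/
lemma loc2 (c : UC A B f R₀ P Q H G κ d l Hi Gi) {z : ℂ} (hz : z ∉ EE A Hi) {s : Set ℂ} (hs : s ∈ 𝓝 z) {ε : ℝ} (hε : 0 < ε) :
    ∃ ρ M, 0 < ρ ∧ 1 ≤ M ∧ Metric.ball z ρ ⊆ s ∧ Metric.ball z ρ ⊆ (EE A Hi)ᶜ ∧
      (∀ᶠ n in (l : Filter ℕ), 1 ≤ n ∧ ∀ w ∈ Metric.ball z ρ, Good A B H G n w M) ∧
      (∀ᶠ n in (l : Filter ℕ), ∀ w ∈ Metric.ball z ρ, ‖VV A H G n w - Gi.eval z / (A.eval z * Hi.eval z)‖ ≤ ε) := by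
  have h := (c.tendsto_VV hz).eventually (Metric.closedBall_mem_nhds _ hε)
  obtain ⟨pa, hpa, pb, hpb, hab⟩ := eventually_prod_iff.1 h
  obtain ⟨ρ, M, h1, h2, h3, h4, h5⟩ := c.loc hz (inter_mem hs hpb)
  refine ⟨ρ, M, h1, h2, fun w hw => (h3 hw).1, h4, h5, ?_⟩
  filter_upwards [hpa] with n hn w hw
  exact mem_closedBall_iff_norm.1 (hab hn (h3 hw).2)

lemma flat (c : UC A B f R₀ P Q H G κ d l Hi Gi) (L : Lims A B P Q κ l (EE A Hi) zb N pl r k) {z : ℂ} (hz : z ∉ EE A Hi)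
    (h0 : Gi = 0) {δ : ℝ} (hδ : 0 < δ) (hδ1 : δ ≤ 1) : ∀ᶠ w in 𝓝 z, |N w - N z| ≤ 4 * δ * ‖w - z‖ := by
  obtain ⟨ρ, M, hρ, hM, -, hsub, hg, hV⟩ := c.loc2 hz univ_mem (ε := δ ^ 2) (by positivity)
  simp only [h0, eval_zero, zero_div, sub_zero] at hV
  have hnM : ∀ᶠ n : ℕ in (l : Filter ℕ), M ≤ n * δ := by
    have : Tendsto (fun n : ℕ => (n:ℝ) * δ) l atTop := (tendsto_natCast_atTop_atTop.mono_left c.hl).atTop_mul_const hδ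
    exact this.eventually_ge_atTop M
  have key : ∀ w ∈ Metric.ball z ρ, ∀ w' ∈ Metric.ball z ρ, N w ≤ N w' + 4 * δ * ‖w - w'‖ := by
    intro w hw w' hw'
    have t := ((c.tlg (1 / δ)).add (L.tN w' (hsub hw'))).add_const (4 * δ * ‖w - w'‖)
    rw [zero_add] at t
    refine le_of_tendsto_of_tendsto (L.tN w (hsub hw)) t ?_
    filter_upwards [hg, hV, hnM] with n hn hV hnM
    have hn' : (1:ℝ) ≤ n := by exact_mod_cast hn.1
    set T : ℂ × ℂ →L[ℂ] ℂ × ℂ := (ContinuousLinearMap.fst ℂ ℂ ℂ).prod (((δ⁻¹ : ℝ) : ℂ) • ContinuousLinearMap.snd ℂ ℂ ℂ) with hT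
    have Tn : ∀ u, ‖T u‖ = max ‖u.1‖ (δ⁻¹ * ‖u.2‖) := fun u => by
      simp [hT, Prod.norm_def, abs_of_pos hδ]
    have bd : ∀ x ∈ Metric.ball z ρ, ∀ u : ℂ × ℂ, ‖T ((n:ℂ) * u.2, - bb A B H n x * u.2 + ((n:ℂ) + 1) * VV A H G n x * u.1)‖ ≤ n * (3 * δ) * ‖T u‖ := by
      intro x hx u
      rw [Tn, Tn]
      set m := max ‖u.1‖ (δ⁻¹ * ‖u.2‖) with hm
      have m1 : ‖u.1‖ ≤ m := le_max_left _ _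
      have m2 : ‖u.2‖ ≤ δ * m := by
        have : δ⁻¹ * ‖u.2‖ ≤ m := le_max_right _ _
        rwa [inv_mul_le_iff₀ hδ] at this
      have m0 : 0 ≤ m := (norm_nonneg _).trans m1
      have hbx := (hn.2 x hx).2.2.1
      have hVx := hV x hx
      apply max_le
      · rw [norm_mul, Complex.norm_natCast]
        have := mul_le_mul_of_nonneg_left m2 (by positivity : (0:ℝ) ≤ n)
        have : 0 ≤ n * (δ * m) := by positivity
        nlinarith
      · rw [inv_mul_le_iff₀ hδ]
        refine (norm_add_le _ _).trans ?_
        rw [norm_mul, norm_mul, norm_mul, norm_neg]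
        have i1 : ‖bb A B H n x‖ * ‖u.2‖ ≤ (n * δ) * (δ * m) := mul_le_mul (hbx.trans hnM) m2 (norm_nonneg _) (by positivity)
        have i2 : ‖(n:ℂ) + 1‖ ≤ 2 * n := by
          refine (norm_add_le _ _).trans ?_
          rw [Complex.norm_natCast, norm_one]; linarith
        have i3 : ‖(n:ℂ) + 1‖ * ‖VV A H G n x‖ ≤ 2 * n * δ ^ 2 := mul_le_mul i2 hVx (norm_nonneg _) (by positivity)
        have i4 := mul_le_mul i3 m1 (norm_nonneg _) (by positivity)
        refine (add_le_add i1 i4).trans (le_of_eq ?_)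
        ring
    set TT : (ℂ × ℂ) × (ℂ × ℂ) →L[ℂ] (ℂ × ℂ) × (ℂ × ℂ) := T.prodMap T with hTT
    have TTn : ∀ u, ‖TT u‖ = max ‖T u.1‖ ‖T u.2‖ := fun u => by simp [hTT, Prod.norm_def]
    have Tlo : ∀ u, ‖u‖ ≤ ‖T u‖ := fun u => by
      rw [Tn, Prod.norm_def]
      refine max_le_max le_rfl ?_
      have : 1 ≤ δ⁻¹ := (one_le_inv₀ hδ).2 hδ1
      nlinarith [norm_nonneg u.2]
    have Tup : ∀ u, ‖T u‖ ≤ δ⁻¹ * ‖u‖ := fun u => by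
      have : 1 ≤ δ⁻¹ := (one_le_inv₀ hδ).2 hδ1
      rw [Tn]
      apply max_le
      · nlinarith [norm_nonneg u.1, norm_fst_le u]
      · have := norm_snd_le u
        gcongr
    have TTlo : ∀ u, ‖u‖ ≤ ‖TT u‖ := fun u => by
      rw [TTn, Prod.norm_def]; exact max_le_max (Tlo _) (Tlo _)
    have TTup : ∀ u, ‖TT u‖ ≤ δ⁻¹ * ‖u‖ := fun u => by
      rw [TTn]
      have := norm_fst_le u
      have := norm_snd_le u
      apply max_le
      · refine (Tup _).trans ?_; gcongr
      · refine (Tup _).trans ?_; gcongr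
    have G1 := gron (W := fun x => TT (vY A B P Q n x)) (K := n * (4 * δ)) (convex_ball z ρ)
      (fun x hx => TT.hasFDerivAt.comp_hasDerivAt x (((c.solP hn.1 (S := Metric.ball z ρ) (fun y hy => ⟨(hn.2 y hy).1, (hn.2 y hy).2.1⟩)) x hx).prodMk
        (c.derQ hn.1 (hn.2 x hx).1 (hn.2 x hx).2.1))) (fun x hx => by
        rw [TTn, TTn]
        have e1 := bd x hx (vP P n x)
        have e2 := bd x hx (vQ A B Q n x)
        set m := max ‖T (vY A B P Q n x).1‖ ‖T (vY A B P Q n x).2‖ with hm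
        have m1 : ‖T (vP P n x)‖ ≤ m := le_max_left _ _
        have m2 : ‖T (vQ A B Q n x)‖ ≤ m := le_max_right _ _
        have m0 : 0 ≤ m := (norm_nonneg _).trans m1
        have hB := (hn.2 x hx).2.2.2.2.1
        have hB' := hB.trans hnM
        apply max_le
        · refine e1.trans ?_
          have := mul_le_mul_of_nonneg_left m1 (by positivity : 0 ≤ (n:ℝ) * (3 * δ))
          have : 0 ≤ n * δ * m := by positivity
          nlinarith
        · dsimp only
          rw [map_sub, map_smul]
          refine (norm_sub_le _ _).trans ?_
          rw [norm_smul]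
          have := mul_le_mul_of_nonneg_left m2 (by positivity : 0 ≤ (n:ℝ) * (3 * δ))
          have := mul_le_mul hB' m2 (norm_nonneg _) (by positivity)
          nlinarith) hw' hw
    have y1 : vY A B P Q n w ≠ 0 := c.vY_ne hn.1 (hn.2 w hw).1 (hn.2 w hw).2.1
    have y2 : vY A B P Q n w' ≠ 0 := c.vY_ne hn.1 (hn.2 w' hw').1 (hn.2 w' hw').2.1
    have y1' := norm_pos_iff.2 y1
    have y2' := norm_pos_iff.2 y2
    have G2 : ‖vY A B P Q n w‖ ≤ (1 / δ * ‖vY A B P Q n w'‖) * Real.exp (n * (4 * δ) * ‖w - w'‖) := by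
      refine (TTlo _).trans (G1.trans ?_)
      have := TTup (vY A B P Q n w')
      rw [one_div]
      gcongr
    have G3 := lg_gron hn.1 y1' (by positivity) G2
    rw [lg_mul (by positivity) y2'] at G3
    linarith
  filter_upwards [Metric.ball_mem_nhds z hρ] with w hw
  have hzz := Metric.mem_ball_self (x := z) hρ
  have a1 := key w hw z hzz
  have a2 := key z hzz w hw
  rw [norm_sub_rev] at a2
  rw [abs_le]
  constructor <;> linarith

lemma Gi_ne (c : UC A B f R₀ P Q H G κ d l Hi Gi) (L : Lims A B P Q κ l (EE A Hi) zb N pl r k) : Gi ≠ 0 := by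
  intro h0
  have hd : ∀ z ∉ EE A Hi, HasFDerivAt N (0 : ℂ →L[ℝ] ℝ) z := fun z hz => by
    rw [hasFDerivAt_iff_isLittleO]
    simp only [ContinuousLinearMap.zero_apply, sub_zero]
    rw [isLittleO_iff]
    intro ε hε
    have hm : 0 < min (ε / 4) 1 := lt_min (by positivity) one_pos
    filter_upwards [c.flat L hz h0 hm (min_le_right _ _)] with w hw
    rw [Real.norm_eq_abs]
    refine hw.trans ?_
    have := min_le_left (ε / 4) 1
    have := mul_le_mul_of_nonneg_right this (norm_nonneg (w - z))
    linarith
  have hconn := (compl_finite_connected c.finE).isPreconnected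
  have hc : ∀ x ∈ (EE A Hi)ᶜ, ∀ y ∈ (EE A Hi)ᶜ, N x = N y := fun x hx y hy => c.openE.is_const_of_fderiv_eq_zero (𝕜 := ℝ) hconn (f := N) 
    (fun z hz => (hd z hz).differentiableAt.differentiableWithinAt) (fun z hz => (hd z hz).fderiv) hx hy
  obtain ⟨C, R, _, h2⟩ := c.lim_grow L
  have h3 := Real.tendsto_log_atTop.eventually_gt_atTop (C - k + N zb)
  obtain ⟨t, ht1, ht2, ht3⟩ := (h3.and ((eventually_ge_atTop R).and (eventually_ge_atTop 0))).exists
  have hn : ‖(t:ℂ)‖ = t := by simp [abs_of_nonneg ht3]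
  obtain ⟨g1, g2, g3⟩ := h2 t (by rw [hn]; exact ht2)
  have a1 := c.lim_low L g1 g2
  have a2 := c.lim_pup L g1
  have a3 := hc _ g1 _ L.hzb
  rw [hn] at g3; linarith

end UC

noncomputable def CK (k : ℂ) : ℝ := 2 * (1 + ‖k‖) * (1 + 1 / ‖k‖)

def Dom (k : ℂ) (u : ℂ × ℂ) : Prop := ‖u.2 - k * u.1‖ ≤ 2 * ‖u.2 + k * u.1‖

lemma Dom.or (k : ℂ) (u : ℂ × ℂ) : Dom k u ∨ Dom (-k) u := by
  unfold Dom
  simp only [neg_mul, sub_neg_eq_add, ← sub_eq_add_neg]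
  rcases le_total ‖u.2 - k * u.1‖ ‖u.2 + k * u.1‖ with h | h
  · left; linarith [norm_nonneg (u.2 + k * u.1)]
  · right; linarith [norm_nonneg (u.2 - k * u.1)]

def ConeOK (A B : ℂ[X]) (H G : ℕ → ℂ[X]) (k₀ : ℂ) (n : ℕ) (S : Set ℂ) : Prop :=
  ∀ k', (k' = k₀ ∨ k' = -k₀) → ∀ W, Sol n (bb A B H n) (VV A H G n) S W → (∀ w ∈ S, W w ≠ 0) → ∀ z ∈ S, ∀ T : ℝ, 0 ≤ T →
    z + T * (‖k'‖ / k') ∈ S → Dom k' (W z) → lg n ‖W z‖ + ‖k₀‖ * T / 2 ≤ lg n (CK k₀) + lg n ‖W (z + T * (‖k'‖ / k'))‖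

namespace UC
variable {A B : ℂ[X]} {f : ℂ → ℂ} {R₀ : ℝ} {P Q H G : ℕ → ℂ[X]} {κ : ℕ → ℂ} {d : ℕ} {l : Ultrafilter ℕ} {Hi Gi : ℂ[X]}
variable {zb : ℂ} {N pl : ℂ → ℝ} {r : ℂ → ℂ → ℝ} {k : ℝ}

lemma coneSetup (c : UC A B f R₀ P Q H G κ d l Hi Gi) {z : ℂ} (hz : z ∉ EE A Hi) {s : Set ℂ} (hs : s ∈ 𝓝 z) {k₀ : ℂ} (hk : k₀ ≠ 0)
    (hk2 : k₀ ^ 2 = Gi.eval z / (A.eval z * Hi.eval z)) : 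
    ∃ ρ M, 0 < ρ ∧ 1 ≤ M ∧ Metric.ball z ρ ⊆ s ∧ Metric.ball z ρ ⊆ (EE A Hi)ᶜ ∧
      (∀ᶠ n in (l : Filter ℕ), 1 ≤ n ∧ ∀ w ∈ Metric.ball z ρ, Good A B H G n w M) ∧
      (∀ᶠ n in (l : Filter ℕ), ConeOK A B H G k₀ n (Metric.ball z ρ)) := by
  have hkp : 0 < ‖k₀‖ := norm_pos_iff.2 hk
  obtain ⟨ρ, M, hρ, hM, hs', hsub, hg, hV⟩ := c.loc2 hz hs (ε := ‖k₀‖ ^ 2 / 64) (by positivity)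
  refine ⟨ρ, M, hρ, hM, hs', hsub, hg, ?_⟩
  rw [← hk2] at hV
  have hn0 : ∀ᶠ n : ℕ in (l : Filter ℕ), M / 2 + M / (2 * ‖k₀‖) ≤ n * (‖k₀‖ / 128) := by
    have : Tendsto (fun n : ℕ => (n:ℝ) * (‖k₀‖ / 128)) l atTop := (tendsto_natCast_atTop_atTop.mono_left c.hl).atTop_mul_const (by positivity)
    exact this.eventually_ge_atTop _
  filter_upwards [hg, hV, hn0] with n hn hV hn0 k' hk' W hW hW0 x hx T hT hx' hdom
  have hkk : ‖k'‖ = ‖k₀‖ := by rcases hk' with h | h <;> simp [h]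
  have hk'0 : k' ≠ 0 := by rcases hk' with h | h <;> simp [h, hk]
  have hk'2 : k' ^ 2 = k₀ ^ 2 := by rcases hk' with h | h <;> simp [h]
  have := Sol.cone hn.1 hk'0 (fun w hw => (hn.2 w hw).2.2.1) (fun w hw => (hn.2 w hw).2.2.2.1) (fun w hw => by rw [hk'2]; exact hV w hw) (convex_ball z ρ) hW
    (by
      rw [hkk]
      have : (n * (‖k₀‖ ^ 2 / 64) + M) / (2 * ‖k₀‖) = n * (‖k₀‖ / 128) + M / (2 * ‖k₀‖) := by field_simp; ring
      rw [this]; linarith) hT hx hx' hdom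
  rw [hkk] at this
  have p1 : 0 < ‖W x‖ := norm_pos_iff.2 (hW0 x hx)
  have p2 : 0 < ‖W (x + T * (‖k'‖ / k'))‖ := norm_pos_iff.2 (hW0 _ hx')
  have p3 : 0 < CK k₀ := by unfold CK; positivity
  have h2 := lg_mono (n := n) (by positivity) this
  rw [lg_mul p1 (Real.exp_pos _), show (n:ℝ) * ‖k₀‖ * T / 2 = n * (‖k₀‖ * T / 2) by ring, lg_exp hn.1] at h2
  rw [hkk]
  rw [← lg_mul p3 (by rw [← hkk]; exact p2)]
  exact h2

lemma dir_unit {k' : ℂ} (hk : k' ≠ 0) {T : ℝ} (hT : 0 ≤ T) : ‖(T:ℂ) * (‖k'‖ / k')‖ = T := by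
  have : ‖k'‖ ≠ 0 := norm_ne_zero_iff.2 hk
  simp [this, abs_of_nonneg hT]

lemma grow_dir (c : UC A B f R₀ P Q H G κ d l Hi Gi) (L : Lims A B P Q κ l (EE A Hi) zb N pl r k) {z : ℂ} (hz : z ∉ EE A Hi) (hG : Gi.eval z ≠ 0) :
    ∃ k' : ℂ, k' ≠ 0 ∧ ∃ ρ > 0, ∀ T : ℝ, 0 ≤ T → T < ρ → N z + ‖k'‖ * T / 2 ≤ N (z + T * (‖k'‖ / k')) := by
  have hA : A.eval z ≠ 0 := fun h => hz (Or.inl h)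
  have hH : Hi.eval z ≠ 0 := fun h => hz (Or.inr h)
  obtain ⟨k₀, hk2⟩ := IsAlgClosed.exists_pow_nat_eq (Gi.eval z / (A.eval z * Hi.eval z)) (n := 2) (by norm_num)
  have hk : k₀ ≠ 0 := by
    rintro rfl
    rw [zero_pow two_ne_zero, eq_comm, div_eq_zero_iff] at hk2
    rcases hk2 with h | h
    · exact hG h
    · exact mul_ne_zero hA hH h
  obtain ⟨ρ, M, hρ, hM, -, hsub, hg, hc⟩ := c.coneSetup hz univ_mem hk hk2
  have hzz := Metric.mem_ball_self (x := z) hρ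
  obtain ⟨F, hF, hFz⟩ := exists_branch (A := A) (B := B) (c := z) (ρ := ρ) (w := z) (fun w hw h => hsub hw (Or.inl h)) (one_ne_zero (α := ℂ))
  -- generic statement
  have gen : ∀ (W : ℕ → ℂ → ℂ × ℂ) (g : ℂ → ℝ), (∀ w ∈ Metric.ball z ρ, 0 < g w) → 
      (∀ᶠ n in (l : Filter ℕ), Sol n (bb A B H n) (VV A H G n) (Metric.ball z ρ) (W n)) → 
      (∀ n, ∀ w, ‖W n w‖ ≤ g w * ‖vY A B P Q n w‖) → (∀ᶠ n in (l : Filter ℕ), ‖W n z‖ = ‖vY A B P Q n z‖) →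
      ∃ k' : ℂ, k' ≠ 0 ∧ ∃ ρ > 0, ∀ T : ℝ, 0 ≤ T → T < ρ → N z + ‖k'‖ * T / 2 ≤ N (z + T * (‖k'‖ / k')) := by
    intro W g hgp hS hle heq
    have hor : ∀ᶠ n in (l : Filter ℕ), Dom k₀ (W n z) ∨ Dom (-k₀) (W n z) := Eventually.of_forall fun n => Dom.or _ _
    have : ∃ k', (k' = k₀ ∨ k' = -k₀) ∧ ∀ᶠ n in (l : Filter ℕ), Dom k' (W n z) := by
      rcases Ultrafilter.eventually_or.1 hor with h | h
      · exact ⟨k₀, Or.inl rfl, h⟩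
      · exact ⟨-k₀, Or.inr rfl, h⟩
    obtain ⟨k', hk', hdom⟩ := this
    have hkk : ‖k'‖ = ‖k₀‖ := by rcases hk' with h | h <;> simp [h]
    have hk'0 : k' ≠ 0 := by rcases hk' with h | h <;> simp [h, hk]
    refine ⟨k', hk'0, ρ, hρ, fun T hT hTρ => ?_⟩
    have hx' : z + T * (‖k'‖ / k') ∈ Metric.ball z ρ := by
      rw [mem_ball_iff_norm, add_sub_cancel_left, dir_unit hk'0 hT]; exact hTρ
    set x := z + T * (‖k'‖ / k') with hx
    have t1 := (L.tN z hz).add_const (‖k'‖ * T / 2)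
    have t2 := ((c.tlg (CK k₀)).add (c.tlg (g x))).add (L.tN x (hsub hx'))
    rw [zero_add, zero_add] at t2
    refine le_of_tendsto_of_tendsto t1 t2 ?_
    filter_upwards [hg, hS, hc, heq, hdom] with n hn hS hc heq hdom
    have W0 : ∀ w ∈ Metric.ball z ρ, W n w ≠ 0 := by
      intro w hw h0
      have := Sol.gron hn.1 (fun x hx => (hn.2 x hx).2.2.1) (fun x hx => (hn.2 x hx).2.2.2.1) (convex_ball z ρ) hS hw hzz
      rw [h0, norm_zero, zero_mul, heq] at this
      exact c.vY_ne hn.1 (hn.2 z hzz).1 (hn.2 z hzz).2.1 (norm_le_zero_iff.1 this)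
    have i1 := hc k' hk' (W n) hS W0 z hzz T hT hx' hdom
    have y1 := norm_pos_iff.2 (c.vY_ne hn.1 (hn.2 x hx').1 (hn.2 x hx').2.1)
    have i2 := lg_mono (n := n) (norm_pos_iff.2 (W0 x hx')) (hle n x)
    rw [lg_mul (hgp x hx') y1] at i2
    rw [heq] at i1
    rw [hkk]
    linarith
  have hor : ∀ᶠ n in (l : Filter ℕ), ‖vP P n z‖ = ‖vY A B P Q n z‖ ∨ ‖vQ A B Q n z‖ = ‖vY A B P Q n z‖ := Eventually.of_forall fun n => by
    rcases max_choice ‖vP P n z‖ ‖vQ A B Q n z‖ with h | h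
    · left; rw [vY, Prod.norm_def]; exact h.symm
    · right; rw [vY, Prod.norm_def]; exact h.symm
  rcases Ultrafilter.eventually_or.1 hor with h | h
  · refine gen (fun n => vP P n) (fun _ => 1) (fun _ _ => one_pos) ?_ ?_ h
    · filter_upwards [hg] with n hn
      exact c.solP hn.1 (fun y hy => ⟨(hn.2 y hy).1, (hn.2 y hy).2.1⟩)
    · intro n w
      rw [one_mul]; exact norm_fst_le (vY A B P Q n w)
  · refine gen (fun n w => F w • vQ A B Q n w) (fun w => ‖F w‖) (fun w hw => norm_pos_iff.2 (hF w hw).1) ?_ ?_ ?_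
    · filter_upwards [hg] with n hn
      exact c.solQ hn.1 (fun y hy => (hn.2 y hy).2.1) hF
    · intro n w
      rw [norm_smul]
      have := norm_snd_le (vY A B P Q n w)
      exact mul_le_mul_of_nonneg_left this (norm_nonneg _)
    · filter_upwards [h] with n hn
      rw [hFz, one_smul, hn]

lemma null (c : UC A B f R₀ P Q H G κ d l Hi Gi) (L : Lims A B P Q κ l (EE A Hi) zb N pl r k) : 
    volume {z | z ∉ EE A Hi ∧ N z = k / 2} = 0 := by
  have hGf : {z | Gi.eval z = 0}.Finite := Gi.finite_setOf_isRoot (c.Gi_ne L)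
  have h1 : volume {z | z ∉ EE A Hi ∧ N z = k / 2 ∧ Gi.eval z ≠ 0} = 0 := by
    refine porous_null ?_
    rintro z ⟨hz, hNz, hGz⟩
    obtain ⟨k', hk', ρ, hρ, hT⟩ := c.grow_dir L hz hGz
    obtain ⟨ρ', M, hρ', hM, -, hsub, hg⟩ := c.loc hz univ_mem
    have lip := c.lipN L hsub hg
    have hkp : 0 < ‖k'‖ := norm_pos_iff.2 hk'
    set η : ℝ := min 1 (‖k'‖ / (4 * (4 * M + 1))) with hη
    have hη0 : 0 < η := lt_min one_pos (by positivity)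
    have hη1 : η ≤ 1 := min_le_left _ _
    have hη2 : (4 * M + 1) * η ≤ ‖k'‖ / 4 := by
      have : η ≤ ‖k'‖ / (4 * (4 * M + 1)) := min_le_right _ _
      rw [le_div_iff₀ (by positivity)] at this
      linarith
    obtain ⟨K, hK⟩ := exists_nat_gt (1 / η)
    have hK' : 1 ≤ K * η := by rw [div_lt_iff₀ hη0] at hK; exact hK.le
    have t0 : Tendsto (fun j : ℕ => 1 / ((j:ℝ) + 1)) atTop (𝓝 0) := tendsto_one_div_add_atTop_nhds_zero_nat
    refine ⟨K, fun j => z + (1 / ((j:ℝ) + 1) : ℝ) * (‖k'‖ / k'), fun j => η * (1 / ((j:ℝ) + 1)), ?_, ?_, ?_⟩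
    · rw [tendsto_nhdsWithin_iff]
      refine ⟨by simpa using t0.const_mul η, Eventually.of_forall fun j => ?_⟩
      change 0 < η * (1 / ((j:ℝ) + 1))
      positivity
    · refine Eventually.of_forall fun j => ?_
      have hp : (0:ℝ) ≤ 1 / ((j:ℝ) + 1) := by positivity
      rw [mem_closedBall_iff_norm, norm_sub_rev, add_sub_cancel_left, dir_unit hk' hp, ← mul_assoc]
      nlinarith
    · filter_upwards [t0.eventually_lt_const hρ, t0.eventually_lt_const (half_pos hρ')] with j hj hj'
      have hp : (0:ℝ) < 1 / ((j:ℝ) + 1) := by positivity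
      have g1 := hT _ hp.le hj
      set t := 1 / ((j:ℝ) + 1) with ht
      rw [Set.eq_empty_iff_forall_notMem]
      rintro w ⟨⟨hw1, hw2, -⟩, hw3⟩
      rw [mem_closedBall_iff_norm] at hw3
      set x := z + (t:ℂ) * (‖k'‖ / k') with hx
      have hxz : ‖x - z‖ = t := by rw [hx, add_sub_cancel_left, dir_unit hk' hp.le]
      have hηt : η * t ≤ t := by nlinarith
      have hxb : x ∈ Metric.ball z ρ' := by rw [mem_ball_iff_norm, hxz]; linarith
      have hwb : w ∈ Metric.ball z ρ' := by
        rw [mem_ball_iff_norm]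
        have := norm_sub_le_norm_sub_add_norm_sub w x z
        rw [hxz] at this
        linarith
      have l1 := lip w hwb x hxb
      rw [abs_le] at l1
      have : (4 * M + 1) * ‖w - x‖ ≤ ‖k'‖ / 4 * t := by
        refine (mul_le_mul_of_nonneg_left hw3 (by positivity)).trans ?_
        rw [← mul_assoc]; gcongr
      have : 0 < ‖k'‖ * t := by positivity
      linarith [l1.1]
  refine measure_mono_null (t := {z | z ∉ EE A Hi ∧ N z = k / 2 ∧ Gi.eval z ≠ 0} ∪ {z | Gi.eval z = 0}) ?_ (measure_union_null h1 (hGf.measure_zero _))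
  rintro z ⟨h1, h2⟩
  by_cases h : Gi.eval z = 0
  · exact Or.inr h
  · exact Or.inl ⟨h1, h2, h⟩

end UC

lemma alg1 {k : ℂ} (hk : k ≠ 0) {u v : ℂ × ℂ} (h1 : 2 * ‖u.2 - k * u.1‖ ≤ ‖u.2 + k * u.1‖) (h2 : 2 * ‖v.2 + k * v.1‖ ≤ ‖v.2 - k * v.1‖) :
    ‖u.1 * v.1‖ ≤ 3 / (2 * ‖k‖) * ‖Dt u v‖ ∧ ‖Dt u v‖ ≤ 10 * ‖k‖ * ‖u.1 * v.1‖ := by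
  have hkp : 0 < ‖k‖ := norm_pos_iff.2 hk
  set a := u.2 + k * u.1 with ha
  set b := u.2 - k * u.1 with hb
  set a' := v.2 + k * v.1 with ha'
  set b' := v.2 - k * v.1 with hb'
  have e1 : 2 * k * u.1 = a - b := by rw [ha, hb]; ring
  have e2 : 2 * k * v.1 = a' - b' := by rw [ha', hb']; ring
  have e3 : 2 * k * Dt u v = a * b' - b * a' := by rw [ha, hb, ha', hb', Dt]; ring
  have n1 : 2 * ‖k‖ * ‖u.1‖ = ‖a - b‖ := by rw [← e1]; simp
  have n2 : 2 * ‖k‖ * ‖v.1‖ = ‖a' - b'‖ := by rw [← e2]; simp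
  have n3 : 2 * ‖k‖ * ‖Dt u v‖ = ‖a * b' - b * a'‖ := by rw [← e3]; simp
  have i1 := norm_sub_le a b
  have i2 := norm_sub_norm_le a b
  have i3 := norm_sub_le a' b'
  have i4 := norm_sub_norm_le b' a'
  rw [norm_sub_rev b' a'] at i4
  have i5 := norm_sub_le (a * b') (b * a')
  have i6 := norm_sub_norm_le (a * b') (b * a')
  rw [norm_mul, norm_mul] at i5 i6
  rw [← n1] at i1 i2
  rw [← n2] at i3 i4
  rw [← n3] at i5 i6
  have q : ‖b‖ * ‖a'‖ ≤ (‖a‖ / 2) * (‖b'‖ / 2) := mul_le_mul (by linarith) (by linarith) (norm_nonneg _) (by positivity)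
  have s1 : (2 * ‖k‖ * ‖u.1‖) * (2 * ‖k‖ * ‖v.1‖) ≤ (3 / 2 * ‖a‖) * (3 / 2 * ‖b'‖) :=
    mul_le_mul (by linarith) (by linarith) (by positivity) (by positivity)
  have s2 : (1 / 2 * ‖a‖) * (1 / 2 * ‖b'‖) ≤ (2 * ‖k‖ * ‖u.1‖) * (2 * ‖k‖ * ‖v.1‖) :=
    mul_le_mul (by linarith) (by linarith) (by positivity) (by positivity)
  rw [norm_mul]
  constructor
  · rw [div_mul_eq_mul_div, le_div_iff₀ (by positivity)]
    refine le_of_mul_le_mul_left ?_ hkp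
    nlinarith
  · refine le_of_mul_le_mul_left ?_ hkp
    nlinarith

lemma alg2 {k : ℂ} (hk : k ≠ 0) {u v : ℂ × ℂ} (h1 : ¬ (Dom k u ∧ Dom k v)) (h2 : ¬ (Dom (-k) u ∧ Dom (-k) v)) :
    ‖u.1 * v.1‖ ≤ 3 / (2 * ‖k‖) * ‖Dt u v‖ ∧ ‖Dt u v‖ ≤ 10 * ‖k‖ * ‖u.1 * v.1‖ := by
  have hu := Dom.or k u
  have hv := Dom.or k v
  have key : (¬ Dom (-k) u ∧ ¬ Dom k v) ∨ (¬ Dom k u ∧ ¬ Dom (-k) v) := by tauto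
  unfold Dom at key
  simp only [neg_mul, sub_neg_eq_add, ← sub_eq_add_neg, not_le] at key
  rcases key with ⟨a, b⟩ | ⟨a, b⟩
  · exact alg1 hk a.le b.le
  · have := alg1 (k := -k) (neg_ne_zero.2 hk) (u := u) (v := v) (by simpa [← sub_eq_add_neg] using a.le) (by simpa [← sub_eq_add_neg] using b.le)
    rwa [norm_neg] at this

namespace UC
variable {A B : ℂ[X]} {f : ℂ → ℂ} {R₀ : ℝ} {P Q H G : ℕ → ℂ[X]} {κ : ℕ → ℂ} {d : ℕ} {l : Ultrafilter ℕ} {Hi Gi : ℂ[X]}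
variable {zb : ℂ} {N pl : ℂ → ℝ} {r : ℂ → ℂ → ℝ} {k : ℝ}

lemma loc_prod (c : UC A B f R₀ P Q H G κ d l Hi Gi) (L : Lims A B P Q κ l (EE A Hi) zb N pl r k) {z : ℂ} (hz : z ∉ EE A Hi) (hG : Gi.eval z ≠ 0)
    {U : Set ℂ} (hU : IsOpen U) (hzU : z ∈ U) {F : ℂ → ℂ} (hF : Br A B F U) (hr : r z (F z) < N z) :
    ∃ ρ > 0, ∃ C > 0, ∀ᶠ n in (l : Filter ℕ), ∀ w ∈ Metric.ball z ρ, 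
      (‖κ n‖ / n) / C ≤ ‖(P n).eval w * (F w * (Q n).eval w - (P n).eval w)‖ ∧
      ‖(P n).eval w * (F w * (Q n).eval w - (P n).eval w)‖ ≤ C * (‖κ n‖ / n) := by
  have D := c.limData L (c.null L)
  have hA : A.eval z ≠ 0 := fun h => hz (Or.inl h)
  have hH : Hi.eval z ≠ 0 := fun h => hz (Or.inr h)
  obtain ⟨k₀, hk2⟩ := IsAlgClosed.exists_pow_nat_eq (Gi.eval z / (A.eval z * Hi.eval z)) (n := 2) (by norm_num)
  have hk : k₀ ≠ 0 := by
    rintro rfl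
    rw [zero_pow two_ne_zero, eq_comm, div_eq_zero_iff] at hk2
    rcases hk2 with h | h
    · exact hG h
    · exact mul_ne_zero hA hH h
  have hkp : 0 < ‖k₀‖ := norm_pos_iff.2 hk
  have hU' : IsOpen (U ∩ (EE A Hi)ᶜ) := hU.inter c.openE
  have hF' : Br A B F (U ∩ (EE A Hi)ᶜ) := hF.mono Set.inter_subset_left
  have e1 : ∀ᶠ w in 𝓝 z, r w (F w) < N w := (D.contr _ F hU' Set.inter_subset_right hF' z ⟨hzU, hz⟩).eventually_lt (D.contN z hz) hr
  have hFp : 0 < ‖F z‖ := norm_pos_iff.2 (hF z hzU).1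
  have e2 : ∀ᶠ w in 𝓝 z, ‖F z‖ / 2 < ‖F w‖ := (hF z hzU).2.2.continuousAt.norm.eventually_const_lt (by linarith)
  have e3 : ∀ᶠ w in 𝓝 z, ‖F w‖ < 2 * ‖F z‖ := (hF z hzU).2.2.continuousAt.norm.eventually_lt_const (by linarith)
  obtain ⟨ρ₀, M, hρ₀, hM, hs, hsub, hg, hc⟩ := c.coneSetup hz (inter_mem (hU.mem_nhds hzU) (e1.and (e2.and e3))) hk hk2
  have hFb : Br A B F (Metric.ball z ρ₀) := hF.mono fun w hw => (hs hw).1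
  have hpr : ∀ w ∈ Metric.ball z ρ₀, pl w + r w (F w) = k := fun w hw => by
    have h1 := (hs hw).2.1
    rw [c.lim_p L (hsub hw) (hFb w hw).1 h1, D.rlt (hsub hw) (hFb w hw).1 h1]; ring
  set T := ρ₀ / 2 with hT
  set Lc := 3 * M + 1 with hLc
  set ρ := min (ρ₀ / 4) (‖k₀‖ * T / (8 * Lc)) with hρ
  have hρ0 : 0 < ρ := lt_min (by positivity) (by positivity)
  have hρ1 : ρ ≤ ρ₀ / 4 := min_le_left _ _
  have hρ2 : Lc * ρ ≤ ‖k₀‖ * T / 8 := by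
    have : ρ ≤ ‖k₀‖ * T / (8 * Lc) := min_le_right _ _
    rw [le_div_iff₀ (by positivity)] at this
    linarith
  have hzz := Metric.mem_ball_self (x := z) hρ₀
  have main : ∀ k', (k' = k₀ ∨ k' = -k₀) → ∀ᶠ n in (l : Filter ℕ), ∀ w ∈ Metric.ball z ρ, ¬ (Dom k' (vP P n w) ∧ Dom k' (vR A B P Q n (F w) w)) := by
    intro k' hk'
    have hkk : ‖k'‖ = ‖k₀‖ := by rcases hk' with h | h <;> simp [h]
    have hk'0 : k' ≠ 0 := by rcases hk' with h | h <;> simp [h, hk]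
    by_contra hcon
    push Not at hcon
    have hTp : 0 ≤ T := by positivity
    have hdu := dir_unit hk'0 hTp
    set e : ℂ := (T:ℂ) * (‖k'‖ / k') with he
    have hxb : z + e ∈ Metric.ball z ρ₀ := by rw [mem_ball_iff_norm, add_sub_cancel_left, hdu]; linarith
    have t1 := ((L.tp z hz).add (L.tr z hz _ (hFb z hzz).1)).add_const (‖k₀‖ * T)
    have t2 := (((c.tlg (CK k₀)).const_mul 2).add ((L.tp _ (hsub hxb)).add (L.tr _ (hsub hxb) _ (hFb _ hxb).1))).add_const (4 * (Lc * ρ))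
    rw [hpr z hzz] at t1
    rw [hpr _ hxb] at t2
    have := le_of_tendsto_of_tendsto t1 t2 (by
      filter_upwards [hcon, hg, hc] with n hn hg hc
      obtain ⟨w, hw, d1, d2⟩ := hn
      rw [mem_ball_iff_norm] at hw
      have hwb : w ∈ Metric.ball z ρ₀ := by rw [mem_ball_iff_norm]; linarith
      have hweb : w + e ∈ Metric.ball z ρ₀ := by
        rw [mem_ball_iff_norm]
        have := norm_add_le (w - z) e
        rw [hdu, ← add_sub_right_comm] at this
        linarith
      have sP : Sol n (bb A B H n) (VV A H G n) (Metric.ball z ρ₀) (vP P n) := c.solP hg.1 fun y hy => ⟨(hg.2 y hy).1, (hg.2 y hy).2.1⟩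
      have sR : Sol n (bb A B H n) (VV A H G n) (Metric.ball z ρ₀) (fun w => vR A B P Q n (F w) w) := c.solR hg.1 (fun y hy => (hg.2 y hy).2.1) hFb
      have P0 : ∀ y ∈ Metric.ball z ρ₀, vP P n y ≠ 0 := fun y hy => c.vP_ne hg.1 (hg.2 y hy).1 (hg.2 y hy).2.1
      have R0 : ∀ y ∈ Metric.ball z ρ₀, vR A B P Q n (F y) y ≠ 0 := fun y hy => c.vR_ne hg.1 (hg.2 y hy).1 (hg.2 y hy).2.1 (hFb y hy).1
      have cP := hc k' hk' _ sP P0 w hwb T hTp hweb d1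
      have cR := hc k' hk' _ sR R0 w hwb T hTp hweb d2
      rw [← he] at cP cR
      have lP := Sol.lip hg.1 hg.2 sP P0
      have lR := Sol.lip hg.1 hg.2 sR R0
      have b1 : (3 * M + 1) * ‖z - w‖ ≤ Lc * ρ := by rw [norm_sub_rev]; gcongr
      have b2 : (3 * M + 1) * ‖(w + e) - (z + e)‖ ≤ Lc * ρ := by rw [add_sub_add_right_eq_sub]; gcongr
      have q1 := (abs_le.1 ((lP z hzz w hwb).trans b1)).2
      have q2 := (abs_le.1 ((lP _ hweb _ hxb).trans b2)).2
      have q3 := (abs_le.1 ((lR z hzz w hwb).trans b1)).2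
      have q4 := (abs_le.1 ((lR _ hweb _ hxb).trans b2)).2
      linarith)
    have : 0 < ‖k₀‖ * T := by positivity
    linarith
  refine ⟨ρ, hρ0, max (3 / (2 * ‖k₀‖) * (2 * ‖F z‖ * M)) (20 * ‖k₀‖ * M / ‖F z‖), by positivity, ?_⟩
  filter_upwards [main k₀ (Or.inl rfl), main (-k₀) (Or.inr rfl), hg] with n h1 h2 hg w hw
  have hwb : w ∈ Metric.ball z ρ₀ := Metric.ball_subset_ball (by linarith) hw
  obtain ⟨a1, a2⟩ := alg2 hk (h1 w hw) (h2 w hw)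
  have heq : (vP P n w).1 * (vR A B P Q n (F w) w).1 = (P n).eval w * (F w * (Q n).eval w - (P n).eval w) := rfl
  rw [heq] at a1 a2
  have hdet := c.det hg.1 (hg.2 w hwb).1 (F w)
  obtain ⟨g1, g2, -, -, -, g3, g4⟩ := hg.2 w hwb
  have hdn : ‖Dt (vP P n w) (vR A B P Q n (F w) w)‖ = ‖F w‖ * ‖(H n).eval w / A.eval w‖ * (‖κ n‖ / n) := by
    rw [hdet]; simp only [norm_mul, norm_div, Complex.norm_natCast]; ring
  rw [hdn] at a1 a2
  obtain ⟨-, -, f1, f2⟩ := hs hwb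
  have hτ : 0 ≤ ‖κ n‖ / n := by positivity
  constructor
  · rw [div_le_iff₀ (by positivity)]
    have m1 : ‖F z‖ / 2 * M⁻¹ ≤ ‖F w‖ * ‖(H n).eval w / A.eval w‖ := mul_le_mul f1.le g3 (by positivity) (norm_nonneg _)
    have m2 := (mul_le_mul_of_nonneg_right m1 hτ).trans a2
    set S := ‖(P n).eval w * (F w * (Q n).eval w - (P n).eval w)‖
    have m3 : ‖κ n‖ / n ≤ S * (20 * ‖k₀‖ * M / ‖F z‖) := by
      rw [mul_div_assoc', le_div_iff₀ hFp]
      have : 0 < M := by linarith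
      have := mul_le_mul_of_nonneg_left m2 (by positivity : 0 ≤ 2 * M)
      have e : 2 * M * (‖F z‖ / 2 * M⁻¹ * (‖κ n‖ / n)) = ‖κ n‖ / n * ‖F z‖ := by field_simp
      rw [e] at this
      linarith
    exact m3.trans (mul_le_mul_of_nonneg_left (le_max_right _ _) (norm_nonneg _))
  · refine a1.trans ?_
    have m1 : ‖F w‖ * ‖(H n).eval w / A.eval w‖ ≤ 2 * ‖F z‖ * M := mul_le_mul f2.le g4 (norm_nonneg _) (by positivity)
    have m2 := mul_le_mul_of_nonneg_left (mul_le_mul_of_nonneg_right m1 hτ) (by positivity : 0 ≤ 3 / (2 * ‖k₀‖))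
    refine m2.trans ?_
    rw [← mul_assoc]
    exact mul_le_mul_of_nonneg_right (le_max_left _ _) hτ

end UC

lemma ball_diff_preconnected {E : Set ℂ} (hE : E.Finite) (z : ℂ) {ρ : ℝ} (hρ : 0 < ρ) : IsPreconnected (Metric.ball z ρ \ E) := by
  set e := OpenPartialHomeomorph.univBall z ρ with he
  have hs : e.source = Set.univ := OpenPartialHomeomorph.univBall_source z ρ
  have ht : e.target = Metric.ball z ρ := OpenPartialHomeomorph.univBall_target z hρ
  have hinj : Set.InjOn e Set.univ := by rw [← hs]; exact e.injOn
  have hpre : (e ⁻¹' E).Finite := hE.preimage (hinj.mono (Set.subset_univ _))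
  have : Metric.ball z ρ \ E = e '' (e ⁻¹' E)ᶜ := by
    ext w
    constructor
    · rintro ⟨h1, h2⟩
      rw [← ht] at h1
      refine ⟨e.symm w, ?_, e.right_inv h1⟩
      intro h3
      have h4 : e (e.symm w) ∈ E := h3
      rw [e.right_inv h1] at h4
      exact h2 h4
    · rintro ⟨x, hx, rfl⟩
      refine ⟨?_, hx⟩
      rw [← ht]
      exact e.map_source (by rw [hs]; trivial)
  rw [this]
  refine (compl_finite_connected hpre).isPreconnected.image _ ?_
  have := e.continuousOn
  rw [hs] at this
  exact this.mono (Set.subset_univ _)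

open Classical in
noncomputable def rcount (p : ℂ[X]) (z : ℂ) (ρ : ℝ) : ℕ := (p.roots.filter fun ζ => ζ ∈ Metric.ball z ρ).card

lemma rcount_mono (p : ℂ[X]) (z : ℂ) {ρ ρ' : ℝ} (h : ρ ≤ ρ') : rcount p z ρ ≤ rcount p z ρ' := by
  classical
  unfold rcount
  refine Multiset.card_le_card (Multiset.monotone_filter_right _ ?_)
  intro ζ hζ
  exact Metric.ball_subset_ball h hζ

lemma prod_low {s : Multiset ℂ} {w : ℂ} {t : ℝ} (ht : 0 ≤ t) (h : ∀ ζ ∈ s, t ≤ ‖w - ζ‖) : 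
    t ^ s.card ≤ ‖((s.map fun ζ => X - C ζ).prod).eval w‖ := by
  induction s using Multiset.induction with
  | empty => simp
  | cons a s ih =>
    rw [Multiset.map_cons, Multiset.prod_cons, eval_mul, norm_mul, Multiset.card_cons, pow_succ']
    have h1 := h a (Multiset.mem_cons_self a s)
    have h2 := ih fun ζ hζ => h ζ (Multiset.mem_cons_of_mem hζ)
    simp only [eval_sub, eval_X, eval_C]
    gcongr

lemma prod_up {s : Multiset ℂ} {w : ℂ} {t : ℝ} (ht : 0 ≤ t) (h : ∀ ζ ∈ s, ‖w - ζ‖ ≤ t) : 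
    ‖((s.map fun ζ => X - C ζ).prod).eval w‖ ≤ t ^ s.card := by
  induction s using Multiset.induction with
  | empty => simp
  | cons a s ih =>
    rw [Multiset.map_cons, Multiset.prod_cons, eval_mul, norm_mul, Multiset.card_cons, pow_succ']
    have h1 := h a (Multiset.mem_cons_self a s)
    have h2 := ih fun ζ hζ => h ζ (Multiset.mem_cons_of_mem hζ)
    simp only [eval_sub, eval_X, eval_C]
    gcongr

lemma count_bound {p : ℂ[X]} {R : ℂ → ℂ} {z₀ zs : ℂ} {ρ' ρ C τ : ℝ} (hp : p ≠ 0) (hρ : 0 < ρ) (hρ' : ρ < ρ') (hR : DifferentiableOn ℂ R (Metric.ball z₀ ρ'))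
    (hzs : ‖zs - z₀‖ = ρ / 4) (hτ : 0 < τ) (hC : 0 < C) (hup : ∀ w ∈ Metric.sphere z₀ ρ, ‖p.eval w * R w‖ ≤ C * τ)
    (hlo : τ / C ≤ ‖p.eval zs * R zs‖) : (7 / 3 : ℝ) ^ (rcount p z₀ (ρ / 8)) ≤ C ^ 2 := by
  classical
  set s := p.roots.filter fun ζ => ζ ∈ Metric.ball z₀ (ρ / 8) with hs
  have hm : rcount p z₀ (ρ / 8) = s.card := by rw [hs]; unfold rcount; congr
  rw [hm]
  have hdvd : ((s.map fun ζ => X - Polynomial.C ζ).prod) ∣ p := by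
    refine (Multiset.prod_dvd_prod_of_le (Multiset.map_le_map (Multiset.filter_le _ _))).trans (prod_multiset_X_sub_C_dvd p)
  obtain ⟨q, hq⟩ := hdvd
  have hsmem : ∀ ζ ∈ s, ‖ζ - z₀‖ < ρ / 8 := fun ζ hζ => mem_ball_iff_norm.1 (Multiset.mem_filter.1 hζ).2
  have hsph : ∀ w ∈ Metric.sphere z₀ ρ, ‖q.eval w * R w‖ ≤ C * τ / (7 * ρ / 8) ^ s.card := by
    intro w hw
    have h1 := prod_low (s := s) (w := w) (t := 7 * ρ / 8) (by positivity) (fun ζ hζ => by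
      have := hsmem ζ hζ
      have e := norm_sub_le_norm_sub_add_norm_sub w ζ z₀
      rw [mem_sphere_iff_norm.1 hw] at e
      linarith)
    rw [le_div_iff₀ (by positivity)]
    have h2 := hup w hw
    rw [hq, eval_mul, mul_assoc, norm_mul] at h2
    have := mul_le_mul_of_nonneg_right h1 (norm_nonneg (q.eval w * R w))
    linarith
  have hd : DiffContOnCl ℂ (fun w => q.eval w * R w) (Metric.ball z₀ ρ) := by
    apply DifferentiableOn.diffContOnCl
    rw [closure_ball z₀ hρ.ne']
    exact q.differentiable.differentiableOn.mul (hR.mono (Metric.closedBall_subset_ball hρ'))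
  have hmax := Complex.norm_le_of_forall_mem_frontier_norm_le Metric.isBounded_ball hd (C := C * τ / (7 * ρ / 8) ^ s.card) (z := zs)
    (by rw [frontier_ball z₀ hρ.ne']; exact hsph) (subset_closure (by rw [mem_ball_iff_norm]; linarith))
  have h3 := prod_up (s := s) (w := zs) (t := 3 * ρ / 8) (by positivity) (fun ζ hζ => by
      have := hsmem ζ hζ
      have e := norm_sub_le_norm_sub_add_norm_sub zs z₀ ζ
      rw [norm_sub_rev z₀ ζ] at e
      linarith)
  rw [hq, eval_mul, mul_assoc, norm_mul] at hlo
  have h4 := hlo.trans (mul_le_mul h3 hmax (norm_nonneg _) (by positivity))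
  rw [div_le_iff₀ hC] at h4
  have e : (3 * ρ / 8) ^ s.card * (C * τ / (7 * ρ / 8) ^ s.card) * C = C ^ 2 * τ / (7 / 3 : ℝ) ^ s.card := by
    rw [show 7 * ρ / 8 = (7 / 3) * (3 * ρ / 8) by ring, mul_pow]
    field_simp
  rw [e, le_div_iff₀ (by positivity)] at h4
  exact le_of_mul_le_mul_left (by linarith) hτ

namespace UC
variable {A B : ℂ[X]} {f : ℂ → ℂ} {R₀ : ℝ} {P Q H G : ℕ → ℂ[X]} {κ : ℕ → ℂ} {d : ℕ} {l : Ultrafilter ℕ} {Hi Gi : ℂ[X]}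
variable {zb : ℂ} {N pl : ℂ → ℝ} {r : ℂ → ℂ → ℝ} {k : ℝ}

lemma zero_count (c : UC A B f R₀ P Q H G κ d l Hi Gi) (L : Lims A B P Q κ l (EE A Hi) zb N pl r k) (hP : ∀ n, P n ≠ 0) {z₀ : ℂ} (hA : A.eval z₀ ≠ 0) {r₀ : ℝ} (hr₀ : 0 < r₀)
    (hN : ∀ z ∈ Metric.ball z₀ r₀, z ∉ EE A Hi → k / 2 < N z) : ∃ ρ > 0, ∃ M : ℕ, ∀ᶠ n in (l : Filter ℕ), rcount (P n) z₀ ρ ≤ M := by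
  have D := c.limData L (c.null L)
  have hGi := c.Gi_ne L
  obtain ⟨r₁, hr₁, hsub⟩ := Metric.mem_nhds_iff.1 (inter_mem (Metric.ball_mem_nhds z₀ hr₀) (A.continuous.continuousAt.eventually_ne hA))
  have hA1 : ∀ z ∈ Metric.ball z₀ r₁, A.eval z ≠ 0 := fun z hz => (hsub hz).2
  have hN1 : ∀ z ∈ Metric.ball z₀ r₁ \ EE A Hi, k / 2 < N z := fun z hz => hN z (hsub hz.1).1 hz.2
  set Z : Set ℂ := EE A Hi ∪ {z | Gi.eval z = 0} with hZ
  have hZf : Z.Finite := c.finE.union (Gi.finite_setOf_isRoot hGi)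
  -- radius
  obtain ⟨ρ, ⟨hρ0, hρ1⟩, hρZ⟩ : ∃ ρ ∈ Set.Ioo 0 r₁, ρ ∉ ((fun z => ‖z - z₀‖) '' Z ∪ (fun z => 4 * ‖z - z₀‖) '' Z) :=
    (Set.Ioo_infinite hr₁).exists_notMem_finite ((hZf.image _).union (hZf.image _))
  have hsph : ∀ w ∈ Metric.sphere z₀ ρ, w ∉ Z := fun w hw h => hρZ (Or.inl ⟨w, h, mem_sphere_iff_norm.1 hw⟩)
  set zs : ℂ := z₀ + (ρ / 4 : ℝ) with hzs
  have hzsn : ‖zs - z₀‖ = ρ / 4 := by rw [hzs, add_sub_cancel_left, Complex.norm_real, Real.norm_of_nonneg (by positivity)]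
  have hzsZ : zs ∉ Z := fun h => hρZ (Or.inr ⟨zs, h, by simp only [hzsn]; ring⟩)
  have hzsb : zs ∈ Metric.ball z₀ r₁ := by rw [mem_ball_iff_norm, hzsn]; linarith
  have hzsE : zs ∉ EE A Hi := fun h => hzsZ (Or.inl h)
  obtain ⟨φ, hφ, hφr⟩ := D.D_of_gt hzsE (hN1 zs ⟨hzsb, hzsE⟩)
  obtain ⟨F, hF, hFs⟩ := exists_branch (B := B) (w := zs) hA1 hφ
  have hU' : IsOpen (Metric.ball z₀ r₁ \ EE A Hi) := Metric.isOpen_ball.sdiff c.finE.isClosed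
  have hF' : Br A B F (Metric.ball z₀ r₁ \ EE A Hi) := hF.mono Set.diff_subset
  have cr : ∀ z ∈ Metric.ball z₀ r₁ \ EE A Hi, ContinuousAt (fun w => r w (F w)) z := fun z hz => D.contr _ F hU' (fun x hx => hx.2) hF' z hz
  have dom : ∀ z ∈ Metric.ball z₀ r₁ \ EE A Hi, r z (F z) < N z := by
    refine clopen_all (ball_diff_preconnected c.finE z₀ hr₁) (fun z hz hp => (cr z hz).eventually_lt (D.contN z hz.2) hp) ?_ ⟨hzsb, hzsE⟩ ?_
    · intro z hz hp
      have h1 := hN1 z hz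
      have h2 : k < N z + r z (F z) := by linarith
      filter_upwards [((D.contN z hz.2).add (cr z hz)).eventually_const_lt h2, hU'.mem_nhds hz] with w hw hwU hlt
      have := D.rlt hwU.2 (hF' w hwU).1 hlt
      simp only [Pi.add_apply] at hw
      linarith
    · rw [hFs, hφr]
      linarith [hN1 zs ⟨hzsb, hzsE⟩]
  have lp : ∀ z ∈ Metric.ball z₀ r₁, z ∉ Z → _ := fun z hz hzZ => 
    c.loc_prod L (z := z) (fun h => hzZ (Or.inl h)) (fun h => hzZ (Or.inr h)) Metric.isOpen_ball hz hF (dom z ⟨hz, fun h => hzZ (Or.inl h)⟩)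
  -- compactness of the sphere
  have hcomp : ∃ C > 0, ∀ᶠ n in (l : Filter ℕ), ∀ w ∈ Metric.sphere z₀ ρ, ‖(P n).eval w * (F w * (Q n).eval w - (P n).eval w)‖ ≤ C * (‖κ n‖ / n) := by
    refine (isCompact_sphere z₀ ρ).induction_on (p := fun S => ∃ C > 0, ∀ᶠ n in (l : Filter ℕ), ∀ w ∈ S, ‖(P n).eval w * (F w * (Q n).eval w - (P n).eval w)‖ ≤ C * (‖κ n‖ / n)) ?_ ?_ ?_ ?_
    · exact ⟨1, one_pos, by simp⟩
    · rintro S T hST ⟨C, hC, h⟩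
      exact ⟨C, hC, h.mono fun n hn w hw => hn w (hST hw)⟩
    · rintro S T ⟨C, hC, h⟩ ⟨C', hC', h'⟩
      refine ⟨max C C', by positivity, ?_⟩
      filter_upwards [h, h'] with n hn hn' w hw
      have hτ : 0 ≤ ‖κ n‖ / n := by positivity
      rcases hw with hw | hw
      · exact (hn w hw).trans (mul_le_mul_of_nonneg_right (le_max_left _ _) hτ)
      · exact (hn' w hw).trans (mul_le_mul_of_nonneg_right (le_max_right _ _) hτ)
    · intro w hw
      have hwb : w ∈ Metric.ball z₀ r₁ := by rw [mem_ball_iff_norm, mem_sphere_iff_norm.1 hw]; exact hρ1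
      obtain ⟨δ, hδ, C, hC, h⟩ := lp w hwb (hsph w hw)
      exact ⟨Metric.ball w δ, mem_nhdsWithin_of_mem_nhds (Metric.ball_mem_nhds w hδ), C, hC, h.mono fun n hn x hx => (hn x hx).2⟩
  obtain ⟨C, hC, hup⟩ := hcomp
  obtain ⟨δ, hδ, C', hC', hlo⟩ := lp zs hzsb hzsZ
  have hlim : Tendsto (fun m : ℕ => (7 / 3 : ℝ) ^ m) atTop atTop := tendsto_pow_atTop_atTop_of_one_lt (by norm_num)
  obtain ⟨M, hM⟩ := (hlim.eventually_gt_atTop ((max C C') ^ 2)).exists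
  refine ⟨ρ / 8, by positivity, M, ?_⟩
  filter_upwards [hup, hlo, c.ev1] with n h1 h2 hn
  have hn' : (1:ℝ) ≤ n := by exact_mod_cast hn
  have hτ : 0 < ‖κ n‖ / n := div_pos (norm_pos_iff.2 (c.hκ n hn)) (by linarith)
  have := count_bound (p := P n) (R := fun w => F w * (Q n).eval w - (P n).eval w) (C := max C C') (hP n) hρ0 hρ1 
    (fun w hw => (((hF w hw).2.2.differentiableAt.mul (Q n).differentiableAt).sub (P n).differentiableAt).differentiableWithinAt) hzsn hτ (by positivity)
    (fun w hw => (h1 w hw).trans (mul_le_mul_of_nonneg_right (le_max_left _ _) hτ.le))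
    (le_trans (by gcongr; exact le_max_right _ _) (h2 zs (Metric.mem_ball_self hδ)).1)
  by_contra hcon
  push Not at hcon
  have := pow_le_pow_right₀ (by norm_num : (1:ℝ) ≤ 7 / 3) hcon.le
  linarith

end UC

lemma Ctx.zero_count {A B : ℂ[X]} {f : ℂ → ℂ} {R₀ : ℝ} {P Q H G : ℕ → ℂ[X]} {κ : ℕ → ℂ} {d : ℕ} 
    (c : Ctx A B f R₀ P Q H G κ d) (hP : ∀ n, P n ≠ 0) : ∀ᵐ z₀ ∂(volume : Measure ℂ), A.eval z₀ ≠ 0 ∧ 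
      ∃ ρ > 0, ∃ M : ℕ, ∀ᶠ n in atTop, rcount (P n) z₀ ρ ≤ M := by
  obtain ⟨Hi, Gi, u⟩ := c.uc (hyperfilter ℕ) Nat.hyperfilter_le_atTop
  obtain ⟨zb, N, pl, r, k, L⟩ := u.exists_lims
  have D := u.limData L (u.null L)
  have n1 : ∀ᵐ z₀ ∂(volume : Measure ℂ), ¬ (z₀ ∉ EE A Hi ∧ N z₀ = k / 2) := by
    rw [ae_iff]
    simpa only [not_not] using u.null L
  have n2 : ∀ᵐ z₀ ∂(volume : Measure ℂ), z₀ ∉ EE A Hi := by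
    rw [ae_iff]
    simp only [not_not]
    exact u.finE.measure_zero _
  filter_upwards [n1, n2] with z₀ h1 h2
  have hA : A.eval z₀ ≠ 0 := fun h => h2 (Or.inl h)
  refine ⟨hA, ?_⟩
  have hlt : k / 2 < N z₀ := lt_of_le_of_ne (D.half h2) fun h => h1 ⟨h2, h.symm⟩
  obtain ⟨r₀, hr₀, hb⟩ := Metric.mem_nhds_iff.1 (inter_mem (u.openE.mem_nhds h2) ((D.contN z₀ h2).eventually_const_lt hlt))
  by_contra hcon
  push Not at hcon
  have hfr : ∀ j : ℕ, ∃ᶠ n in atTop, j < rcount (P n) z₀ (1 / ((j:ℝ) + 1)) := fun j => hcon _ (by positivity) j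
  obtain ⟨φ, hφ, hφ2⟩ := extraction_forall_of_frequently hfr
  set l : Ultrafilter ℕ := Ultrafilter.of (map φ atTop) with hl
  have hlm : (l : Filter ℕ) ≤ map φ atTop := Ultrafilter.of_le _
  have hla : (l : Filter ℕ) ≤ atTop := hlm.trans hφ.tendsto_atTop
  obtain ⟨Hi', Gi', u'⟩ := c.uc l hla
  obtain ⟨zb', N', pl', r', k', L'⟩ := u'.exists_lims
  have D' := u'.limData L' (u'.null L')
  obtain ⟨ρ, hρ, M, hM⟩ := u'.zero_count L' hP hA hr₀ (fun z hz hzE => by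
    have := uniq_lim D D' (hb hz).1 hzE
    have h3 : k / 2 < N z := (hb hz).2
    linarith)
  have h4 : ∀ᶠ j : ℕ in atTop, M < rcount (P (φ j)) z₀ ρ := by
    have t0 : Tendsto (fun j : ℕ => 1 / ((j:ℝ) + 1)) atTop (𝓝 0) := tendsto_one_div_add_atTop_nhds_zero_nat
    filter_upwards [t0.eventually_lt_const hρ, eventually_ge_atTop M] with j hj hjM
    exact (lt_of_le_of_lt hjM (hφ2 j)).trans_le (rcount_mono _ _ hj.le)
  have h5 : ∀ᶠ n in (l : Filter ℕ), M < rcount (P n) z₀ ρ := hlm (eventually_map.2 h4)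
  obtain ⟨n, hn1, hn2⟩ := (hM.and h5).exists
  omega

lemma poly_iteratedDeriv (p : ℂ[X]) (k : ℕ) :
    iteratedDeriv k (fun z : ℂ => p.eval z) = fun z => (derivative^[k] p).eval z := by
  induction k with
  | zero => simp
  | succ k ih =>
    rw [iteratedDeriv_succ, ih, Function.iterate_succ_apply']
    funext z
    exact (derivative^[k] p).deriv

lemma coeff_cauchy {p : ℂ[X]} {M : ℝ} (h : ∀ z ∈ Metric.closedBall (0:ℂ) 1, ‖p.eval z‖ ≤ M) (i : ℕ) :
    ‖p.coeff i‖ ≤ M := by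
  have h1 := Complex.norm_iteratedDeriv_le_of_forall_mem_sphere_norm_le (c := 0) (R := 1) (C := M) (f := fun z : ℂ => p.eval z) i one_pos
    p.differentiable.diffContOnCl (fun z hz => h z (Metric.sphere_subset_closedBall hz))
  rw [poly_iteratedDeriv] at h1
  simp only [one_pow, div_one] at h1
  rw [← coeff_zero_eq_eval_zero, coeff_iterate_derivative] at h1
  simp only [zero_add, Nat.descFactorial_self, nsmul_eq_mul, norm_mul, Complex.norm_natCast] at h1
  have : (0:ℝ) < (i.factorial : ℝ) := by exact_mod_cast i.factorial_pos
  exact le_of_mul_le_mul_left h1 this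

lemma poly_eq_far {p q : ℂ[X]} {R : ℝ} (h : ∀ z : ℂ, R < ‖z‖ → p.eval z = q.eval z) : p = q := by
  refine eq_of_infinite_eval_eq p q ?_
  refine Set.Infinite.mono (s := {z : ℂ | R < ‖z‖}) (fun z hz => h z hz) ?_
  have hinj : Function.Injective (fun k : ℕ => ((|R| + 1 + k : ℝ) : ℂ)) := by
    intro k l hkl
    have : (|R| + 1 + k : ℝ) = |R| + 1 + l := Complex.ofReal_injective hkl
    exact_mod_cast add_left_cancel this
  refine Set.infinite_of_injective_forall_mem hinj fun k => ?_
  change R < ‖((|R| + 1 + k : ℝ) : ℂ)‖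
  rw [Complex.norm_real, Real.norm_eq_abs, abs_of_nonneg (by positivity)]
  have := le_abs_self R
  have : (0:ℝ) ≤ k := by positivity
  linarith

lemma lagrange_bound {e : ℕ} {p : ℂ[X]} (hp : p.natDegree ≤ e) {x : ℕ → ℂ} {K : ℝ}
    (hx : ∀ i ∈ Finset.range (e + 1), ‖x i - 3 * i‖ ≤ 1) (hK : ∀ i ∈ Finset.range (e + 1), ‖p.eval (x i)‖ ≤ K) (i : ℕ) :
    ‖p.coeff i‖ ≤ (e + 1) * (K * (3 * e + 2) ^ e) := by
  have hK0 : 0 ≤ K := (norm_nonneg _).trans (hK 0 (by simp))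
  have hsep : ∀ i ∈ Finset.range (e + 1), ∀ j ∈ Finset.range (e + 1), i ≠ j → 1 ≤ ‖x i - x j‖ := by
    intro i hi j hj hij
    have h1 := hx i hi
    have h2 := hx j hj
    have h3 : (3:ℝ) ≤ ‖(3 * i - 3 * j : ℂ)‖ := by
      have : (3 * i - 3 * j : ℂ) = ((3 * (i - j : ℤ) : ℤ) : ℂ) := by push_cast; ring
      rw [this, Complex.norm_intCast]
      have : (3:ℤ) ≤ |3 * ((i:ℤ) - j)| := by
        rw [abs_mul]
        have : 1 ≤ |(i:ℤ) - j| := Int.one_le_abs (by omega)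
        norm_num; omega
      exact_mod_cast this
    have h4 : (3 * i - 3 * j : ℂ) = (x i - x j) - (x i - 3 * i) + (x j - 3 * j) := by ring
    rw [h4] at h3
    have h5 := norm_add_le ((x i - x j) - (x i - 3 * i)) (x j - 3 * j)
    have h6 := norm_sub_le (x i - x j) (x i - 3 * i)
    linarith
  have hinj : Set.InjOn x (Finset.range (e + 1)) := by
    intro i hi j hj hij
    by_contra hne
    have := hsep i hi j hj hne
    rw [hij] at this; norm_num at this
  have hdeg : p.degree < (Finset.range (e + 1)).card := by
    rw [Finset.card_range]
    refine (degree_le_natDegree).trans_lt ?_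
    exact_mod_cast Nat.lt_succ_of_le hp
  refine coeff_cauchy (fun z hz => ?_) i
  have hz1 : ‖z‖ ≤ 1 := by simpa using hz
  rw [Lagrange.eq_interpolate hinj hdeg, Lagrange.interpolate_apply, eval_finset_sum]
  refine (norm_sum_le _ _).trans ?_
  have : ∀ i ∈ Finset.range (e + 1), ‖(C (p.eval (x i)) * Lagrange.basis (Finset.range (e + 1)) x i).eval z‖ ≤ K * (3 * e + 2) ^ e := by
    intro i hi
    rw [eval_mul, eval_C, norm_mul]
    refine mul_le_mul (hK i hi) ?_ (norm_nonneg _) hK0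
    unfold Lagrange.basis
    rw [eval_prod, norm_prod]
    have hc : ((Finset.range (e + 1)).erase i).card = e := by
      rw [Finset.card_erase_of_mem hi]; simp
    conv_rhs => rw [← hc]
    rw [← Finset.prod_const]
    refine Finset.prod_le_prod (fun _ _ => norm_nonneg _) fun j hj => ?_
    obtain ⟨hj1, hj2⟩ := Finset.mem_erase.1 hj
    unfold Lagrange.basisDivisor
    simp only [eval_mul, eval_C, eval_sub, eval_X, norm_mul, norm_inv]
    rw [hc]
    have h1 := hsep i hi j hj2 (Ne.symm hj1)
    have h2 : ‖x i - x j‖⁻¹ ≤ 1 := inv_le_one_of_one_le₀ h1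
    have h3 : ‖z - x j‖ ≤ 3 * e + 2 := by
      have e1 : z - x j = z - (x j - 3 * j) - 3 * j := by ring
      rw [e1]
      have e2 := norm_sub_le (z - (x j - 3 * j)) (3 * j)
      have e3 := norm_sub_le z (x j - 3 * j)
      have e4 : ‖(3 * j : ℂ)‖ = 3 * j := by simp
      have e5 : (j : ℝ) ≤ e := by exact_mod_cast Nat.lt_succ_iff.1 (Finset.mem_range.1 hj2)
      have := hx j hj2
      linarith
    calc ‖x i - x j‖⁻¹ * ‖z - x j‖ ≤ 1 * (3 * e + 2) := by gcongr
      _ = 3 * e + 2 := one_mul _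
  refine (Finset.sum_le_sum this).trans ?_
  simp

lemma bern {p : ℂ[X]} (hp0 : p ≠ 0) {n : ℕ} (hn : 1 ≤ n) (hp : p.natDegree ≤ n) (zb : ℂ) :
    ∃ z, ‖z - zb‖ ≤ 1 ∧ p.eval z ≠ 0 ∧ ‖(derivative p).eval z‖ ≤ 6 * n * ‖p.eval z‖ ∧
      ‖(derivative (derivative p)).eval z‖ ≤ 6 * n ^ 2 * ‖p.eval z‖ := by
  obtain ⟨z, hz, hmax⟩ := (isCompact_closedBall zb 1).exists_isMaxOn ⟨zb, by simp⟩
    (f := fun z : ℂ => ‖p.eval z‖) p.continuous.norm.continuousOn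
  have hM : ∀ w ∈ Metric.closedBall zb 1, ‖p.eval w‖ ≤ ‖p.eval z‖ := fun w hw => hmax hw
  have hz1 : ‖z - zb‖ ≤ 1 := mem_closedBall_iff_norm.1 hz
  have hn0 : (0:ℝ) < n := by exact_mod_cast hn
  have hne : p.eval z ≠ 0 := by
    intro h0
    apply hp0
    refine eq_of_infinite_eval_eq p 0 ?_
    refine Set.Infinite.mono (s := Metric.closedBall zb 1) (fun w hw => ?_) ?_
    · have := hM w hw
      rw [h0, norm_zero] at this
      simpa using this
    · exact infinite_of_mem_nhds zb (Metric.closedBall_mem_nhds zb one_pos)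
  have hb : ∀ w ∈ Metric.sphere z (1 / n : ℝ), ‖p.eval w‖ ≤ 3 * ‖p.eval z‖ := by
    intro w hw
    rcases le_total ‖w - zb‖ 1 with h | h
    · have := hM w (mem_closedBall_iff_norm.2 h)
      have := norm_nonneg (p.eval z)
      linarith
    · refine (bw hp one_pos hM h).trans ?_
      rw [mul_comm]
      refine mul_le_mul_of_nonneg_right ?_ (norm_nonneg _)
      have h1 : ‖w - zb‖ ≤ 1 / n + 1 := by
        have := norm_sub_le_norm_sub_add_norm_sub w z zb
        rw [mem_sphere_iff_norm.1 hw] at this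
        linarith
      calc (‖w - zb‖ / 1) ^ n ≤ (1 / n + 1) ^ n := by rw [div_one]; gcongr
        _ ≤ (Real.exp (1 / n)) ^ n := by gcongr; exact Real.add_one_le_exp _
        _ = Real.exp 1 := by rw [← Real.exp_nat_mul]; congr 1; field_simp
        _ ≤ 3 := by have := Real.exp_one_lt_d9; linarith
  have hc : ∀ k, ‖(derivative^[k] p).eval z‖ ≤ k.factorial * (3 * ‖p.eval z‖) / (1 / n) ^ k := by
    intro k
    have h1 := Complex.norm_iteratedDeriv_le_of_forall_mem_sphere_norm_le (c := z) (R := (1 / n : ℝ)) (f := fun z : ℂ => p.eval z) k (by positivity)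
      p.differentiable.diffContOnCl hb
    rwa [poly_iteratedDeriv] at h1
  refine ⟨z, hz1, hne, ?_, ?_⟩
  · have h := hc 1
    simp only [Function.iterate_one, Nat.factorial_one, Nat.cast_one, one_mul, pow_one] at h
    refine h.trans ?_
    rw [div_div_eq_mul_div, div_one]
    nlinarith [mul_nonneg hn0.le (norm_nonneg (p.eval z))]
  · have h := hc 2
    change ‖(derivative (derivative p)).eval z‖ ≤ _ at h
    refine h.trans (le_of_eq ?_)
    simp only [Nat.factorial_two]
    field_simp
    push_cast; ring

lemma HX_aux {H Y : ℂ[X]} (hH : H.Monic) (hY : Y ≠ 0) (h : H * derivative Y = derivative H * Y) : Y.natDegree = H.natDegree := by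
  set d := H.natDegree with hd
  set m := Y.natDegree with hm
  rcases Nat.eq_zero_or_pos m with h0 | h0
  · have : derivative Y = 0 := derivative_of_natDegree_zero (hm ▸ h0)
    rw [this, mul_zero] at h
    have h1 : derivative H = 0 := by
      rcases mul_eq_zero.1 h.symm with h | h
      · exact h
      · exact absurd h hY
    rw [h0, hd, natDegree_eq_zero_of_derivative_eq_zero h1]
  rcases Nat.eq_zero_or_pos d with h1 | h1
  · have h2 : derivative H = 0 := derivative_of_natDegree_zero (hd ▸ h1)
    rw [h2, zero_mul] at h
    have h3 : derivative Y = 0 := by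
      rcases mul_eq_zero.1 h with h | h
      · exact absurd h hH.ne_zero
      · exact h
    rw [h1, hm, natDegree_eq_zero_of_derivative_eq_zero h3]
  have e1 := coeff_mul_add_eq_of_natDegree_le (f := H) (g := derivative Y) (df := d) (dg := m - 1) le_rfl (natDegree_derivative_le Y)
  have e2 := coeff_mul_add_eq_of_natDegree_le (f := derivative H) (g := Y) (df := d - 1) (dg := m) (natDegree_derivative_le H) le_rfl
  have e3 : d + (m - 1) = d - 1 + m := by omega
  rw [h, e3, e2] at e1
  simp only [coeff_derivative] at e1
  rw [Nat.sub_add_cancel h0, Nat.sub_add_cancel h1] at e1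
  have hH1 : H.coeff d = 1 := hH
  have hY1 : Y.coeff m ≠ 0 := by
    have := leadingCoeff_ne_zero.2 hY; exact this
  rw [hH1, one_mul, one_mul, mul_comm] at e1
  have e4 := mul_left_cancel₀ hY1 e1
  have e5 : ((d - 1 + 1 : ℕ) : ℂ) = ((m - 1 + 1 : ℕ) : ℂ) := by push_cast; exact e4
  have e6 : d - 1 + 1 = m - 1 + 1 := by exact_mod_cast e5
  omega

lemma HX {H Y : ℂ[X]} (hH : H.Monic) (h : H * derivative Y = derivative H * Y) : ∃ κ : ℂ, Y = C κ * H := by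
  refine ⟨Y.coeff H.natDegree, ?_⟩
  by_contra hne
  have h1 : Y - C (Y.coeff H.natDegree) * H ≠ 0 := sub_ne_zero.2 hne
  have h2 := HX_aux hH h1 (by simp only [derivative_sub, derivative_mul, derivative_C]; linear_combination h)
  have h3 : (Y - C (Y.coeff H.natDegree) * H).coeff H.natDegree = 0 := by
    have : H.coeff H.natDegree = 1 := hH
    simp [this]
  have h4 := leadingCoeff_ne_zero.2 h1
  apply h4
  rw [leadingCoeff, h2, h3]

lemma nobr_core {A B A1 B1 : ℂ[X]} {a0 α : ℂ} (hα : ∀ m : ℤ, α ≠ (m : ℂ)) (hA : A = (X - C a0) * A1) (h1 : A1.eval a0 ≠ 0)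
    (hB : B = C α * A1 + (X - C a0) * B1) {E : Set ℂ} (hE : E.Finite) {F : ℂ → ℂ} (hF : Br A B F Eᶜ) : False := by
  have hev : ∀ᶠ z in 𝓝 a0, A1.eval z ≠ 0 ∧ (z ≠ a0 → z ∈ Eᶜ) := by
    refine (A1.continuous.continuousAt.eventually_ne h1).and ?_
    have : (E \ {a0})ᶜ ∈ 𝓝 a0 := (hE.sdiff (t := {a0})).isClosed.isOpen_compl.mem_nhds (by simp)
    filter_upwards [this] with z hz hne hzE
    exact hz ⟨hzE, hne⟩
  obtain ⟨ρ, hρ, hball⟩ := Metric.eventually_nhds_iff_ball.1 hev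
  obtain ⟨k, hk, -⟩ := exists_branch (A := A1) (B := B1) (c := a0) (ρ := ρ) (w := a0) (fun z hz => (hball z hz).1) one_ne_zero
  set U : Set ℂ := {w | w.re < Real.log ρ} with hU
  have hUo : IsOpen U := isOpen_lt Complex.continuous_re continuous_const
  have hUc : IsPreconnected U := (convex_halfSpace_re_lt _).isPreconnected
  have hmem : ∀ w ∈ U, a0 + Complex.exp w ∈ Metric.ball a0 ρ := by
    intro w hw
    have hw' : w.re < Real.log ρ := hw
    rw [mem_ball_iff_norm, add_sub_cancel_left, Complex.norm_exp]
    rw [← Real.exp_log hρ]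
    exact Real.exp_lt_exp.2 hw'
  have hd : ∀ w ∈ U, HasDerivAt (fun w => F (a0 + Complex.exp w) * Complex.exp (-α * w) / k (a0 + Complex.exp w)) 0 w := by
    intro w hw
    have hne : a0 + Complex.exp w ≠ a0 := by simp [Complex.exp_ne_zero]
    obtain ⟨f1, f2, f3⟩ := hF _ ((hball _ (hmem w hw)).2 hne)
    obtain ⟨k1, k2, k3⟩ := hk _ (hmem w hw)
    have he : HasDerivAt (fun w => a0 + Complex.exp w) (Complex.exp w) w := (Complex.hasDerivAt_exp w).const_add a0
    have g1 := f3.comp w he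
    have g2 := k3.comp w he
    have g3 : HasDerivAt (fun w => Complex.exp (-α * w)) (Complex.exp (-α * w) * (-α)) w := by
      have := ((hasDerivAt_id w).const_mul (-α)).cexp
      simpa using this
    have g4 := (g1.mul g3).div g2 k1
    refine g4.congr_deriv ?_
    simp only [Function.comp_apply, Pi.mul_apply]
    rw [div_eq_zero_iff]; left
    subst hA hB
    simp only [eval_mul, eval_add, eval_sub, eval_X, eval_C, add_sub_cancel_left]
    have := Complex.exp_ne_zero w
    field_simp
    ring
  have hw0 : ((Real.log ρ - 1 : ℝ) : ℂ) ∈ U := by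
    change (((Real.log ρ - 1 : ℝ) : ℂ)).re < _
    rw [Complex.ofReal_re]; linarith
  set w0 : ℂ := ((Real.log ρ - 1 : ℝ) : ℂ)
  have hw1 : w0 + 2 * Real.pi * Complex.I ∈ U := by
    change (w0 + 2 * Real.pi * Complex.I).re < _
    have : w0.re < Real.log ρ := hw0
    simpa using this
  have hc := hUo.is_const_of_deriv_eq_zero hUc (fun w hw => (hd w hw).differentiableAt.differentiableWithinAt)
    (fun w hw => (hd w hw).deriv) hw0 hw1
  have hexp : Complex.exp (w0 + 2 * Real.pi * Complex.I) = Complex.exp w0 := Complex.exp_periodic w0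
  simp only [hexp] at hc
  have hne : a0 + Complex.exp w0 ≠ a0 := by simp [Complex.exp_ne_zero]
  have f1 := (hF _ ((hball _ (hmem w0 hw0)).2 hne)).1
  have k1 := (hk _ (hmem w0 hw0)).1
  rw [div_left_inj' k1] at hc
  have hc2 := mul_left_cancel₀ f1 hc
  obtain ⟨n, hn⟩ := Complex.exp_eq_exp_iff_exists_int.1 hc2
  apply hα n
  have hpi : (2 * Real.pi * Complex.I : ℂ) ≠ 0 := Complex.two_pi_I_ne_zero
  have : (α - n) * (2 * Real.pi * Complex.I) = 0 := by linear_combination hn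
  rcases mul_eq_zero.1 this with h | h
  · exact sub_eq_zero.1 h
  · exact absurd h hpi

lemma nobr_main {p : ℕ} (hp : 2 ≤ p) {a : Fin p → ℂ} (ha : Function.Injective a)
    {α : Fin p → ℂ} (hα : ∀ j, ∀ m : ℤ, α j ≠ (m : ℂ)) {A B : ℂ[X]}
    (hA : A = ∏ j, (X - C (a j)))
    (hB : B = ∑ j, C (α j) * ∏ i ∈ Finset.univ.erase j, (X - C (a i))) (E : Set ℂ) (hE : E.Finite) (F : ℂ → ℂ) : ¬ Br A B F Eᶜ := by
  intro hF
  set j0 : Fin p := ⟨0, by omega⟩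
  set A1 : ℂ[X] := ∏ i ∈ Finset.univ.erase j0, (X - C (a i)) with hA1
  have hdvd : (X - C (a j0)) ∣ B - C (α j0) * A1 := by
    rw [hB, ← Finset.add_sum_erase _ _ (Finset.mem_univ j0), add_sub_cancel_left]
    refine Finset.dvd_sum fun j hj => ?_
    refine Dvd.dvd.mul_left ?_ _
    exact Finset.dvd_prod_of_mem (fun i => X - C (a i)) (Finset.mem_erase.2 ⟨(Finset.mem_erase.1 hj).1.symm, Finset.mem_univ _⟩)
  obtain ⟨B1, hB1⟩ := hdvd
  refine nobr_core (a0 := a j0) (A1 := A1) (B1 := B1) (hα j0) ?_ ?_ ?_ hE hF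
  · rw [hA, hA1, Finset.mul_prod_erase _ (fun i => X - C (a i)) (Finset.mem_univ j0)]
  · rw [hA1, eval_prod, Finset.prod_ne_zero_iff]
    intro i hi
    simp only [eval_sub, eval_X, eval_C]
    exact sub_ne_zero.2 fun h => (Finset.mem_erase.1 hi).1 (ha h).symm
  · linear_combination hB1

lemma ode1_of {A B P H G : ℂ[X]} {N : ℂ} {R : ℝ}
    (h : ∀ z : ℂ, R < ‖z‖ → A.eval z * H.eval z * iteratedDeriv 2 (fun z => P.eval z) z
          + (((A.derivative - B) * H).eval z - (A * H.derivative).eval z) * deriv (fun z => P.eval z) z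
          - N * G.eval z * P.eval z = 0) :
    A * H * derivative (derivative P) + ((derivative A - B) * H - A * derivative H) * derivative P = C N * G * P := by
  refine poly_eq_far (R := R) fun z hz => ?_
  have h1 := h z hz
  rw [poly_iteratedDeriv, Polynomial.deriv] at h1
  change _ * (derivative (derivative P)).eval z + _ - _ = _ at h1
  simp only [eval_add, eval_mul, eval_sub, eval_C] at h1 ⊢
  linear_combination h1

lemma ode2_of {A B Q H G : ℂ[X]} {f : ℂ → ℂ} {N : ℂ} {R : ℝ} (hf : Br A B f {z | R < ‖z‖})
    (h : ∀ z : ℂ, R < ‖z‖ → A.eval z * H.eval z * iteratedDeriv 2 (fun z => Q.eval z * f z) z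
          + (((A.derivative - B) * H).eval z - (A * H.derivative).eval z) * deriv (fun z => Q.eval z * f z) z
          - N * G.eval z * (Q.eval z * f z) = 0) :
    A * H * derivative (derivative Q) + ((derivative A + B) * H - A * derivative H) * derivative Q
      + (H * derivative B - derivative H * B) * Q = C N * G * Q := by
  refine poly_eq_far (R := R) fun z hz => ?_
  have h1 := h z hz
  have hd1 : ∀ y : ℂ, R < ‖y‖ → HasDerivAt (fun z => Q.eval z * f z)
      (((derivative Q).eval y + Q.eval y * B.eval y / A.eval y) * f y) y := by
    intro y hy
    obtain ⟨f1, f2, f3⟩ := hf y hy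
    exact ((Q.hasDerivAt y).mul f3).congr_deriv (by ring)
  have ho : IsOpen {y : ℂ | R < ‖y‖} := isOpen_lt continuous_const continuous_norm
  have hev : deriv (fun z => Q.eval z * f z) =ᶠ[𝓝 z] fun y => ((derivative Q).eval y + Q.eval y * B.eval y / A.eval y) * f y := by
    filter_upwards [ho.mem_nhds hz] with y hy
    exact (hd1 y hy).deriv
  obtain ⟨f1, f2, f3⟩ := hf z hz
  have hd2 := (((derivative Q).hasDerivAt z).add (((Q.hasDerivAt z).mul (B.hasDerivAt z)).div (A.hasDerivAt z) f2)).mul f3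
  have hd3 := hev.deriv_eq.trans hd2.deriv
  rw [iteratedDeriv_succ, iteratedDeriv_one, hd3, (hd1 z hz).deriv] at h1
  simp only [Pi.add_apply, Pi.mul_apply, Pi.div_apply] at h1
  simp only [eval_add, eval_mul, eval_sub, eval_C] at h1 ⊢
  apply mul_right_cancel₀ f1
  field_simp at h1
  apply mul_left_cancel₀ f2
  linear_combination h1

lemma wr_of {A B P Q H G : ℂ[X]} {N : ℂ} (hH : H.Monic)
    (o1 : A * H * derivative (derivative P) + ((derivative A - B) * H - A * derivative H) * derivative P = C N * G * P)
    (o2 : A * H * derivative (derivative Q) + ((derivative A + B) * H - A * derivative H) * derivative Q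
      + (H * derivative B - derivative H * B) * Q = C N * G * Q) :
    ∃ κ : ℂ, A * (P * derivative Q - derivative P * Q) + B * P * Q = C κ * H := by
  refine HX hH ?_
  simp only [derivative_add, derivative_mul, derivative_sub]
  linear_combination P * o2 - Q * o1

lemma kappa_ne {A B P Q : ℂ[X]} (hA : A ≠ 0) (hP : P ≠ 0) (hQ : Q ≠ 0) (hno : ∀ E : Set ℂ, E.Finite → ∀ F, ¬ Br A B F Eᶜ) :
    A * (P * derivative Q - derivative P * Q) + B * P * Q ≠ 0 := by
  intro h
  refine hno {z | (A * P * Q).eval z = 0} ?_ (fun z => P.eval z / Q.eval z) ?_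
  · exact (A * P * Q).finite_setOf_isRoot (mul_ne_zero (mul_ne_zero hA hP) hQ)
  · intro z hz
    have hz' : (A * P * Q).eval z ≠ 0 := hz
    simp only [eval_mul, mul_ne_zero_iff] at hz'
    obtain ⟨⟨h1, h2⟩, h3⟩ := hz'
    refine ⟨div_ne_zero h2 h3, h1, ((P.hasDerivAt z).div (Q.hasDerivAt z) h3).congr_deriv ?_⟩
    have h4 := congrArg (eval z) h
    simp only [eval_add, eval_mul, eval_sub, eval_zero] at h4
    field_simp
    linear_combination -h4

lemma H_eval_bd {H : ℂ[X]} {d : ℕ} (hd : H.natDegree ≤ d) (h1 : ∑ i ∈ Finset.range (d + 1), ‖H.coeff i‖ = 1) {T : ℝ} (hT : 1 ≤ T)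
    {z : ℂ} (hz : ‖z‖ ≤ T) : ‖H.eval z‖ ≤ T ^ d ∧ ‖(derivative H).eval z‖ ≤ d * T ^ d := by
  constructor
  · rw [eval_eq_sum_range' (Nat.lt_succ_of_le hd)]
    calc _ ≤ ∑ i ∈ Finset.range (d + 1), ‖H.coeff i * z ^ i‖ := norm_sum_le _ _
      _ ≤ ∑ i ∈ Finset.range (d + 1), ‖H.coeff i‖ * T ^ d := by
          refine Finset.sum_le_sum fun i hi => ?_
          rw [norm_mul, norm_pow]
          refine mul_le_mul_of_nonneg_left ?_ (norm_nonneg _)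
          exact (pow_le_pow_left₀ (norm_nonneg _) hz _).trans (pow_le_pow_right₀ hT (Nat.lt_succ_iff.1 (Finset.mem_range.1 hi)))
      _ = T ^ d := by rw [← Finset.sum_mul, h1, one_mul]
  · have hs : (derivative H).eval z = ∑ i ∈ Finset.range (d + 1), H.coeff i * i * z ^ (i - 1) := by
      rw [derivative_eval, Polynomial.sum_over_range' _ _ (d + 1) (Nat.lt_succ_of_le hd)]
      intro n; simp
    rw [hs]
    calc _ ≤ ∑ i ∈ Finset.range (d + 1), ‖H.coeff i * i * z ^ (i - 1)‖ := norm_sum_le _ _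
      _ ≤ ∑ i ∈ Finset.range (d + 1), ‖H.coeff i‖ * (d * T ^ d) := by
          refine Finset.sum_le_sum fun i hi => ?_
          have hi' := Nat.lt_succ_iff.1 (Finset.mem_range.1 hi)
          rw [norm_mul, norm_mul, norm_pow, Complex.norm_natCast, mul_assoc]
          refine mul_le_mul_of_nonneg_left ?_ (norm_nonneg _)
          refine mul_le_mul (by exact_mod_cast hi') ?_ (by positivity) (by positivity)
          exact (pow_le_pow_left₀ (norm_nonneg _) hz _).trans (pow_le_pow_right₀ hT (by omega))
      _ = d * T ^ d := by rw [← Finset.sum_mul, h1, one_mul]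

lemma poly_bd (p : ℂ[X]) (T : ℝ) : ∃ K : ℝ, 0 ≤ K ∧ ∀ z : ℂ, ‖z‖ ≤ T → ‖p.eval z‖ ≤ K := by
  obtain ⟨K, hK⟩ := (isCompact_closedBall (0:ℂ) T).exists_bound_of_continuousOn (f := fun z => p.eval z) p.continuous.continuousOn
  exact ⟨max K 0, le_max_right _ _, fun z hz => (hK z (by simpa using hz)).trans (le_max_left _ _)⟩

lemma G_bound (A B : ℂ[X]) (d e : ℕ) : ∃ K : ℝ, ∀ n : ℕ, 1 ≤ n → ∀ P H G : ℂ[X], P ≠ 0 → P.natDegree ≤ n → H.natDegree ≤ d →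
    ∑ i ∈ Finset.range (d + 1), ‖H.coeff i‖ = 1 → G.natDegree ≤ e →
    A * H * derivative (derivative P) + ((derivative A - B) * H - A * derivative H) * derivative P
      = (n : ℂ[X]) * ((n : ℂ[X]) + 1) * G * P → ∀ i, ‖G.coeff i‖ ≤ K := by
  set T : ℝ := 3 * e + 1 with hT
  have hT1 : 1 ≤ T := by rw [hT]; linarith [(Nat.cast_nonneg e : (0:ℝ) ≤ e)]
  obtain ⟨KA, hKA0, hKA⟩ := poly_bd A T
  obtain ⟨KD, hKD0, hKD⟩ := poly_bd (derivative A - B) T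
  set L : ℝ := 6 * (KA * T ^ d + KD * T ^ d + KA * (d * T ^ d)) with hL
  refine ⟨(e + 1) * (L * (3 * e + 2) ^ e), fun n hn P H G hP hdP hdH hH hdG hode i => ?_⟩
  have hb := fun i : ℕ => bern hP hn hdP (3 * i)
  choose x hx1 hx2 hx3 hx4 using hb
  refine lagrange_bound hdG (x := x) (fun i _ => hx1 i) (fun i hi => ?_) i
  have hxT : ‖x i‖ ≤ T := by
    have e1 : x i = (x i - 3 * i) + 3 * i := by ring
    have e2 : ‖(3 * i : ℂ)‖ = 3 * i := by simp
    have e3 : (i : ℝ) ≤ e := by exact_mod_cast Nat.lt_succ_iff.1 (Finset.mem_range.1 hi)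
    have e4 := norm_add_le (x i - 3 * i) (3 * i)
    rw [← e1, e2] at e4
    have := hx1 i
    rw [hT]; linarith
  obtain ⟨b1, b2⟩ := H_eval_bd hdH hH hT1 hxT
  have b3 := hKA _ hxT
  have b4 := hKD _ hxT
  have ho := congrArg (eval (x i)) hode
  simp only [eval_add, eval_mul, eval_natCast, eval_one] at ho
  rw [eval_sub, eval_mul, eval_mul] at ho
  set u := P.eval (x i)
  set y := x i
  have hn0 : (1:ℝ) ≤ n := by exact_mod_cast hn
  have hu : 0 < ‖u‖ := norm_pos_iff.2 (hx2 i)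
  have hTd : 0 ≤ T ^ d := by positivity
  have h1 : ‖A.eval y * H.eval y * (derivative (derivative P)).eval y‖ ≤ KA * T ^ d * (6 * n ^ 2 * ‖u‖) := by
    rw [norm_mul, norm_mul]
    have := hx4 i
    gcongr
  have h2 : ‖((derivative A - B).eval y * H.eval y - A.eval y * (derivative H).eval y) * (derivative P).eval y‖
      ≤ (KD * T ^ d + KA * (d * T ^ d)) * (6 * n * ‖u‖) := by
    rw [norm_mul]
    have := hx3 i
    have h : ‖(derivative A - B).eval y * H.eval y - A.eval y * (derivative H).eval y‖ ≤ KD * T ^ d + KA * (d * T ^ d) := by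
      refine (norm_sub_le _ _).trans ?_
      rw [norm_mul, norm_mul]
      gcongr
    gcongr
  have h3 : ‖(n:ℂ) * ((n:ℂ) + 1) * G.eval y * u‖ = n * (n + 1) * ‖G.eval y‖ * ‖u‖ := by
    rw [norm_mul, norm_mul, norm_mul, Complex.norm_natCast]
    congr 3
    have : ((n:ℂ) + 1) = ((n + 1 : ℕ) : ℂ) := by push_cast; rfl
    rw [this, Complex.norm_natCast]; push_cast; rfl
  have h4 := norm_add_le (A.eval y * H.eval y * (derivative (derivative P)).eval y)
    (((derivative A - B).eval y * H.eval y - A.eval y * (derivative H).eval y) * (derivative P).eval y)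
  rw [ho, h3] at h4
  have hW : 0 ≤ KD * T ^ d + KA * (d * T ^ d) := by positivity
  have h5 : n * (n + 1) * ‖G.eval y‖ * ‖u‖ ≤ n * (n + 1) * L * ‖u‖ := by
    refine h4.trans ((add_le_add h1 h2).trans ?_)
    have e1 : KA * T ^ d * (6 * n ^ 2 * ‖u‖) ≤ KA * T ^ d * (6 * (n * (n + 1)) * ‖u‖) := by
      gcongr; nlinarith
    have e2 : (KD * T ^ d + KA * (d * T ^ d)) * (6 * n * ‖u‖) ≤ (KD * T ^ d + KA * (d * T ^ d)) * (6 * (n * (n + 1)) * ‖u‖) := by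
      gcongr; nlinarith
    refine (add_le_add e1 e2).trans (le_of_eq ?_)
    rw [hL]; ring
  have h6 := le_of_mul_le_mul_right h5 hu
  exact le_of_mul_le_mul_left h6 (by positivity)

theorem mkCtx (p : ℕ) (hp : 2 ≤ p) (a : Fin p → ℂ) (ha : Function.Injective a)
    (α : Fin p → ℂ) (hα : ∀ j, ∀ m : ℤ, α j ≠ (m : ℂ))
    (A B : Polynomial ℂ)
    (hA : A = ∏ j, (X - C (a j)))
    (hB : B = ∑ j, C (α j) * ∏ i ∈ Finset.univ.erase j, (X - C (a i)))
    (f : ℂ → ℂ) (R₀ : ℝ) (hR : ∀ j, ‖a j‖ < R₀)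
    (hfd : DifferentiableOn ℂ f {z : ℂ | R₀ < ‖z‖})
    (hf1 : Tendsto f (cobounded ℂ) (𝓝 1))
    (hfp : ∀ z ∈ {z : ℂ | R₀ < ‖z‖}, A.eval z * deriv f z = B.eval z * f z)
    (P Q : ℕ → Polynomial ℂ)
    (hP0 : ∀ n, P n ≠ 0) (hQ0 : ∀ n, Q n ≠ 0)
    (hdegP : ∀ n, (P n).natDegree = n) (hdegQ : ∀ n, (Q n).natDegree = n)
    (hnormal : ∀ n, ∃ M : ℂ, M ≠ 0 ∧
      Tendsto (fun z : ℂ => z ^ (n + 1) * ((Q n).eval z * f z - (P n).eval z))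
        (cobounded ℂ) (𝓝 M))
    (H Cn : ℕ → Polynomial ℂ)
    (hH : ∀ n, (H n).Monic ∧ (H n).natDegree = p - 2)
    (hC : ∀ n, (Cn n).Monic ∧ (Cn n).natDegree = 2 * p - 4)
    (hODE : ∀ n, ∀ w : ℂ → ℂ,
      ((w = fun z => (P n).eval z) ∨ (w = fun z => (Q n).eval z * f z) ∨
        (w = fun z => (Q n).eval z * f z - (P n).eval z)) →
      ∀ z ∈ {z : ℂ | R₀ < ‖z‖},
        A.eval z * (H n).eval z * iteratedDeriv 2 w z
          + (((A.derivative - B) * H n).eval z - (A * (H n).derivative).eval z) * deriv w z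
          - (n : ℂ) * ((n : ℂ) + 1) * (Cn n).eval z * w z = 0) :
    ∃ (R₁ : ℝ) (t : ℕ → ℂ) (κ : ℕ → ℂ), (∀ n, t n ≠ 0) ∧
      Ctx A B f R₁ P Q (fun n => C (t n) * H n) (fun n => C (t n) * Cn n) κ (p - 2) := by
  have hA0 : A ≠ 0 := by
    rw [hA, Finset.prod_ne_zero_iff]
    exact fun i _ => X_sub_C_ne_zero _
  have hno := nobr_main hp ha hα hA hB
  obtain ⟨R₂, hR₂⟩ : ∃ R₂ : ℝ, ∀ z : ℂ, R₂ < ‖z‖ → ‖f z - 1‖ ≤ 1 / 2 := by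
    have h1 : ∀ᶠ z in cobounded ℂ, ‖f z - 1‖ < 1 / 2 := by
      have := hf1.eventually (Metric.ball_mem_nhds (1:ℂ) (show (0:ℝ) < 1 / 2 by norm_num))
      filter_upwards [this] with z hz
      exact mem_ball_iff_norm.1 hz
    rw [← comap_norm_atTop] at h1
    obtain ⟨R, hR⟩ := (eventually_atTop.1 (eventually_comap.1 h1))
    exact ⟨R, fun z hz => (hR ‖z‖ hz.le z rfl).le⟩
  set R₁ := max (max R₀ 1) R₂
  have hR10 : ∀ z : ℂ, R₁ < ‖z‖ → R₀ < ‖z‖ := fun z hz => ((le_max_left _ _).trans (le_max_left _ _)).trans_lt hz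
  have hfc : ∀ z : ℂ, R₁ < ‖z‖ → ‖f z - 1‖ ≤ 1 / 2 := fun z hz => hR₂ z ((le_max_right _ _).trans_lt hz)
  have hge : ∀ z : ℂ, R₁ < ‖z‖ → 1 / 2 ≤ ‖f z‖ := by
    intro z hz
    have h1 := hfc z hz
    have h2 := norm_sub_norm_le (1:ℂ) (f z)
    rw [norm_sub_rev, norm_one] at h2
    linarith
  have hle : ∀ z : ℂ, R₁ < ‖z‖ → ‖f z‖ ≤ 2 := by
    intro z hz
    have h1 := hfc z hz
    have h2 := norm_sub_norm_le (f z) (1:ℂ)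
    rw [norm_one] at h2
    linarith
  have hbr : Br A B f {z | R₁ < ‖z‖} := by
    intro z hz
    have hz1 : R₁ < ‖z‖ := hz
    have hz0 := hR10 z hz1
    have hAz : A.eval z ≠ 0 := by
      rw [hA, eval_prod, Finset.prod_ne_zero_iff]
      intro i _
      simp only [eval_sub, eval_X, eval_C]
      refine sub_ne_zero.2 fun h => ?_
      have := hR i
      rw [← h] at this
      linarith
    have hfz : f z ≠ 0 := by
      intro h
      have := hge z hz1
      rw [h, norm_zero] at this; norm_num at this
    refine ⟨hfz, hAz, ?_⟩
    have ho : IsOpen {y : ℂ | R₀ < ‖y‖} := isOpen_lt continuous_const continuous_norm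
    have hd := (hfd.differentiableAt (ho.mem_nhds hz0)).hasDerivAt
    refine hd.congr_deriv ?_
    have := hfp z hz0
    rw [eq_div_iff hAz, mul_comm]; exact this
  have o1 := fun n => ode1_of (A := A) (B := B) (P := P n) (H := H n) (G := Cn n) (N := (n:ℂ) * ((n:ℂ) + 1)) (R := R₁)
    fun z hz => hODE n _ (Or.inl rfl) z (hR10 z hz)
  have o2 := fun n => ode2_of (A := A) (B := B) (Q := Q n) (H := H n) (G := Cn n) (N := (n:ℂ) * ((n:ℂ) + 1)) (R := R₁) hbr
    fun z hz => hODE n _ (Or.inr (Or.inl rfl)) z (hR10 z hz)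
  choose κ hκ using fun n => wr_of (hH n).1 (o1 n) (o2 n)
  have hκ0 : ∀ n, κ n ≠ 0 := by
    intro n h
    have := kappa_ne hA0 (hP0 n) (hQ0 n) hno
    rw [hκ n, h] at this
    simp at this
  set S : ℕ → ℝ := fun n => ∑ i ∈ Finset.range (p - 2 + 1), ‖(H n).coeff i‖ with hS
  have hS0 : ∀ n, 0 < S n := by
    intro n
    have h1 : ‖(H n).coeff (p - 2)‖ ≤ S n :=
      Finset.single_le_sum (f := fun i => ‖(H n).coeff i‖) (fun i _ => norm_nonneg _) (Finset.mem_range.2 (Nat.lt_succ_self _))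
    have h2 : (H n).coeff (p - 2) = 1 := by rw [← (hH n).2]; exact (hH n).1
    rw [h2, norm_one] at h1
    linarith
  set t : ℕ → ℂ := fun n => ((S n)⁻¹ : ℝ) with ht
  have ht0 : ∀ n, t n ≠ 0 := fun n => by
    rw [ht]; exact Complex.ofReal_ne_zero.2 (inv_ne_zero (hS0 n).ne')
  have hCc : ∀ n : ℕ, (C ((n:ℂ) * ((n:ℂ) + 1)) : ℂ[X]) = (n : ℂ[X]) * ((n : ℂ[X]) + 1) := by
    intro n; simp
  have hnH : ∀ n, ∑ i ∈ Finset.range (p - 2 + 1), ‖(C (t n) * H n).coeff i‖ = 1 := by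
    intro n
    simp only [coeff_C_mul, norm_mul]
    rw [← Finset.mul_sum]
    have : ‖t n‖ = (S n)⁻¹ := by
      rw [ht]; simp only [Complex.norm_real, Real.norm_eq_abs]
      rw [abs_of_pos (inv_pos.2 (hS0 n))]
    rw [this]
    exact inv_mul_cancel₀ (hS0 n).ne'
  have hdH : ∀ n, (C (t n) * H n).natDegree ≤ p - 2 := fun n => (natDegree_C_mul_le _ _).trans (hH n).2.le
  have hdG : ∀ n, (C (t n) * Cn n).natDegree ≤ 2 * p - 4 := fun n => (natDegree_C_mul_le _ _).trans (hC n).2.le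
  have o1' : ∀ n : ℕ, A * (C (t n) * H n) * derivative (derivative (P n))
      + ((derivative A - B) * (C (t n) * H n) - A * derivative (C (t n) * H n)) * derivative (P n)
      = (n : ℂ[X]) * ((n : ℂ[X]) + 1) * (C (t n) * Cn n) * P n := by
    intro n
    have h := o1 n
    rw [hCc] at h
    rw [derivative_C_mul]
    linear_combination C (t n) * h
  obtain ⟨K, hK⟩ := G_bound A B (p - 2) (2 * p - 4)
  refine ⟨R₁, t, fun n => κ n / t n, ht0, ⟨hno, hA0, (le_max_right _ _).trans (le_max_left _ _), hbr, hge, hle, fun n => (hdegP n).le, fun n => (hdegQ n).le, ?_, fun n _ => o1' n, ?_, ?_, ?_,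
    fun n _ => hdH n, fun n _ => hnH n, ⟨_, fun n _ => hdG n⟩, ⟨K, fun n hn => hK n hn (P n) _ _ (hP0 n) (hdegP n).le (hdH n) (hnH n) (hdG n) (o1' n)⟩⟩⟩
  · intro n
    obtain ⟨M, _, hM⟩ := hnormal n
    exact ⟨M, hM⟩
  · intro n _
    have h := o2 n
    rw [hCc] at h
    rw [derivative_C_mul]
    linear_combination C (t n) * h
  · intro n _
    rw [hκ n, ← mul_assoc, ← C_mul, div_mul_cancel₀ _ (ht0 n)]
  · intro n _
    exact div_ne_zero (hκ0 n) (ht0 n)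

lemma root_sum (s : Multiset ℂ) (z : ℂ) (h : ∀ ζ ∈ s, ζ ≠ z) :
    (s.map fun ζ => X - C ζ).prod.eval z ≠ 0 ∧
    (derivative (s.map fun ζ => X - C ζ).prod).eval z = (s.map fun ζ => (z - ζ)⁻¹).sum * (s.map fun ζ => X - C ζ).prod.eval z ∧
    (derivative (s.map fun ζ => X - C ζ).prod).eval z ^ 2 - (derivative (derivative (s.map fun ζ => X - C ζ).prod)).eval z * (s.map fun ζ => X - C ζ).prod.eval z
      = (s.map fun ζ => ((z - ζ)⁻¹) ^ 2).sum * (s.map fun ζ => X - C ζ).prod.eval z ^ 2 := by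
  induction s using Multiset.induction with
  | empty => simp
  | cons ζ s ih =>
    obtain ⟨h1, h2, h3⟩ := ih fun ξ hξ => h ξ (Multiset.mem_cons_of_mem hξ)
    have hu : z - ζ ≠ 0 := sub_ne_zero.2 (h ζ (Multiset.mem_cons_self ζ s)).symm
    simp only [Multiset.map_cons, Multiset.prod_cons, Multiset.sum_cons]
    set q := (s.map fun ζ => X - C ζ).prod
    simp only [derivative_mul, derivative_sub, derivative_X, derivative_C, eval_mul, eval_add, eval_sub, eval_X, eval_C, eval_one, eval_zero, derivative_add, derivative_one, sub_zero, one_mul]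
    refine ⟨mul_ne_zero hu h1, ?_, ?_⟩
    · rw [h2]; field_simp
    · have : ((z - ζ)⁻¹ ^ 2 + (s.map fun ζ => ((z - ζ)⁻¹) ^ 2).sum) * ((z - ζ) * eval z q) ^ 2
          = eval z q ^ 2 + (z - ζ) ^ 2 * ((s.map fun ζ => ((z - ζ)⁻¹) ^ 2).sum * eval z q ^ 2) := by field_simp
      rw [this, ← h3]
      ring

lemma root_sum' {p : ℂ[X]} (hp : p ≠ 0) {z : ℂ} (hz : p.eval z ≠ 0) :
    (derivative p).eval z / p.eval z = (p.roots.map fun ζ => (z - ζ)⁻¹).sum ∧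
    ((derivative p).eval z / p.eval z) ^ 2 - (derivative (derivative p)).eval z / p.eval z = (p.roots.map fun ζ => ((z - ζ)⁻¹) ^ 2).sum := by
  have hf : C p.leadingCoeff * (p.roots.map fun ζ => X - C ζ).prod = p :=
    C_leadingCoeff_mul_prod_multiset_X_sub_C (splits_iff_card_roots.1 (IsAlgClosed.splits p))
  obtain ⟨h1, h2, h3⟩ := root_sum p.roots z (fun ζ hζ h => hz (by rw [← h]; exact (mem_roots hp).1 hζ))
  set q := (p.roots.map fun ζ => X - C ζ).prod
  have hl : p.leadingCoeff ≠ 0 := leadingCoeff_ne_zero.2 hp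
  set S1 := (p.roots.map fun ζ => (z - ζ)⁻¹).sum
  set S2 := (p.roots.map fun ζ => ((z - ζ)⁻¹) ^ 2).sum
  have e0 : p.eval z = p.leadingCoeff * q.eval z := by conv_lhs => rw [← hf]; simp
  have e1 : (derivative p).eval z = p.leadingCoeff * (derivative q).eval z := by conv_lhs => rw [← hf]; simp
  have e2 : (derivative (derivative p)).eval z = p.leadingCoeff * (derivative (derivative q)).eval z := by conv_lhs => rw [← hf]; simp
  rw [e0, e1, e2]
  rw [mul_div_mul_left _ _ hl, mul_div_mul_left _ _ hl]
  constructor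
  · rw [h2, mul_div_cancel_right₀ _ h1]
  · rw [eq_comm, ← mul_left_inj' (pow_ne_zero 2 h1), ← h3]
    field_simp

lemma msum_norm (s : Multiset ℂ) (g : ℂ → ℂ) (c : ℝ) (h : ∀ ζ ∈ s, ‖g ζ‖ ≤ c) : ‖(s.map g).sum‖ ≤ s.card * c := by
  induction s using Multiset.induction with
  | empty => simp
  | cons ζ s ih =>
    rw [Multiset.map_cons, Multiset.sum_cons, Multiset.card_cons]
    push_cast
    have h1 := ih fun ξ hξ => h ξ (Multiset.mem_cons_of_mem hξ)
    have h2 := h ζ (Multiset.mem_cons_self ζ s)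
    have h3 := norm_add_le (g ζ) (s.map g).sum
    linarith

open Classical in
lemma msum_split (s : Multiset ℂ) (g : ℂ → ℂ) (p : ℂ → Prop) {n M : ℕ} {c b : ℝ} (hc : 0 ≤ c) (hb : 0 ≤ b) (hn : s.card ≤ n) (hM : (s.filter p).card ≤ M)
    (h1 : ∀ ζ ∈ s, p ζ → ‖g ζ‖ ≤ c) (h2 : ∀ ζ ∈ s, ¬ p ζ → ‖g ζ‖ ≤ b) : ‖(s.map g).sum‖ ≤ M * c + n * b := by
  rw [← Multiset.filter_add_not p s, Multiset.map_add, Multiset.sum_add]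
  refine (norm_add_le _ _).trans (add_le_add ?_ ?_)
  · refine (msum_norm _ g c fun ζ hζ => ?_).trans ?_
    · exact h1 ζ (Multiset.mem_filter.1 hζ).1 (Multiset.mem_filter.1 hζ).2
    · gcongr
  · refine (msum_norm _ g b fun ζ hζ => ?_).trans ?_
    · exact h2 ζ (Multiset.mem_filter.1 hζ).1 (Multiset.mem_filter.1 hζ).2
    · have : ((s.filter fun a => ¬ p a).card) ≤ n := (Multiset.card_le_card (Multiset.filter_le _ _)).trans hn
      gcongr

lemma bc {S : ℕ → Multiset ℂ} {M : ℕ} (h : ∀ᶠ n in atTop, (S n).card ≤ M) :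
    ∀ᵐ z : ℂ, ∀ᶠ n : ℕ in atTop, ∀ ζ ∈ S n, (n : ℝ) ^ (-(3 / 4) : ℝ) ≤ ‖z - ζ‖ := by
  classical
  set T : ℕ → Set ℂ := fun n => if (S n).card ≤ M then ⋃ ζ ∈ (S n).toFinset, Metric.ball ζ ((n : ℝ) ^ (-(3 / 4) : ℝ)) else ∅ with hT
  have hvol : ∀ n, volume (T n) ≤ ENNReal.ofReal (M * Real.pi * (n : ℝ) ^ (-(3 / 2) : ℝ)) := by
    intro n
    rw [hT]
    dsimp only
    split_ifs with hc
    · refine (measure_biUnion_finset_le _ _).trans ?_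
      have : ∀ ζ ∈ (S n).toFinset, volume (Metric.ball ζ ((n : ℝ) ^ (-(3 / 4) : ℝ))) ≤ ENNReal.ofReal (Real.pi * (n : ℝ) ^ (-(3 / 2) : ℝ)) := by
        intro ζ _
        rw [Complex.volume_ball, ← ENNReal.ofReal_pow (by positivity)]
        have e1 : ((n : ℝ) ^ (-(3 / 4) : ℝ)) ^ 2 = (n : ℝ) ^ (-(3 / 2) : ℝ) := by
          rw [← Real.rpow_natCast, ← Real.rpow_mul (by positivity)]; norm_num
        have e2 : (NNReal.pi : ENNReal) = ENNReal.ofReal Real.pi := by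
          rw [ENNReal.ofReal, ← NNReal.coe_real_pi, Real.toNNReal_coe]
        rw [e1, e2, mul_comm, ← ENNReal.ofReal_mul Real.pi_pos.le]
      refine (Finset.sum_le_card_nsmul _ _ _ this).trans ?_
      rw [nsmul_eq_mul, ← ENNReal.ofReal_natCast, ← ENNReal.ofReal_mul (by positivity), mul_assoc]
      apply ENNReal.ofReal_le_ofReal
      have h3 : ((S n).toFinset.card : ℝ) ≤ M := by exact_mod_cast (Multiset.toFinset_card_le _).trans hc
      gcongr
    · simp
  have hsum : ∑' n, volume (T n) ≠ ⊤ := by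
    refine ne_top_of_le_ne_top ?_ (ENNReal.tsum_le_tsum hvol)
    refine Summable.tsum_ofReal_ne_top ?_
    exact (Real.summable_nat_rpow.2 (by norm_num)).mul_left _
  filter_upwards [ae_eventually_notMem hsum] with z hz
  filter_upwards [hz, h] with n hn hc ζ hζ
  by_contra hlt
  apply hn
  rw [hT]
  dsimp only
  rw [if_pos hc]
  refine Set.mem_biUnion (Multiset.mem_toFinset.2 hζ) ?_
  rw [mem_ball_iff_norm]
  exact not_le.1 hlt

lemma det_bound {A B P H G : ℂ[X]} {n M d : ℕ} {s r K : ℝ} {z : ℂ} (hs : 1 ≤ s) (hn : (n : ℝ) = s ^ 4) (hr : 0 < r) (hK : 0 ≤ K)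
    (hP : P ≠ 0) (hH : H ≠ 0) (hdP : P.natDegree ≤ n) (hdH : H.natDegree ≤ d) (hA : A.eval z ≠ 0)
    (hM : rcount P z r ≤ M) (hPz : ∀ ζ ∈ P.roots, (s ^ 3)⁻¹ ≤ ‖z - ζ‖) (hHz : ∀ ζ ∈ H.roots, (s ^ 3)⁻¹ ≤ ‖z - ζ‖)
    (hKA : ‖(derivative A - B).eval z / A.eval z‖ ≤ K)
    (hode : A * H * derivative (derivative P) + ((derivative A - B) * H - A * derivative H) * derivative P
      = (n : ℂ[X]) * ((n : ℂ[X]) + 1) * G * P) :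
    ‖((derivative P).eval z / (n * P.eval z)) ^ 2 - G.eval z / (A.eval z * H.eval z)‖
      ≤ (2 * (M + (r⁻¹) ^ 2) + (M + r⁻¹) ^ 2 + (K + d) * (M + r⁻¹)) / s := by
  have hs0 : 0 < s := by linarith
  have hs3 : 0 < (s ^ 3)⁻¹ := by positivity
  have hPne : P.eval z ≠ 0 := by
    intro h
    have := hPz z ((mem_roots hP).2 h)
    rw [sub_self, norm_zero] at this; linarith
  have hHne : H.eval z ≠ 0 := by
    intro h
    have := hHz z ((mem_roots hH).2 h)
    rw [sub_self, norm_zero] at this; linarith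
  have hinv : ∀ ζ, (s ^ 3)⁻¹ ≤ ‖z - ζ‖ → ‖(z - ζ)⁻¹‖ ≤ s ^ 3 := by
    intro ζ h
    rw [norm_inv]
    exact inv_le_of_inv_le₀ (by positivity) h
  have hfar : ∀ ζ, ¬ ζ ∈ Metric.ball z r → ‖(z - ζ)⁻¹‖ ≤ r⁻¹ := by
    intro ζ h
    rw [norm_inv]
    rw [mem_ball_iff_norm, not_lt, norm_sub_rev] at h
    exact inv_anti₀ hr h
  obtain ⟨p1, p2⟩ := root_sum' hP hPne
  obtain ⟨q1, -⟩ := root_sum' hH hHne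
  have hcard : P.roots.card ≤ n := (card_roots' P).trans hdP
  have hL := msum_split P.roots (fun ζ => (z - ζ)⁻¹) (fun ζ => ζ ∈ Metric.ball z r) (n := n) (M := M) (c := s ^ 3) (b := r⁻¹)
    (by positivity) (by positivity) hcard (by unfold rcount at hM; convert hM)
    (fun ζ hζ _ => hinv ζ (hPz ζ hζ)) (fun ζ _ h => hfar ζ h)
  have hS := msum_split P.roots (fun ζ => ((z - ζ)⁻¹) ^ 2) (fun ζ => ζ ∈ Metric.ball z r) (n := n) (M := M) (c := (s ^ 3) ^ 2) (b := (r⁻¹) ^ 2)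
    (by positivity) (by positivity) hcard (by unfold rcount at hM; convert hM)
    (fun ζ hζ _ => by rw [norm_pow]; have := hinv ζ (hPz ζ hζ); gcongr) (fun ζ _ h => by rw [norm_pow]; have := hfar ζ h; gcongr)
  have hHb : ‖(derivative H).eval z / H.eval z‖ ≤ d * s ^ 3 := by
    rw [q1]
    refine (msum_norm _ _ (s ^ 3) fun ζ hζ => hinv ζ (hHz ζ hζ)).trans ?_
    have : H.roots.card ≤ d := (card_roots' H).trans hdH
    gcongr
  rw [← p1] at hL
  rw [← p2] at hS
  set L := (derivative P).eval z / P.eval z with hLd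
  set T := (derivative (derivative P)).eval z / P.eval z with hTd
  set b := (derivative A - B).eval z / A.eval z - (derivative H).eval z / H.eval z with hbd
  have hbb : ‖b‖ ≤ K + d * s ^ 3 := (norm_sub_le _ _).trans (add_le_add hKA hHb)
  have hn0 : (0:ℝ) < n := by rw [hn]; positivity
  have hnC : (n:ℂ) ≠ 0 := by
    intro h; rw [← Complex.norm_natCast, h, norm_zero] at hn0; exact lt_irrefl _ hn0
  have hn1C : (n:ℂ) + 1 ≠ 0 := by exact_mod_cast Nat.succ_ne_zero n
  have hV : G.eval z / (A.eval z * H.eval z) = (T + b * L) / (n * (n + 1)) := by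
    have ho := congrArg (eval z) hode
    rw [eval_add, eval_mul, eval_mul, eval_mul, eval_sub, eval_mul, eval_mul, eval_mul, eval_mul, eval_mul] at ho
    simp only [eval_natCast, eval_add, eval_one] at ho
    rw [hTd, hbd, hLd]
    field_simp
    linear_combination -ho
  have hid : ((derivative P).eval z / (n * P.eval z)) ^ 2 - G.eval z / (A.eval z * H.eval z)
      = (L ^ 2 - T) / n ^ 2 + T / (n ^ 2 * (n + 1)) - b * L / (n * (n + 1)) := by
    rw [hV]
    have : (derivative P).eval z / (n * P.eval z) = L / n := by rw [hLd]; field_simp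
    rw [this]
    field_simp
    ring
  rw [hid]
  have hri : 0 < r⁻¹ := by positivity
  have hnn : ‖(n:ℂ)‖ = s ^ 4 := by rw [Complex.norm_natCast, hn]
  have hnn1 : ‖(n:ℂ) + 1‖ = s ^ 4 + 1 := by
    have : ((n:ℂ) + 1) = ((n + 1 : ℕ) : ℂ) := by push_cast; rfl
    rw [this, Complex.norm_natCast]; push_cast; rw [hn]
  have s1 : s ^ 3 ≤ s ^ 4 := pow_le_pow_right₀ hs (by norm_num)
  have hM0 : (0:ℝ) ≤ M := by positivity
  have hL' : ‖L‖ ≤ (M + r⁻¹) * s ^ 4 := by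
    refine hL.trans ?_
    rw [hn]
    have : M * s ^ 3 ≤ M * s ^ 4 := by gcongr
    linarith
  have hS' : ‖L ^ 2 - T‖ ≤ (M + (r⁻¹) ^ 2) * s ^ 7 := by
    refine hS.trans ?_
    rw [hn, ← pow_mul]
    have e1 : s ^ (3 * 2) ≤ s ^ 7 := pow_le_pow_right₀ hs (by norm_num)
    have e2 : s ^ 4 ≤ s ^ 7 := pow_le_pow_right₀ hs (by norm_num)
    have e3 : M * s ^ (3 * 2) ≤ M * s ^ 7 := by gcongr
    have e4 : s ^ 4 * (r⁻¹) ^ 2 ≤ s ^ 7 * (r⁻¹) ^ 2 := by gcongr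
    exact (add_le_add e3 e4).trans (le_of_eq (by ring))
  have hT' : ‖T‖ ≤ ((M + r⁻¹) ^ 2 + (M + (r⁻¹) ^ 2)) * s ^ 8 := by
    have e1 : T = L ^ 2 - (L ^ 2 - T) := by ring
    rw [e1]
    refine (norm_sub_le _ _).trans ?_
    rw [norm_pow]
    have e2 : s ^ 7 ≤ s ^ 8 := pow_le_pow_right₀ hs (by norm_num)
    have e3 : ‖L‖ ^ 2 ≤ ((M + r⁻¹) * s ^ 4) ^ 2 := by gcongr
    have e4 : (M + (r⁻¹) ^ 2) * s ^ 7 ≤ (M + (r⁻¹) ^ 2) * s ^ 8 := by gcongr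
    nlinarith
  have t1 : ‖(L ^ 2 - T) / n ^ 2‖ ≤ (M + (r⁻¹) ^ 2) / s := by
    rw [norm_div, norm_pow, hnn, div_le_div_iff₀ (by positivity) hs0]
    have := mul_le_mul_of_nonneg_right hS' hs0.le
    refine this.trans (le_of_eq ?_)
    ring
  have t2 : ‖T / (n ^ 2 * (n + 1))‖ ≤ ((M + r⁻¹) ^ 2 + (M + (r⁻¹) ^ 2)) / s := by
    rw [norm_div, norm_mul, norm_pow, hnn, hnn1, div_le_div_iff₀ (by positivity) hs0]
    have e1 := mul_le_mul_of_nonneg_right hT' hs0.le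
    refine e1.trans ?_
    have e2 : s ≤ s ^ 4 + 1 := by
      have : s ^ 1 ≤ s ^ 4 := pow_le_pow_right₀ hs (by norm_num)
      linarith
    have : ((M + r⁻¹) ^ 2 + (M + (r⁻¹) ^ 2)) * s ^ 8 * s ≤ ((M + r⁻¹) ^ 2 + (M + (r⁻¹) ^ 2)) * s ^ 8 * (s ^ 4 + 1) := by gcongr
    refine this.trans (le_of_eq ?_)
    ring
  have t3 : ‖b * L / (n * (n + 1))‖ ≤ (K + d) * (M + r⁻¹) / s := by
    rw [norm_div, norm_mul, norm_mul, hnn, hnn1, div_le_div_iff₀ (by positivity) hs0]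
    have e0 : ‖b‖ ≤ (K + d) * s ^ 3 := by
      refine hbb.trans ?_
      have : 1 ≤ s ^ 3 := one_le_pow₀ hs
      nlinarith
    have e1 : ‖b‖ * ‖L‖ * s ≤ ((K + d) * s ^ 3) * ((M + r⁻¹) * s ^ 4) * s := by gcongr
    refine e1.trans ?_
    have : ((K + d) * s ^ 3) * ((M + r⁻¹) * s ^ 4) * s = (K + d) * (M + r⁻¹) * (s ^ 4 * s ^ 4) := by ring
    rw [this]
    gcongr
    linarith
  refine (norm_sub_le _ _).trans ?_
  refine (add_le_add ((norm_add_le _ _).trans (add_le_add t1 t2)) t3).trans (le_of_eq ?_)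
  ring

lemma local_conv {A B : ℂ[X]} {f : ℂ → ℂ} {R₀ : ℝ} {P Q H G : ℕ → ℂ[X]} {κ : ℕ → ℂ} {d : ℕ} (c : Ctx A B f R₀ P Q H G κ d)
    (hP : ∀ n, P n ≠ 0) (hH : ∀ n, H n ≠ 0) {z₀ : ℂ} {ρ : ℝ} (hρ : 0 < ρ) {M : ℕ} (hM : ∀ᶠ n in atTop, rcount (P n) z₀ ρ ≤ M) :
    ∀ᵐ z : ℂ, z ∈ Metric.ball z₀ (ρ / 2) → Tendsto (fun n : ℕ =>
      ((P n).derivative.eval z / ((n : ℂ) * (P n).eval z)) ^ 2 - (G n).eval z / (A.eval z * (H n).eval z)) atTop (𝓝 0) := by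
  classical
  have b1 := bc (S := fun n => (P n).roots.filter fun ζ => ζ ∈ Metric.ball z₀ ρ) (M := M) (by
    filter_upwards [hM] with n hn
    unfold rcount at hn; convert hn)
  have b2 := bc (S := fun n => (H n).roots) (M := d) (by
    filter_upwards [eventually_ge_atTop 1] with n hn
    exact (card_roots' _).trans (c.degH n hn))
  have b3 : ∀ᵐ z : ℂ, A.eval z ≠ 0 := by
    have : (volume : Measure ℂ) {z | A.IsRoot z} = 0 := (A.finite_setOf_isRoot c.hA).measure_zero _
    rw [ae_iff]
    simpa using this
  filter_upwards [b1, b2, b3] with z h1 h2 h3 hz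
  have hz' := mem_ball_iff_norm.1 hz
  set s : ℕ → ℝ := fun n => (n : ℝ) ^ (1 / 4 : ℝ) with hs
  have hst : Tendsto s atTop atTop := (tendsto_rpow_atTop (by norm_num)).comp tendsto_natCast_atTop_atTop
  have hs4 : ∀ n : ℕ, (n : ℝ) = s n ^ 4 := by
    intro n
    rw [hs]; dsimp only
    rw [← Real.rpow_natCast, ← Real.rpow_mul (by positivity)]; norm_num
  have hs3 : ∀ n : ℕ, (n : ℝ) ^ (-(3 / 4) : ℝ) = (s n ^ 3)⁻¹ := by
    intro n
    rw [hs]; dsimp only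
    rw [← Real.rpow_natCast, ← Real.rpow_mul (by positivity), ← Real.rpow_neg (by positivity)]; norm_num
  have hsmall : ∀ᶠ n in atTop, (s n ^ 3)⁻¹ ≤ ρ / 2 := by
    have : Tendsto (fun n => (s n ^ 3)⁻¹) atTop (𝓝 0) := ((tendsto_pow_atTop (by norm_num)).comp hst).inv_tendsto_atTop
    exact this.eventually_le_const (by positivity)
  set K := ‖(derivative A - B).eval z / A.eval z‖ with hK
  set W : ℝ := 2 * (M + ((ρ / 2)⁻¹) ^ 2) + (M + (ρ / 2)⁻¹) ^ 2 + (K + d) * (M + (ρ / 2)⁻¹) with hW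
  have hlim : Tendsto (fun n => W / s n) atTop (𝓝 0) := hst.const_div_atTop W
  refine squeeze_zero_norm' ?_ hlim
  filter_upwards [h1, h2, hsmall, hM, hst.eventually_ge_atTop 1, eventually_ge_atTop 1] with n e1 e2 e3 e4 e5 e6
  rw [hs3] at e1 e2
  refine det_bound e5 (hs4 n) (half_pos hρ) (norm_nonneg _) (hP n) (hH n) (c.degP n) (c.degH n e6) h3 ?_ ?_ e2 le_rfl (c.ode1 n e6)
  · refine le_trans ?_ e4
    unfold rcount
    refine Multiset.card_le_card (Multiset.monotone_filter_right _ ?_)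
    intro ζ hζ
    have := mem_ball_iff_norm.1 hζ
    refine mem_ball_iff_norm.2 ?_
    have := norm_sub_le_norm_sub_add_norm_sub ζ z z₀
    linarith
  · intro ζ hζ
    by_cases h : ζ ∈ Metric.ball z₀ ρ
    · exact e1 ζ (Multiset.mem_filter.2 ⟨hζ, h⟩)
    · refine e3.trans ?_
      rw [mem_ball_iff_norm, not_lt] at h
      have := norm_sub_le_norm_sub_add_norm_sub ζ z z₀
      rw [norm_sub_rev ζ z] at this
      linarith

lemma zero_case {f : ℂ → ℂ} (hf1 : Tendsto f (cobounded ℂ) (𝓝 1)) {P Q : ℂ[X]} (hP : P.natDegree = 0) (hQ : Q.natDegree = 0)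
    {M : ℂ} (hM : M ≠ 0) (h : Tendsto (fun z : ℂ => z ^ (0 + 1) * (Q.eval z * f z - P.eval z)) (cobounded ℂ) (𝓝 M)) : P ≠ 0 ∧ Q ≠ 0 := by
  obtain ⟨x, rfl⟩ := natDegree_eq_zero.1 hP
  obtain ⟨y, rfl⟩ := natDegree_eq_zero.1 hQ
  simp only [eval_C, zero_add, pow_one] at h
  have h1 : Tendsto (fun z : ℂ => z⁻¹ * (z * (y * f z - x))) (cobounded ℂ) (𝓝 (0 * M)) := (tendsto_inv₀_cobounded).mul h
  have h2 : Tendsto (fun z : ℂ => y * f z - x) (cobounded ℂ) (𝓝 (y * 1 - x)) := (hf1.const_mul y).sub_const x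
  have h3 : Tendsto (fun z : ℂ => y * f z - x) (cobounded ℂ) (𝓝 (0 * M)) := by
    refine h1.congr' ?_
    have : ∀ᶠ z : ℂ in cobounded ℂ, z ≠ 0 := eventually_ne_cobounded 0
    filter_upwards [this] with z hz
    field_simp
  have h4 := tendsto_nhds_unique h2 h3
  have hxy : y = x := by linear_combination h4
  subst hxy
  have hy : y ≠ 0 := by
    rintro rfl
    apply hM
    refine tendsto_nhds_unique h ?_
    simp
  exact ⟨C_ne_zero.2 hy, C_ne_zero.2 hy⟩

/-- Let `f ∈ 𝓛_A` with distinct branch points `a₁, …, a_p` (`p ≥ 2`),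
`A = ∏ (X − a_j)`, `B = A f'/f = Σ_j α_j ∏_{i≠j} (X − a_i)`.  Assume every index `n` is
normal, let `P_n, Q_n ∈ 𝒫_n` be the Padé polynomials of order `n` for `f` with
`deg P_n = n`, and let `H_n` (monic, degree `p−2`) and `C_n` (monic, degree `2p−4`) be
the polynomials for which `P_n`, `Q_n f` and `R_n = Q_n f − P_n` satisfy the Laguerre
equation `A H_n w'' + [(A'−B)H_n − A H_n'] w' − n(n+1) C_n w = 0` near `∞`.  Set
`v_n = P_n'/(n P_n)`.  Then for `m₂`-almost every `z ∈ ℂ`,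
`v_n(z)² − C_n(z)/(A(z)H_n(z)) → 0` as `n → ∞`. -/
theorem stmt_10 (p : ℕ) (hp : 2 ≤ p) (a : Fin p → ℂ) (ha : Function.Injective a)
    (α : Fin p → ℂ) (hα : ∀ j, ∀ m : ℤ, α j ≠ (m : ℂ)) (hsum : ∑ j, α j = 0)
    (A B : Polynomial ℂ)
    (hA : A = ∏ j, (X - C (a j)))
    (hB : B = ∑ j, C (α j) * ∏ i ∈ Finset.univ.erase j, (X - C (a i)))
    (f : ℂ → ℂ) (R₀ : ℝ) (hR : ∀ j, ‖a j‖ < R₀)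
    (hfd : DifferentiableOn ℂ f {z : ℂ | R₀ < ‖z‖})
    (hf1 : Tendsto f (cobounded ℂ) (𝓝 1))
    (hfp : ∀ z ∈ {z : ℂ | R₀ < ‖z‖}, A.eval z * deriv f z = B.eval z * f z)
    (P Q : ℕ → Polynomial ℂ)
    (hdegP : ∀ n, (P n).natDegree = n) (hdegQ : ∀ n, (Q n).natDegree = n)
    (hPade : ∀ n, (fun z : ℂ => (Q n).eval z * f z - (P n).eval z)
      =O[cobounded ℂ] fun z => (z ^ (n + 1))⁻¹)
    (hnormal : ∀ n, ∃ M : ℂ, M ≠ 0 ∧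
      Tendsto (fun z : ℂ => z ^ (n + 1) * ((Q n).eval z * f z - (P n).eval z))
        (cobounded ℂ) (𝓝 M))
    (H Cn : ℕ → Polynomial ℂ)
    (hH : ∀ n, (H n).Monic ∧ (H n).natDegree = p - 2)
    (hC : ∀ n, (Cn n).Monic ∧ (Cn n).natDegree = 2 * p - 4)
    (hODE : ∀ n, ∀ w : ℂ → ℂ,
      ((w = fun z => (P n).eval z) ∨ (w = fun z => (Q n).eval z * f z) ∨
        (w = fun z => (Q n).eval z * f z - (P n).eval z)) →
      ∀ z ∈ {z : ℂ | R₀ < ‖z‖},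
        A.eval z * (H n).eval z * iteratedDeriv 2 w z
          + (((A.derivative - B) * H n).eval z - (A * (H n).derivative).eval z) * deriv w z
          - (n : ℂ) * ((n : ℂ) + 1) * (Cn n).eval z * w z = 0) :
    ∀ᵐ z ∂(volume : Measure ℂ),
      Tendsto (fun n : ℕ =>
          ((P n).derivative.eval z / ((n : ℂ) * (P n).eval z)) ^ 2
            - (Cn n).eval z / (A.eval z * (H n).eval z))
        atTop (𝓝 0) := by
  have hPQ : ∀ n, P n ≠ 0 ∧ Q n ≠ 0 := by
    intro n
    rcases Nat.eq_zero_or_pos n with rfl | hn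
    · obtain ⟨M, hM0, hM⟩ := hnormal 0
      exact zero_case hf1 (hdegP 0) (hdegQ 0) hM0 hM
    · refine ⟨fun h => ?_, fun h => ?_⟩
      · have := hdegP n
        rw [h, natDegree_zero] at this; omega
      · have := hdegQ n
        rw [h, natDegree_zero] at this; omega
  obtain ⟨R₁, t, κ, ht, c⟩ := mkCtx p hp a ha α hα A B hA hB f R₀ hR hfd hf1 hfp P Q (fun n => (hPQ n).1) (fun n => (hPQ n).2)
    hdegP hdegQ hnormal H Cn hH hC hODE
  have hz := c.zero_count fun n => (hPQ n).1
  have hH0 : ∀ n, C (t n) * H n ≠ 0 := fun n => mul_ne_zero (C_ne_zero.2 (ht n)) (hH n).1.ne_zero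
  set good : Set ℂ := {z₀ | A.eval z₀ ≠ 0 ∧ ∃ ρ > 0, ∃ M : ℕ, ∀ᶠ n in atTop, rcount (P n) z₀ ρ ≤ M} with hgood
  set bad : Set ℂ := {z | ¬ Tendsto (fun n : ℕ =>
      ((P n).derivative.eval z / ((n : ℂ) * (P n).eval z)) ^ 2 - (C (t n) * Cn n).eval z / (A.eval z * (C (t n) * H n).eval z)) atTop (𝓝 0)} with hbad
  have h1 : volume goodᶜ = 0 := hz
  have h2 : volume (bad ∩ good) = 0 := by
    refine measure_null_of_locally_null _ fun z₀ hz₀ => ?_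
    obtain ⟨_, ρ, hρ, M, hM⟩ := hz₀.2
    refine ⟨bad ∩ Metric.ball z₀ (ρ / 2), ?_, ?_⟩
    · refine mem_nhdsWithin.2 ⟨Metric.ball z₀ (ρ / 2), Metric.isOpen_ball, Metric.mem_ball_self (half_pos hρ), ?_⟩
      intro z hz
      exact ⟨hz.2.1, hz.1⟩
    · have := local_conv c (fun n => (hPQ n).1) hH0 hρ hM
      rw [ae_iff] at this
      refine measure_mono_null ?_ this
      intro z hz hcon
      exact hz.1 (hcon hz.2)
  have h3 : volume bad = 0 := by
    refine measure_mono_null (t := goodᶜ ∪ bad ∩ good) ?_ (measure_union_null h1 h2)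
    intro z hz
    by_cases hg : z ∈ good
    · exact Or.inr ⟨hz, hg⟩
    · exact Or.inl hg
  have h4 : ∀ᵐ z : ℂ, z ∉ bad := measure_eq_zero_iff_ae_notMem.1 h3
  filter_upwards [h4] with z hz
  have hz' := not_not.1 hz
  refine hz'.congr fun n => ?_
  congr 1
  rw [eval_mul, eval_mul, eval_C, mul_left_comm, mul_div_mul_left _ _ (ht n)]
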